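/- arXiv:2002.06236 — 7 statements merged into one kernel-verified Lean document; each statement's English description precedes it below -/
import Mathlib

section
/- Let X be a complex Banach space and let T be a power-bounded bounded linear operator on X. Then ‖Tⁿ(I − T)‖ → 0 as n → ∞ if and only if σ(T) ∩ 𝕋 ⊆ {1}. -/
/-- Maximum principle on the disc of centre `l` and radius `r`, with `‖l‖ = 1`: the weight
`1 + r ζ + ζ²` has modulus `|‖z‖² - 1| / r` at the points `z = l (1 + r ζ)` of the boundary circle,
and so absorbs the growth `K / |‖z‖ - 1|` of `G`. -/
theorem norm_mul_smul_le_of_norm_sub_one_bound {E : Type*} [NormedAddCommGroup E] [NormedSpace ℂ E]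
    {G : ℂ → E} {K r : ℝ} {l : ℂ} (hG : DifferentiableOn ℂ G {1}ᶜ)
    (hK : ∀ z : ℂ, ‖G z‖ * |‖z‖ - 1| ≤ K) (hl : ‖l‖ = 1) (hr : 0 < r) (hr1 : r ≤ 1)
    (hrl : r < ‖l - 1‖) {ζ : ℂ} (hζ : ‖ζ‖ ≤ 1) :
    ‖(1 + r * ζ + ζ ^ 2) • G (l * (1 + r * ζ))‖ ≤ 3 * K / r := by
  have hne : ∀ ζ : ℂ, ‖ζ‖ ≤ 1 → l * (1 + r * ζ) ≠ 1 := by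
    intro ζ hζ h
    have h1 : l - 1 = -(l * r * ζ) := by linear_combination h
    have h2 : ‖l - 1‖ = r * ‖ζ‖ := by
      rw [h1]; simp [hl, abs_of_pos hr]
    nlinarith
  have hd : DifferentiableOn ℂ (fun ζ : ℂ => (1 + r * ζ + ζ ^ 2) • G (l * (1 + r * ζ)))
      (Metric.closedBall 0 1) := by
    refine DifferentiableOn.smul (by fun_prop) (hG.comp (by fun_prop) ?_)
    intro z hz
    exact hne z (by simpa using hz)
  refine Complex.norm_le_of_forall_mem_frontier_norm_le (U := Metric.ball (0 : ℂ) 1)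
    (f := fun ζ : ℂ => (1 + r * ζ + ζ ^ 2) • G (l * (1 + r * ζ))) Metric.isBounded_ball
    (DifferentiableOn.diffContOnCl (by rwa [closure_ball _ one_ne_zero])) ?_
    (by rw [closure_ball _ one_ne_zero]; simpa using hζ)
  intro z hz
  rw [frontier_ball _ one_ne_zero, mem_sphere_zero_iff_norm] at hz
  have hw : ‖l * (1 + r * z)‖ = ‖1 + r * z‖ := by simp [hl]
  have hw2 : ‖1 + r * z‖ ≤ 2 := by
    refine (norm_add_le _ _).trans ?_
    simp [hz, abs_of_pos hr]; linarith
  have hz' : z.re ^ 2 + z.im ^ 2 = 1 := by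
    have := Complex.sq_norm z
    rw [hz, Complex.normSq_apply] at this; nlinarith
  have hfac : 1 + r * z + z ^ 2 = z * ((2 * z.re + r : ℝ) : ℂ) := by
    have : z * (starRingEnd ℂ) z = 1 := by
      rw [Complex.mul_conj, Complex.normSq_eq_norm_sq, hz]; simp
    have h2 : z + (starRingEnd ℂ) z = ((2 * z.re : ℝ) : ℂ) := Complex.add_conj z
    rw [Complex.ofReal_add, ← h2]
    linear_combination -this
  have hsq : ‖1 + r * z‖ ^ 2 - 1 = r * (2 * z.re + r) := by
    rw [Complex.sq_norm, Complex.normSq_apply]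
    simp
    linear_combination r ^ 2 * hz'
  have hq : ‖1 + r * z + z ^ 2‖ * r = |‖1 + r * z‖ - 1| * (‖1 + r * z‖ + 1) := by
    rw [hfac, norm_mul, hz, one_mul, Complex.norm_real, Real.norm_eq_abs, mul_comm,
      ← abs_of_pos hr, ← abs_mul, abs_of_pos hr, ← hsq,
      ← abs_of_nonneg (show 0 ≤ ‖1 + r * z‖ + 1 by positivity), ← abs_mul]
    congr 1; ring
  have := hK (l * (1 + r * z))
  rw [hw] at this
  rw [le_div_iff₀ hr, norm_smul]
  calc ‖1 + r * z + z ^ 2‖ * ‖G (l * (1 + r * z))‖ * r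
      = (‖G (l * (1 + r * z))‖ * |‖1 + r * z‖ - 1|) * (‖1 + r * z‖ + 1) := by
        linear_combination ‖G (l * (1 + r * z))‖ * hq
    _ ≤ 3 * K := by
        have h0 : 0 ≤ ‖G (l * (1 + r * z))‖ * |‖1 + r * z‖ - 1| := by positivity
        nlinarith [norm_nonneg (1 + r * z)]

/-- A function holomorphic off `1` with growth `K / |‖z‖ - 1|` is `O(1 / ‖z - 1‖)` near `1`. -/
theorem norm_sub_one_mul_norm_le {E : Type*} [NormedAddCommGroup E] [NormedSpace ℂ E]
    {G : ℂ → E} {K : ℝ} (hG : DifferentiableOn ℂ G {1}ᶜ)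
    (hK : ∀ z : ℂ, ‖G z‖ * |‖z‖ - 1| ≤ K) {z : ℂ} (hz : z ≠ 1) (hz1 : ‖z - 1‖ ≤ 1) :
    ‖z - 1‖ * ‖G z‖ ≤ 12 * K := by
  have hs : 0 < ‖z - 1‖ := norm_pos_iff.2 (sub_ne_zero.2 hz)
  set s := ‖z - 1‖ with hs_def
  have hz_bound := hK z
  have hG0 := norm_nonneg (G z)
  have hK0 : 0 ≤ K := le_trans (by positivity) hz_bound
  rcases le_or_gt (s / 4) |‖z‖ - 1| with h | h
  · nlinarith
  have hz0 : 0 < ‖z‖ := by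
    have := (abs_lt.1 h).1
    linarith
  have hz0' : (‖z‖ : ℂ) ≠ 0 := by exact_mod_cast hz0.ne'
  have hl : ‖z / ‖z‖‖ = 1 := by
    rw [norm_div, Complex.norm_real, norm_norm, div_self hz0.ne']
  have hl0 : z ≠ 0 := norm_pos_iff.1 hz0
  have hzl : ‖z - z / ‖z‖‖ < s / 4 := by
    have : z - z / ‖z‖ = z / ‖z‖ * ((‖z‖ - 1 : ℝ) : ℂ) := by
      push_cast; field_simp
    rw [this, norm_mul, hl, one_mul, Complex.norm_real]; exact h
  have hrl : s / 2 < ‖z / ‖z‖ - 1‖ := by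
    have := norm_sub_le_norm_sub_add_norm_sub z (z / ‖z‖) 1
    linarith
  have hs' : (s : ℂ) ≠ 0 := by exact_mod_cast hs.ne'
  obtain ⟨ζ, hζ⟩ : ∃ ζ : ℂ, ζ = ((‖z‖ - 1 : ℝ) : ℂ) / ((s / 2 : ℝ) : ℂ) := ⟨_, rfl⟩
  have hζn : ‖ζ‖ ≤ 1 / 2 := by
    rw [hζ, norm_div, Complex.norm_real, Complex.norm_real, Real.norm_eq_abs, Real.norm_eq_abs,
      abs_of_pos (half_pos hs), div_le_iff₀ (half_pos hs)]
    linarith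
  have hpt : z / ‖z‖ * (1 + ((s / 2 : ℝ) : ℂ) * ζ) = z := by
    rw [hζ]; push_cast; field_simp; ring
  have key := norm_mul_smul_le_of_norm_sub_one_bound hG hK hl (half_pos hs) (by linarith) hrl
    (hζn.trans (by norm_num))
  rw [hpt, norm_smul, le_div_iff₀ (half_pos hs)] at key
  have hlow : 1 / 2 ≤ ‖1 + ((s / 2 : ℝ) : ℂ) * ζ + ζ ^ 2‖ := by
    have h1 : ‖((s / 2 : ℝ) : ℂ) * ζ + ζ ^ 2‖ ≤ 1 / 2 := by
      refine (norm_add_le _ _).trans ?_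
      rw [norm_mul, norm_pow, Complex.norm_real, Real.norm_eq_abs, abs_of_pos (half_pos hs)]
      nlinarith [norm_nonneg ζ]
    have h2 := norm_sub_norm_le (1 : ℂ) (-(((s / 2 : ℝ) : ℂ) * ζ + ζ ^ 2))
    rw [norm_neg, norm_one, sub_neg_eq_add, ← add_assoc] at h2
    linarith
  nlinarith [mul_nonneg hG0 hs.le]

/-- A function holomorphic off `1` with growth `K / |‖z‖ - 1|` has the form `c / (z - 1)`. -/
theorem exists_sub_one_smul_eq_const {E : Type*} [NormedAddCommGroup E] [NormedSpace ℂ E]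
    [CompleteSpace E] {G : ℂ → E} {K : ℝ} (hG : DifferentiableOn ℂ G {1}ᶜ)
    (hK : ∀ z : ℂ, ‖G z‖ * |‖z‖ - 1| ≤ K) : ∃ c : E, ∀ z ≠ 1, (z - 1) • G z = c := by
  have hd : DifferentiableOn ℂ (fun z => (z - 1) • G z) (Set.univ \ {1}) := by
    rw [← Set.compl_eq_univ_sdiff]
    exact DifferentiableOn.smul (by fun_prop) hG
  have hb : BddAbove (norm ∘ (fun z => (z - 1) • G z) '' (Metric.closedBall 1 1 \ {1})) := by
    refine ⟨12 * K, ?_⟩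
    rintro _ ⟨z, hz, rfl⟩
    simp only [Function.comp, norm_smul]
    exact norm_sub_one_mul_norm_le hG hK hz.2 (by simpa [dist_eq_norm] using hz.1)
  have hH := Complex.differentiableOn_update_limUnder_of_bddAbove
    (Metric.closedBall_mem_nhds (1 : ℂ) one_pos) (hd.mono (by gcongr; simp)) hb
  generalize Filter.limUnder (nhdsWithin (1 : ℂ) {1}ᶜ) (fun z => (z - 1) • G z) = y at hH
  set H := Function.update (fun z => (z - 1) • G z) 1 y
  have hHeq : ∀ z ≠ 1, H z = (z - 1) • G z := fun z hz => Function.update_of_ne hz _ _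
  have hHd : Differentiable ℂ H := by
    intro z
    rcases eq_or_ne z 1 with rfl | hz
    · exact hH.differentiableAt (Metric.closedBall_mem_nhds _ one_pos)
    · have hn : ({1}ᶜ : Set ℂ) ∈ nhds z := isOpen_compl_singleton.mem_nhds hz
      refine ((hd.differentiableAt (by rwa [← Set.compl_eq_univ_sdiff]))).congr_of_eventuallyEq ?_
      filter_upwards [hn] with w hw using hHeq w hw
  obtain ⟨C, hC⟩ := (isCompact_closedBall (0 : ℂ) 2).exists_bound_of_continuousOn
    hHd.continuous.continuousOn
  have hbd : Bornology.IsBounded (Set.range H) := by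
    refine isBounded_iff_forall_norm_le.2 ⟨max C (3 * K), ?_⟩
    rintro _ ⟨z, rfl⟩
    rcases le_or_gt ‖z‖ 2 with h | h
    · exact (hC z (by simpa using h)).trans (le_max_left _ _)
    · refine le_trans ?_ (le_max_right _ _)
      rw [hHeq z (by rintro rfl; norm_num at h), norm_smul]
      have h1 := hK z
      rw [abs_of_pos (by linarith)] at h1
      have h2 : ‖z - 1‖ ≤ ‖z‖ + 1 := by simpa using norm_sub_le z 1
      nlinarith [norm_nonneg (G z)]
  refine ⟨H 0, fun z hz => ?_⟩
  rw [← hHeq z hz]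
  exact hHd.apply_eq_apply_of_bounded hbd z 0

/-- A form of Gelfand's theorem: if left multiplication by `v` is isometric and the spectrum of `v`
meets the unit circle at most in `1`, then `v = 1`. -/
theorem eq_one_of_norm_mul_eq_of_isUnit {A : Type*} [NormedRing A] [NormedAlgebra ℂ A]
    [CompleteSpace A] {v : A} (hv : ∀ a, ‖v * a‖ = ‖a‖)
    (hs : ∀ z : ℂ, ‖z‖ = 1 → z ≠ 1 → IsUnit (algebraMap ℂ A z - v)) : v = 1 := by
  nontriviality A
  have hres : ∀ z ∈ resolventSet ℂ v, (algebraMap ℂ A z - v) * resolvent v z = 1 :=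
    fun z hz => Ring.mul_inverse_cancel _ hz
  have hbound : ∀ z ∈ resolventSet ℂ v, ‖resolvent v z‖ * |‖z‖ - 1| ≤ ‖(1 : A)‖ := by
    intro z hz
    have h := abs_norm_sub_norm_le (z • resolvent v z) (v * resolvent v z)
    rw [hv, norm_smul, Algebra.smul_def, ← sub_mul, hres z hz] at h
    rwa [← abs_of_nonneg (norm_nonneg (resolvent v z)), ← abs_mul, mul_sub_one, mul_comm]
  have hgt : ∀ z : ℂ, 1 < ‖z‖ → z ∈ resolventSet ℂ v := by
    intro z hz
    by_contra hzs
    have hpow : ∀ n : ℕ, ‖v ^ n‖ = ‖(1 : A)‖ := by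
      intro n
      induction n with
      | zero => simp
      | succ n ih => rw [pow_succ', hv, ih]
    obtain ⟨n, hn⟩ := pow_unbounded_of_one_lt (‖(1 : A)‖ * ‖(1 : A)‖) hz
    have := spectrum.norm_le_norm_mul_of_mem (spectrum.pow_mem_pow v n hzs)
    rw [norm_pow, hpow] at this
    linarith
  have hlt : Metric.ball (0 : ℂ) 1 ⊆ resolventSet ℂ v := by
    refine (convex_ball (0 : ℂ) 1).isPreconnected.subset_of_closure_inter_subset
      (spectrum.isOpen_resolventSet v) ?_ ?_
    · have h1 : (-1 : ℂ) ∈ closure (Metric.ball (0 : ℂ) 1) := by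
        rw [closure_ball _ one_ne_zero]; simp
      rw [Set.inter_comm]
      exact mem_closure_iff.1 h1 _ (spectrum.isOpen_resolventSet v)
        (hs (-1) (by simp) (by norm_num))
    · rintro z ⟨hzc, hz⟩
      rw [mem_ball_zero_iff] at hz
      obtain ⟨w, hw, hzw⟩ := Metric.mem_closure_iff.1 hzc ((1 - ‖z‖) / 2 / (1 + ‖(1 : A)‖ ^ 2))
        (by have : 0 < 1 - ‖z‖ := by linarith
            positivity)
      rw [lt_div_iff₀ (by positivity), dist_eq_norm] at hzw
      have hw1 : (1 - ‖z‖) / 2 < 1 - ‖w‖ := by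
        have h1 := norm_sub_norm_le w z
        rw [norm_sub_rev] at h1
        nlinarith [mul_nonneg (norm_nonneg (z - w)) (sq_nonneg ‖(1 : A)‖)]
      have hb := hbound w hw
      obtain ⟨u, hu⟩ : IsUnit (algebraMap ℂ A w - v) := hw
      rw [abs_of_neg (by linarith), resolvent, ← hu, Ring.inverse_unit] at hb
      have hpos : 0 < ‖(↑u⁻¹ : A)‖ := Units.norm_pos _
      have hnear : ‖(algebraMap ℂ A z - v) - u‖
          < ‖(↑u⁻¹ : A)‖⁻¹ := by
        rw [hu, sub_sub_sub_cancel_right, ← map_sub, norm_algebraMap, ← one_div,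
          lt_div_iff₀ hpos]
        refine lt_of_mul_lt_mul_right ?_ (show 0 ≤ 1 - ‖w‖ by linarith)
        nlinarith [mul_le_mul_of_nonneg_left hb
          (mul_nonneg (norm_nonneg (z - w)) (norm_nonneg (1 : A))), norm_nonneg (z - w)]
      exact (Units.ofNearby _ _ hnear).isUnit
  have hall : ∀ z : ℂ, z ≠ 1 → z ∈ resolventSet ℂ v := by
    intro z hz
    rcases lt_trichotomy ‖z‖ 1 with h | h | h
    · exact hlt (by simpa using h)
    · exact hs z h hz
    · exact hgt z h
  obtain ⟨c, hc⟩ := exists_sub_one_smul_eq_const (G := resolvent v) (K := ‖(1 : A)‖)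
    (fun z hz => (spectrum.hasDerivAt_resolvent_const_left
      (hall z hz)).differentiableAt.differentiableWithinAt)
    (by
      intro z
      rcases eq_or_ne z 1 with rfl | hz
      · simp
      · exact hbound z (hall z hz))
  have key : ∀ z : ℂ, z ≠ 1 → (algebraMap ℂ A z - v) * c = algebraMap ℂ A (z - 1) := by
    intro z hz
    rw [← hc z hz, mul_smul_comm, hres z (hall z hz), Algebra.algebraMap_eq_smul_one]
  have h0 := key 0 (by norm_num)
  have h2 := key 2 (by norm_num)
  have hc1 : c = 1 := by
    have h3 : (2 : ℂ) • c = (2 : ℂ) • (1 : A) := by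
      rw [Algebra.smul_def, Algebra.smul_def, mul_one]
      have h4 : algebraMap ℂ A 2 * c = (algebraMap ℂ A 2 - v) * c - (algebraMap ℂ A 0 - v) * c := by
        simp only [map_zero, sub_mul, zero_mul]; abel
      rw [h4, h0, h2, ← map_sub]
      norm_num
    exact smul_right_injective A (two_ne_zero (α := ℂ)) h3
  simpa [hc1] using h0

/-- The asymptotic size `limsup ‖tⁿ * a‖`. -/
noncomputable def asymptoticNorm {A : Type*} [NormedRing A] (t a : A) : ℝ :=
  sInf {c : ℝ | 0 ≤ c ∧ ∀ᶠ n : ℕ in Filter.atTop, ‖t ^ n * a‖ ≤ c}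

section

variable {A : Type*} [NormedRing A] {t a : A} {c : ℝ}

theorem asymptoticNorm_nonneg (t a : A) : 0 ≤ asymptoticNorm t a :=
  Real.sInf_nonneg fun _ h => h.1

theorem asymptoticNorm_le (hc : 0 ≤ c) (h : ∀ᶠ n : ℕ in Filter.atTop, ‖t ^ n * a‖ ≤ c) :
    asymptoticNorm t a ≤ c :=
  csInf_le ⟨0, fun _ h => h.1⟩ ⟨hc, h⟩

theorem eventually_le_of_asymptoticNorm_lt (ht : ∃ K : ℝ, ∀ n : ℕ, ‖t ^ n‖ ≤ K)
    (h : asymptoticNorm t a < c) : ∀ᶠ n : ℕ in Filter.atTop, ‖t ^ n * a‖ ≤ c := by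
  obtain ⟨K, hK⟩ := ht
  have hK0 : 0 ≤ K := (norm_nonneg _).trans (hK 0)
  have hne : {c : ℝ | 0 ≤ c ∧ ∀ᶠ n : ℕ in Filter.atTop, ‖t ^ n * a‖ ≤ c}.Nonempty :=
    ⟨K * ‖a‖, by positivity, .of_forall fun n =>
      (norm_mul_le _ _).trans (mul_le_mul_of_nonneg_right (hK n) (norm_nonneg a))⟩
  obtain ⟨d, hd, hdc⟩ := exists_lt_of_csInf_lt hne h
  exact hd.2.mono fun n hn => hn.trans hdc.le

theorem asymptoticNorm_add_le (ht : ∃ K : ℝ, ∀ n : ℕ, ‖t ^ n‖ ≤ K) (a b : A) :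
    asymptoticNorm t (a + b) ≤ asymptoticNorm t a + asymptoticNorm t b := by
  refine le_of_forall_pos_le_add fun ε hε => asymptoticNorm_le
    (by have := asymptoticNorm_nonneg t a; have := asymptoticNorm_nonneg t b; positivity) ?_
  filter_upwards [eventually_le_of_asymptoticNorm_lt ht
      (lt_add_of_pos_right (asymptoticNorm t a) (half_pos hε)),
    eventually_le_of_asymptoticNorm_lt ht
      (lt_add_of_pos_right (asymptoticNorm t b) (half_pos hε))] with n h1 h2
  rw [mul_add]
  linarith [norm_add_le (t ^ n * a) (t ^ n * b)]

theorem asymptoticNorm_mul_le (ht : ∃ K : ℝ, ∀ n : ℕ, ‖t ^ n‖ ≤ K) (ha : Commute t a) (b : A) :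
    asymptoticNorm t (a * b) ≤ asymptoticNorm t a * asymptoticNorm t b := by
  have hlim : Filter.Tendsto (fun ε : ℝ => (asymptoticNorm t a + ε) * (asymptoticNorm t b + ε))
      (nhdsWithin 0 (Set.Ioi 0)) (nhds (asymptoticNorm t a * asymptoticNorm t b)) := by
    have : Continuous fun ε : ℝ => (asymptoticNorm t a + ε) * (asymptoticNorm t b + ε) := by
      fun_prop
    simpa using (this.tendsto 0).mono_left nhdsWithin_le_nhds
  refine ge_of_tendsto hlim (eventually_mem_nhdsWithin.mono fun ε (hε : 0 < ε) => ?_)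
  have ha0 := asymptoticNorm_nonneg t a
  have hb0 := asymptoticNorm_nonneg t b
  obtain ⟨N, hN⟩ := (eventually_le_of_asymptoticNorm_lt ht
    (lt_add_of_pos_right (asymptoticNorm t a) hε)).exists
  refine asymptoticNorm_le (by positivity) ?_
  filter_upwards [(Filter.tendsto_sub_atTop_nat N).eventually
    (eventually_le_of_asymptoticNorm_lt ht (lt_add_of_pos_right (asymptoticNorm t b) hε)),
    Filter.eventually_ge_atTop N] with n hn hNn
  have : t ^ n * (a * b) = (t ^ N * a) * (t ^ (n - N) * b) := by
    rw [mul_assoc, ← mul_assoc a, ← (ha.pow_left (n - N)).eq, mul_assoc, ← mul_assoc (t ^ N),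
      ← pow_add, Nat.add_sub_cancel' hNn]
  rw [this]
  exact (norm_mul_le _ _).trans (by gcongr)

theorem asymptoticNorm_self_mul (t a : A) :
    asymptoticNorm t (t * a) = asymptoticNorm t a := by
  unfold asymptoticNorm
  congr! 4 with c
  simp_rw [← mul_assoc, ← pow_succ]
  conv_rhs => rw [← Filter.map_add_atTop_eq_nat 1, Filter.eventually_map]

theorem asymptoticNorm_smul_le [NormedAlgebra ℂ A] (ht : ∃ K : ℝ, ∀ n : ℕ, ‖t ^ n‖ ≤ K) (z : ℂ)
    (a : A) : asymptoticNorm t (z • a) ≤ ‖z‖ * asymptoticNorm t a := by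
  have hlim : Filter.Tendsto (fun ε : ℝ => ‖z‖ * (asymptoticNorm t a + ε))
      (nhdsWithin 0 (Set.Ioi 0)) (nhds (‖z‖ * asymptoticNorm t a)) := by
    have : Continuous fun ε : ℝ => ‖z‖ * (asymptoticNorm t a + ε) := by fun_prop
    simpa using (this.tendsto 0).mono_left nhdsWithin_le_nhds
  refine ge_of_tendsto hlim (eventually_mem_nhdsWithin.mono fun ε (hε : 0 < ε) => ?_)
  refine asymptoticNorm_le (by have := asymptoticNorm_nonneg t a; positivity) ?_
  filter_upwards [eventually_le_of_asymptoticNorm_lt ht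
    (lt_add_of_pos_right (asymptoticNorm t a) hε)] with n hn
  rw [mul_smul_comm, norm_smul]
  gcongr

end

/-- The commutant of a power-bounded element `t`, with the seminorm `limsup ‖tⁿ * a‖`. -/
def AsymptoticCommutant {A : Type*} [NormedRing A] [NormedAlgebra ℂ A] (t : A)
    (_ : ∃ K : ℝ, ∀ n : ℕ, ‖t ^ n‖ ≤ K) : Type _ :=
  Subalgebra.centralizer ℂ {t}

namespace AsymptoticCommutant

variable {A : Type*} [NormedRing A] [NormedAlgebra ℂ A] {t : A}
  {ht : ∃ K : ℝ, ∀ n : ℕ, ‖t ^ n‖ ≤ K}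

noncomputable instance : Ring (AsymptoticCommutant t ht) :=
  inferInstanceAs (Ring (Subalgebra.centralizer ℂ {t}))

noncomputable instance : Algebra ℂ (AsymptoticCommutant t ht) :=
  inferInstanceAs (Algebra ℂ (Subalgebra.centralizer ℂ {t}))

/-- The inclusion of the commutant. -/
noncomputable def val : AsymptoticCommutant t ht →ₐ[ℂ] A :=
  (Subalgebra.centralizer ℂ {t}).val

theorem val_injective : Function.Injective (val : AsymptoticCommutant t ht → A) :=
  Subtype.val_injective

theorem commute_val (a : AsymptoticCommutant t ht) : Commute t (val a) :=
  Subalgebra.mem_centralizer_iff ℂ |>.1 a.2 t rfl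

/-- An element commuting with `t`, seen in the commutant. -/
def mk (a : A) (h : Commute t a) : AsymptoticCommutant t ht :=
  ⟨a, (Subalgebra.mem_centralizer_iff ℂ).2 (by rintro _ rfl; exact h)⟩

@[simp]
theorem val_mk (a : A) (h : Commute t a) : val (mk a h : AsymptoticCommutant t ht) = a := rfl

noncomputable instance : SeminormedRing (AsymptoticCommutant t ht) :=
  RingSeminorm.toSeminormedRing
    { toFun := fun a => asymptoticNorm t (val a)
      map_zero' := le_antisymm (asymptoticNorm_le le_rfl (by simp)) (asymptoticNorm_nonneg _ _)
      add_le' := fun a b => by rw [map_add]; exact asymptoticNorm_add_le ht _ _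
      neg' := fun a => by simp [asymptoticNorm]
      mul_le' := fun a b => by
        rw [map_mul]; exact asymptoticNorm_mul_le ht (commute_val a) _ }

theorem norm_def (a : AsymptoticCommutant t ht) : ‖a‖ = asymptoticNorm t (val a) := rfl

noncomputable instance : NormedAlgebra ℂ (AsymptoticCommutant t ht) where
  norm_smul_le z a := by
    rw [norm_def, map_smul]; exact asymptoticNorm_smul_le ht z _

noncomputable instance : NormedAlgebra ℂ (UniformSpace.Completion (AsymptoticCommutant t ht)) where
  norm_smul_le := norm_smul_le

theorem isUnit_of_isUnit_val {a : AsymptoticCommutant t ht} (h : IsUnit (val a)) : IsUnit a := by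
  obtain ⟨u, hu⟩ := h
  have hc : Commute t (↑u⁻¹ : A) := Commute.units_inv_right (hu ▸ commute_val a)
  refine isUnit_iff_exists.2 ⟨mk _ hc, val_injective ?_, val_injective ?_⟩ <;> simp [← hu]

end AsymptoticCommutant

/-- The analytic half of the Katznelson–Tzafriri theorem in a Banach algebra. -/
theorem tendsto_norm_pow_mul_one_sub {A : Type*} [NormedRing A] [NormedAlgebra ℂ A] {t : A}
    (ht : ∃ K : ℝ, ∀ n : ℕ, ‖t ^ n‖ ≤ K)
    (hs : ∀ z : ℂ, ‖z‖ = 1 → z ≠ 1 → IsUnit (algebraMap ℂ A z - t)) :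
    Filter.Tendsto (fun n : ℕ => ‖t ^ n * (1 - t)‖) Filter.atTop (nhds 0) := by
  let s : AsymptoticCommutant t ht := .mk t (Commute.refl t)
  have hs1 : (s : UniformSpace.Completion (AsymptoticCommutant t ht)) = 1 := by
    refine eq_one_of_norm_mul_eq_of_isUnit (fun a => ?_) fun z hz hz1 => ?_
    · induction a using UniformSpace.Completion.induction_on with
      | hp => exact isClosed_eq (by fun_prop) (by fun_prop)
      | ih a =>
        rw [← UniformSpace.Completion.coe_mul, UniformSpace.Completion.norm_coe,
          UniformSpace.Completion.norm_coe, AsymptoticCommutant.norm_def, map_mul]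
        exact asymptoticNorm_self_mul t _
    · have h : IsUnit (algebraMap ℂ (AsymptoticCommutant t ht) z - s) :=
        AsymptoticCommutant.isUnit_of_isUnit_val (by simpa [s] using hs z hz hz1)
      have h' := h.map UniformSpace.Completion.coeRingHom
      rw [map_sub] at h'
      exact h'
  have h0 : asymptoticNorm t (1 - t) = 0 := by
    have h1 : ‖(1 : AsymptoticCommutant t ht) - s‖ = 0 := by
      rw [← UniformSpace.Completion.norm_coe, UniformSpace.Completion.coe_sub, hs1,
        UniformSpace.Completion.coe_one, sub_self, norm_zero]
    simpa [AsymptoticCommutant.norm_def, s] using h1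
  rw [Metric.tendsto_nhds]
  intro ε hε
  filter_upwards [eventually_le_of_asymptoticNorm_lt ht (h0.trans_lt (half_pos hε))] with n hn
  simp only [dist_zero_right, norm_norm]
  linarith

theorem eq_one_of_mem_spectrum_of_tendsto {A : Type*} [NormedRing A] [NormedAlgebra ℂ A]
    [CompleteSpace A] {t : A}
    (h : Filter.Tendsto (fun n : ℕ => ‖t ^ n * (1 - t)‖) Filter.atTop (nhds 0)) {z : ℂ}
    (hz : z ∈ spectrum ℂ t) (hz1 : ‖z‖ = 1) : z = 1 := by
  have hle : ∀ n : ℕ, ‖1 - z‖ ≤ ‖t ^ n * (1 - t)‖ * ‖(1 : A)‖ := by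
    intro n
    have hmem := spectrum.subset_polynomial_aeval t
      (Polynomial.X ^ n * (1 - Polynomial.X) : Polynomial ℂ) ⟨z, hz, rfl⟩
    simpa [hz1] using spectrum.norm_le_norm_mul_of_mem hmem
  have := ge_of_tendsto' (h.mul_const ‖(1 : A)‖) hle
  rw [zero_mul] at this
  exact (sub_eq_zero.1 (norm_le_zero_iff.1 this)).symm

/-- **Katznelson–Tzafriri theorem.** For a power-bounded operator `T` on a complex Banach
space, `‖Tⁿ(I - T)‖ → 0` iff the spectrum of `T` intersects the unit circle only in `{1}`. -/
theorem katznelson_tzafriri {X : Type*} [NormedAddCommGroup X] [NormedSpace ℂ X]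
    [CompleteSpace X] (T : X →L[ℂ] X) (hpb : ∃ K : ℝ, ∀ n : ℕ, ‖T ^ n‖ ≤ K) :
    Filter.Tendsto (fun n : ℕ => ‖T ^ n * (1 - T)‖) Filter.atTop (nhds 0) ↔
      spectrum ℂ T ∩ {z : ℂ | ‖z‖ = 1} ⊆ {1} := by
  refine ⟨fun h z hz => eq_one_of_mem_spectrum_of_tendsto h hz.1 hz.2, fun h => ?_⟩
  refine tendsto_norm_pow_mul_one_sub hpb fun z hz hz1 => ?_
  by_contra hu
  exact hz1 (h ⟨hu, hz⟩)
end

section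
/- Let X be a complex Hilbert space and let T be a power-bounded bounded linear operator on X such that σ(T) ∩ 𝕋 = {1}. Let m : (0,π] → (0,∞) be a continuous non-increasing function of reciprocally positive increase such that ‖R(e^{iθ},T)‖ ≤ m(|θ|) for 0 < |θ| ≤ π. Then there exist C > 0 and N ∈ ℕ such that ‖Tⁿ(I − T)‖ ≤ C m⁻¹(n) for all n ≥ N. -/
open Filter Topology

/-- The right inverse `m⁻¹(s) = inf {ε ∈ (0,π] : m ε ≤ s}` of a continuous
non-increasing function `m : (0,π] → (0,∞)`. -/
noncomputable def rightInv (m : ℝ → ℝ) (s : ℝ) : ℝ :=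
  sInf {ε : ℝ | ε ∈ Set.Ioc 0 Real.pi ∧ m ε ≤ s}

/-- `m : (0,π] → (0,∞)` has reciprocally positive increase: there are `c ∈ (0,1]`, `α > 0`
and `ε₀ ∈ (0,π]` with `m(ε/t)/m(ε) ≥ c tᵅ` for all `t ≥ 1` and `ε ∈ (0,ε₀]`. -/
def HasRecipPosIncrease (m : ℝ → ℝ) : Prop :=
  ∃ c ∈ Set.Ioc (0:ℝ) 1, ∃ α > (0:ℝ), ∃ ε₀ ∈ Set.Ioc (0:ℝ) Real.pi,
    ∀ t ≥ (1:ℝ), ∀ ε ∈ Set.Ioc (0:ℝ) ε₀, c * t ^ α ≤ m (ε / t) / m ε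

theorem integral_conj_exp_pow_mul_exp_pow (i j : ℕ) :
    ∫ θ in (0:ℝ)..2 * Real.pi,
      (starRingEnd ℂ) (Complex.exp (θ * Complex.I) ^ i) * Complex.exp (θ * Complex.I) ^ j
      = if i = j then 2 * (Real.pi : ℂ) else 0 := by
  have key : ∀ θ : ℝ, (starRingEnd ℂ) (Complex.exp (θ * Complex.I) ^ i) *
      Complex.exp (θ * Complex.I) ^ j = Complex.exp ((((j:ℂ) - i) * Complex.I) * θ) := by
    intro θ
    rw [map_pow, ← Complex.exp_conj, ← Complex.exp_nat_mul, ← Complex.exp_nat_mul,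
      ← Complex.exp_add]
    congr 1
    simp
    ring
  simp_rw [key]
  split_ifs with h
  · subst h; simp
  · have hc : ((j:ℂ) - i) * Complex.I ≠ 0 := by
      refine mul_ne_zero (sub_ne_zero.2 ?_) Complex.I_ne_zero
      exact_mod_cast Ne.symm h
    rw [integral_exp_mul_complex hc]
    have : Complex.exp (((j:ℂ) - i) * Complex.I * ((2 * Real.pi : ℝ) : ℂ)) = 1 := by
      rw [Complex.exp_eq_one_iff]
      exact ⟨(j:ℤ) - i, by push_cast; ring⟩
    rw [this]; simp

section Parseval

variable {X : Type*} [NormedAddCommGroup X] [InnerProductSpace ℂ X]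

theorem norm_exp_pow_smul (a : X) (j : ℕ) (θ : ℝ) :
    ‖Complex.exp (θ * Complex.I) ^ j • a‖ = ‖a‖ := by
  simp [norm_smul, Complex.norm_exp_ofReal_mul_I]

variable [CompleteSpace X]

theorem continuous_tsum_exp_pow_smul {a : ℕ → X} (ha : Summable fun j => ‖a j‖) :
    Continuous fun θ : ℝ => ∑' j, Complex.exp (θ * Complex.I) ^ j • a j :=
  continuous_tsum (fun j => by fun_prop) ha fun j θ => (norm_exp_pow_smul _ _ _).le

theorem hasSum_exp_pow_smul {a : ℕ → X} (ha : Summable fun j => ‖a j‖) (θ : ℝ) :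
    HasSum (fun j => Complex.exp (θ * Complex.I) ^ j • a j)
      (∑' j, Complex.exp (θ * Complex.I) ^ j • a j) :=
  (Summable.of_norm (by simpa only [norm_exp_pow_smul] using ha)).hasSum

/-- Parseval's identity for absolutely convergent Hilbert space valued Fourier series. -/
theorem hasSum_norm_sq_integral_tsum_exp_pow_smul {a : ℕ → X} (ha : Summable fun j => ‖a j‖) :
    HasSum (fun j => 2 * Real.pi * ‖a j‖ ^ 2)
      (∫ θ in (0:ℝ)..2 * Real.pi, ‖∑' j, Complex.exp (θ * Complex.I) ^ j • a j‖ ^ 2) := by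
  set f : ℝ → X := fun θ => ∑' j, Complex.exp (θ * Complex.I) ^ j • a j with hf
  have hfc : Continuous f := continuous_tsum_exp_pow_smul ha
  have hfb : ∀ θ, ‖f θ‖ ≤ ∑' j, ‖a j‖ := fun θ =>
    (norm_tsum_le_tsum_norm (by simpa only [norm_exp_pow_smul] using ha)).trans_eq
      (by simp only [norm_exp_pow_smul])
  have coeff : ∀ j, ∫ θ in (0:ℝ)..2 * Real.pi,
      inner ℂ (f θ) (Complex.exp (θ * Complex.I) ^ j • a j) = ((2 * Real.pi * ‖a j‖ ^ 2 : ℝ) : ℂ) := by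
    intro j
    have h1 : HasSum (fun i => ∫ θ in (0:ℝ)..2 * Real.pi,
        inner ℂ (Complex.exp (θ * Complex.I) ^ i • a i) (Complex.exp (θ * Complex.I) ^ j • a j))
        (∫ θ in (0:ℝ)..2 * Real.pi,
          inner ℂ (f θ) (Complex.exp (θ * Complex.I) ^ j • a j)) := by
      refine intervalIntegral.hasSum_integral_of_dominated_convergence
        (fun i _ => ‖a i‖ * ‖a j‖) (fun i => ?_) (fun i => ?_) ?_ ?_ ?_
      · exact Continuous.aestronglyMeasurable (by fun_prop)
      · refine .of_forall fun θ _ => (norm_inner_le_norm _ _).trans_eq ?_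
        simp only [norm_exp_pow_smul]
      · exact .of_forall fun θ _ => ha.mul_right _
      · exact intervalIntegrable_const
      · refine .of_forall fun θ _ => ?_
        have h := (hasSum_exp_pow_smul ha θ)
        exact ((innerSLFlip ℂ (Complex.exp (θ * Complex.I) ^ j • a j)).hasSum h)
    have h2 : ∀ i, ∫ θ in (0:ℝ)..2 * Real.pi,
        inner ℂ (Complex.exp (θ * Complex.I) ^ i • a i) (Complex.exp (θ * Complex.I) ^ j • a j)
        = if i = j then ((2 * Real.pi * ‖a j‖ ^ 2 : ℝ) : ℂ) else 0 := by
      intro i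
      simp_rw [inner_smul_left, inner_smul_right, ← mul_assoc]
      rw [intervalIntegral.integral_mul_const, integral_conj_exp_pow_mul_exp_pow]
      split_ifs with h
      · subst h
        rw [inner_self_eq_norm_sq_to_K]
        simp
      · simp
    simp_rw [h2] at h1
    exact h1.unique (hasSum_ite_eq j _)
  have h3 : HasSum (fun j => ∫ θ in (0:ℝ)..2 * Real.pi,
      inner ℂ (f θ) (Complex.exp (θ * Complex.I) ^ j • a j))
      (∫ θ in (0:ℝ)..2 * Real.pi, inner ℂ (f θ) (f θ)) := by
    refine intervalIntegral.hasSum_integral_of_dominated_convergence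
      (fun j _ => (∑' i, ‖a i‖) * ‖a j‖) (fun j => ?_) (fun j => ?_) ?_ ?_ ?_
    · exact Continuous.aestronglyMeasurable (by fun_prop)
    · refine .of_forall fun θ _ => (norm_inner_le_norm _ _).trans ?_
      rw [norm_exp_pow_smul]
      gcongr
      exact hfb θ
    · exact .of_forall fun θ _ => ha.mul_left _
    · exact intervalIntegrable_const
    · exact .of_forall fun θ _ => (innerSL ℂ (f θ)).hasSum (hasSum_exp_pow_smul ha θ)
  simp_rw [coeff, inner_self_eq_norm_sq_to_K] at h3
  have h4 : ∫ θ in (0:ℝ)..2 * Real.pi, ((‖f θ‖ : ℝ) : ℂ) ^ 2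
      = ((∫ θ in (0:ℝ)..2 * Real.pi, ‖f θ‖ ^ 2 : ℝ) : ℂ) := by
    rw [← intervalIntegral.integral_ofReal]
    simp
  exact Complex.hasSum_ofReal.1 (h4 ▸ h3)

/-- A pointwise bound between two absolutely convergent Fourier series gives an `ℓ²` bound between
their coefficients. -/
theorem tsum_norm_sq_le_of_norm_tsum_exp_pow_smul_le {a b : ℕ → X}
    (ha : Summable fun j => ‖a j‖) (hb : Summable fun j => ‖b j‖) {M : ℝ}
    (h : ∀ θ : ℝ, ‖∑' j, Complex.exp (θ * Complex.I) ^ j • b j‖ ≤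
      M * ‖∑' j, Complex.exp (θ * Complex.I) ^ j • a j‖) :
    Summable (fun j => ‖b j‖ ^ 2) ∧ ∑' j, ‖b j‖ ^ 2 ≤ M ^ 2 * ∑' j, ‖a j‖ ^ 2 := by
  have hA := hasSum_norm_sq_integral_tsum_exp_pow_smul ha
  have hB := hasSum_norm_sq_integral_tsum_exp_pow_smul hb
  have hpi : 0 < 2 * Real.pi := by positivity
  refine ⟨(summable_mul_left_iff hpi.ne').1 hB.summable, ?_⟩
  refine le_of_mul_le_mul_left ?_ hpi
  rw [mul_left_comm, ← tsum_mul_left, ← tsum_mul_left, hA.tsum_eq, hB.tsum_eq,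
    ← intervalIntegral.integral_const_mul]
  refine intervalIntegral.integral_mono_on hpi.le ?_ ?_ fun θ _ => ?_
  · exact ((continuous_tsum_exp_pow_smul hb).norm.pow 2).intervalIntegrable _ _
  · exact (((continuous_tsum_exp_pow_smul ha).norm.pow 2).const_mul _).intervalIntegrable _ _
  · rw [← mul_pow]
    exact pow_le_pow_left₀ (norm_nonneg _) (h θ) 2

end Parseval

section GeometricSeries

variable {B : Type*} [NormedRing B]

theorem one_sub_mul_tsum_choose_nsmul_pow {S : B} (k : ℕ)
    (hS : Summable fun j => ((j + k).choose k) • S ^ j)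
    (hS' : Summable fun j => ((j + (k + 1)).choose (k + 1)) • S ^ j) :
    (1 - S) * ∑' j, ((j + (k + 1)).choose (k + 1)) • S ^ j = ∑' j, ((j + k).choose k) • S ^ j := by
  rw [sub_mul, one_mul, ← hS'.tsum_mul_left, hS'.tsum_eq_zero_add, hS.tsum_eq_zero_add,
    add_sub_assoc, ← Summable.tsum_sub ((summable_nat_add_iff 1).2 hS') (hS'.mul_left S)]
  congr 1
  · simp
  · refine tsum_congr fun j => ?_
    rw [mul_smul_comm, ← pow_succ', show j + 1 + (k + 1) = (j + 1 + k) + 1 by ring,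
      Nat.choose_succ_succ, show j + (k + 1) = j + 1 + k by ring, add_smul, add_sub_cancel_right]

theorem one_sub_pow_mul_tsum_choose_nsmul_pow {S : B}
    (hS : ∀ k, Summable fun j => ((j + k).choose k) • S ^ j) (k : ℕ) :
    (1 - S) ^ k * ∑' j, ((j + k).choose k) • S ^ j = ∑' j, S ^ j := by
  induction k with
  | zero => simp
  | succ k ih => rw [pow_succ, mul_assoc, one_sub_mul_tsum_choose_nsmul_pow k (hS k) (hS _), ih]

end GeometricSeries

section PowerBounded

variable {B : Type*} [NormedRing B] [NormedAlgebra ℂ B] {T : B} {K : ℝ}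

theorem norm_inv_smul_pow_le (hK : ∀ n, ‖T ^ n‖ ≤ K) (l : ℂ) (j : ℕ) :
    ‖(l⁻¹ • T) ^ j‖ ≤ K * (‖l‖⁻¹) ^ j := by
  rw [smul_pow, norm_smul, norm_pow, norm_inv, mul_comm]
  gcongr
  exact hK j

variable [CompleteSpace B]

theorem summable_choose_nsmul_inv_smul_pow (hK : ∀ n, ‖T ^ n‖ ≤ K) {l : ℂ} (hl : 1 < ‖l‖)
    (k : ℕ) : Summable fun j => ((j + k).choose k) • (l⁻¹ • T) ^ j := by
  have h1 : ‖(‖l‖⁻¹ : ℝ)‖ < 1 := by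
    rw [norm_inv, norm_norm]
    exact inv_lt_one_of_one_lt₀ hl
  refine Summable.of_norm_bounded ((summable_choose_mul_geometric_of_norm_lt_one k h1).mul_left K)
    fun j => ?_
  refine (norm_nsmul_le).trans ?_
  rw [mul_left_comm]
  gcongr
  exact norm_inv_smul_pow_le hK l j

theorem isUnit_algebraMap_sub_of_one_lt_norm (hK : ∀ n, ‖T ^ n‖ ≤ K) {l : ℂ} (hl : 1 < ‖l‖) :
    IsUnit (algebraMap ℂ B l - T) ∧ resolvent T l = l⁻¹ • ∑' j, (l⁻¹ • T) ^ j := by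
  have hs : Summable fun j => (l⁻¹ • T) ^ j := by
    simpa using summable_choose_nsmul_inv_smul_pow hK hl 0
  have hl0 : l ≠ 0 := norm_pos_iff.1 (one_pos.trans hl)
  have e : algebraMap ℂ B l - T = l • (1 - l⁻¹ • T) := by
    rw [smul_sub, smul_inv_smul₀ hl0, Algebra.algebraMap_eq_smul_one]
  have h1 : (algebraMap ℂ B l - T) * (l⁻¹ • ∑' j, (l⁻¹ • T) ^ j) = 1 := by
    rw [e, smul_mul_smul_comm, mul_inv_cancel₀ hl0, one_smul, hs.one_sub_mul_tsum_pow]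
  have h2 : (l⁻¹ • ∑' j, (l⁻¹ • T) ^ j) * (algebraMap ℂ B l - T) = 1 := by
    rw [e, smul_mul_smul_comm, inv_mul_cancel₀ hl0, one_smul, hs.tsum_pow_mul_one_sub]
  exact ⟨⟨⟨_, _, h1, h2⟩, rfl⟩, Ring.inverse_unit ⟨_, _, h1, h2⟩⟩

theorem norm_resolvent_le_of_one_lt_norm (hK : ∀ n, ‖T ^ n‖ ≤ K) {l : ℂ} (hl : 1 < ‖l‖) :
    ‖resolvent T l‖ ≤ K / (‖l‖ - 1) := by
  have hl0 : 0 < ‖l‖ := one_pos.trans hl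
  have hl1 : ‖l‖ - 1 ≠ 0 := (sub_pos.2 hl).ne'
  rw [(isUnit_algebraMap_sub_of_one_lt_norm hK hl).2, norm_smul, norm_inv]
  have h := tsum_of_norm_bounded
    ((hasSum_geometric_of_lt_one (by positivity) (inv_lt_one_of_one_lt₀ hl)).mul_left K)
    (norm_inv_smul_pow_le hK l)
  calc ‖l‖⁻¹ * ‖∑' j, (l⁻¹ • T) ^ j‖ ≤ ‖l‖⁻¹ * (K * (1 - ‖l‖⁻¹)⁻¹) := by gcongr
    _ = K / (‖l‖ - 1) := by
      have : 1 - ‖l‖⁻¹ = (‖l‖ - 1) / ‖l‖ := by field_simp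
      rw [this]
      field_simp

theorem tsum_choose_nsmul_eq_smul_resolvent_pow_mul (hK : ∀ n, ‖T ^ n‖ ≤ K) {l : ℂ}
    (hl : 1 < ‖l‖) (k : ℕ) :
    ∑' j, ((j + k).choose k) • (l⁻¹ • T) ^ j
      = l ^ k • (resolvent T l ^ k * ∑' j, (l⁻¹ • T) ^ j) := by
  have hl0 : l ≠ 0 := norm_pos_iff.1 (one_pos.trans hl)
  obtain ⟨u, hu⟩ := (isUnit_algebraMap_sub_of_one_lt_norm hK hl).1
  have hR : resolvent T l = ↑u⁻¹ := by
    rw [resolvent, ← hu, Ring.inverse_unit]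
  have e : (u : B) = l • (1 - l⁻¹ • T) := by
    rw [hu, smul_sub, smul_inv_smul₀ hl0, Algebra.algebraMap_eq_smul_one]
  rw [← one_sub_pow_mul_tsum_choose_nsmul_pow (summable_choose_nsmul_inv_smul_pow hK hl) k,
    ← mul_smul_comm, ← smul_mul_assoc, ← smul_pow, ← e, hR, ← mul_assoc, ← Units.val_pow_eq_pow_val,
    ← Units.val_pow_eq_pow_val, ← Units.val_mul]
  simp

end PowerBounded

theorem half_pow_le_factorial_mul_choose {n j : ℕ} (hj : n / 2 ≤ j) (k : ℕ) :
    ((n : ℝ) / 2) ^ k ≤ k.factorial * ((j + k).choose k : ℝ) := by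
  have h1 : (j + 1) ^ k ≤ k.factorial * (j + k).choose k := by
    rw [← Nat.ascFactorial_eq_factorial_mul_choose]
    exact Nat.pow_succ_le_ascFactorial (j + 1) k
  have h2 : (n : ℝ) / 2 ≤ j + 1 := by
    have : n ≤ 2 * (j + 1) := by omega
    have : (n : ℝ) ≤ 2 * (j + 1) := by exact_mod_cast this
    linarith
  calc ((n : ℝ) / 2) ^ k ≤ ((j : ℝ) + 1) ^ k := by gcongr
    _ ≤ _ := by exact_mod_cast h1

section HilbertSpace

variable {X : Type*} [NormedAddCommGroup X] [InnerProductSpace ℂ X] [CompleteSpace X]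
  {T A : X →L[ℂ] X} {K : ℝ}

/-- A bound for `A R(λ,T)ᵏ` on the circle `|λ| = r` controls the weighted `ℓ²` norm of the
sequence `(j+k choose k) A Tʲ x`. -/
theorem tsum_choose_mul_norm_sq_le (hK : ∀ n, ‖T ^ n‖ ≤ K) {r : ℝ} (hr : 1 < r) {k : ℕ} {M : ℝ}
    (hM : ∀ l : ℂ, ‖l‖ = r → ‖A * resolvent T l ^ k‖ ≤ M) (x : X) :
    Summable (fun j => (((j + k).choose k : ℝ) * (r⁻¹ ^ j * ‖A ((T ^ j) x)‖)) ^ 2) ∧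
    ∑' j, (((j + k).choose k : ℝ) * (r⁻¹ ^ j * ‖A ((T ^ j) x)‖)) ^ 2 ≤
      (r ^ k * M) ^ 2 * ((K * ‖x‖) ^ 2 * (1 - r⁻¹)⁻¹) := by
  have hr0 : 0 < r := one_pos.trans hr
  have hri : r⁻¹ < 1 := inv_lt_one_of_one_lt₀ hr
  have hK0 : 0 ≤ K := (norm_nonneg _).trans (hK 0)
  have hrn : ‖(r : ℂ)‖ = r := by simp [abs_of_pos hr0]
  have nrm : ∀ (j : ℕ) (y : X), ‖((r : ℂ)⁻¹ ^ j) • y‖ = r⁻¹ ^ j * ‖y‖ := fun j y => by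
    rw [norm_smul, norm_pow, norm_inv, hrn]
  have hTx : ∀ j, ‖(T ^ j) x‖ ≤ K * ‖x‖ := fun j =>
    ((T ^ j).le_opNorm x).trans (by gcongr; exact hK j)
  set a : ℕ → X := fun j => ((r : ℂ)⁻¹ ^ j) • (T ^ j) x with ha
  set b : ℕ → X := fun j => ((j + k).choose k : ℂ) • ((r : ℂ)⁻¹ ^ j) • A ((T ^ j) x) with hb
  have hna : ∀ j, ‖a j‖ = r⁻¹ ^ j * ‖(T ^ j) x‖ := fun j => nrm _ _
  have hnb : ∀ j, ‖b j‖ = ((j + k).choose k : ℝ) * (r⁻¹ ^ j * ‖A ((T ^ j) x)‖) := fun j => by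
    rw [hb, norm_smul, nrm, Complex.norm_natCast]
  have hri' : ‖r⁻¹‖ < 1 := by rwa [Real.norm_of_nonneg (by positivity)]
  have hbase : ∀ k : ℕ, Summable fun j : ℕ => ((j + k).choose k : ℝ) * (r⁻¹ ^ j * (K * ‖x‖)) :=
    fun k => by
      simpa only [mul_assoc] using
        (summable_choose_mul_geometric_of_norm_lt_one k hri').mul_right (K * ‖x‖)
  have hsa : Summable fun j => ‖a j‖ := by
    refine Summable.of_nonneg_of_le (fun _ => norm_nonneg _) (fun j => ?_) (hbase 0)
    rw [hna]
    simp only [add_zero, Nat.choose_zero_right, Nat.cast_one, one_mul]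
    gcongr
    exact hTx j
  have hsb : Summable fun j => ‖b j‖ := by
    refine Summable.of_nonneg_of_le (fun _ => norm_nonneg _) (fun j => ?_)
      ((hbase k).mul_left ‖A‖)
    rw [hnb, mul_left_comm ‖A‖, mul_left_comm ‖A‖]
    gcongr
    exact (A.le_opNorm _).trans (by gcongr; exact hTx j)
  have hmult : ∀ θ : ℝ, ‖∑' j, Complex.exp (θ * Complex.I) ^ j • b j‖ ≤
      (r ^ k * M) * ‖∑' j, Complex.exp (θ * Complex.I) ^ j • a j‖ := by
    intro θ
    set e := Complex.exp (θ * Complex.I) with he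
    have hne : ‖e‖ = 1 := Complex.norm_exp_ofReal_mul_I θ
    set l : ℂ := (e * (r : ℂ)⁻¹)⁻¹ with hl
    have hln : ‖l‖ = r := by rw [hl, norm_inv, norm_mul, hne, norm_inv, hrn, one_mul, inv_inv]
    have hl1 : 1 < ‖l‖ := by rwa [hln]
    have hpow : ∀ j, (l⁻¹ • T) ^ j = (e ^ j * (r : ℂ)⁻¹ ^ j) • T ^ j := fun j => by
      rw [smul_pow, hl, inv_inv, mul_pow]
    have hS := fun k => summable_choose_nsmul_inv_smul_pow hK hl1 k
    have hS0 : Summable fun j => (l⁻¹ • T) ^ j := by simpa using hS 0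
    have e1 : ∑' j, e ^ j • a j = (∑' j, (l⁻¹ • T) ^ j) x := by
      rw [← ContinuousLinearMap.apply_apply x (∑' j, (l⁻¹ • T) ^ j), ContinuousLinearMap.map_tsum _ hS0]
      refine tsum_congr fun j => ?_
      simp [hpow, ha, mul_smul]
    have e2 : ∑' j, e ^ j • b j = A ((∑' j, ((j + k).choose k) • (l⁻¹ • T) ^ j) x) := by
      change _ = (A.comp (ContinuousLinearMap.apply ℂ X x))
        (∑' j, ((j + k).choose k) • (l⁻¹ • T) ^ j)
      rw [ContinuousLinearMap.map_tsum _ (hS k)]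
      refine tsum_congr fun j => ?_
      simp only [hpow, hb, ContinuousLinearMap.comp_apply, ContinuousLinearMap.apply_apply,
        map_smul, ← Nat.cast_smul_eq_nsmul ℂ, smul_smul]
      congr 1
      ring
    rw [e2, e1, tsum_choose_nsmul_eq_smul_resolvent_pow_mul hK hl1]
    set y := (∑' j, (l⁻¹ • T) ^ j)
    have e3 : A ((l ^ k • (resolvent T l ^ k * y)) x) = l ^ k • ((A * resolvent T l ^ k) (y x)) := by
      simp
    rw [e3, norm_smul, norm_pow, hln, mul_assoc]
    gcongr
    exact ((A * resolvent T l ^ k).le_opNorm _).trans (by gcongr; exact hM l hln)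
  obtain ⟨h1, h2⟩ := tsum_norm_sq_le_of_norm_tsum_exp_pow_smul_le hsa hsb hmult
  simp_rw [hnb] at h1 h2
  refine ⟨h1, h2.trans ?_⟩
  gcongr
  refine tsum_of_norm_bounded (f := fun j => ‖a j‖ ^ 2)
    ((hasSum_geometric_of_lt_one (by positivity) hri).mul_left ((K * ‖x‖) ^ 2)) (fun j => ?_)
    |>.trans' (Real.le_norm_self _)
  rw [hna, Real.norm_of_nonneg (by positivity), mul_pow, mul_comm]
  gcongr
  · exact hTx j
  · exact pow_le_of_le_one (by positivity) (pow_le_one₀ (by positivity) hri.le) two_ne_zero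

/-- Quantitative estimate for `Tⁿ A` in terms of `A R(λ,T)ᵏ` on the circle `|λ| = 1 + 1/n`. -/
theorem pow_mul_norm_pow_mul_le (hK : ∀ n, ‖T ^ n‖ ≤ K) (hK1 : 1 ≤ K) (hA : Commute A T) {n : ℕ}
    (hn : 1 ≤ n) {k : ℕ} {M : ℝ} (hM0 : 0 ≤ M)
    (hM : ∀ l : ℂ, ‖l‖ = 1 + 1 / n → ‖A * resolvent T l ^ k‖ ≤ M) :
    (n : ℝ) ^ k * ‖T ^ n * A‖ ≤ 6 * 4 ^ k * k.factorial * K ^ 2 * M := by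
  have hn0 : (0 : ℝ) < n := by exact_mod_cast hn
  have hn1 : (1 : ℝ) ≤ n := by exact_mod_cast hn
  have hK0 : 0 < K := one_pos.trans_le hK1
  set r : ℝ := 1 + 1 / n with hr
  have hr1 : 1 < r := by rw [hr]; linarith [one_div_pos.2 hn0]
  have hr0 : 0 < r := one_pos.trans hr1
  have hr2 : r ≤ 2 := by
    have : 1 / (n : ℝ) ≤ 1 := by rw [div_le_one hn0]; exact hn1
    linarith
  have hrn : r ^ n ≤ 3 := by
    calc r ^ n ≤ (Real.exp (1 / n)) ^ n := by
          gcongr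
          rw [hr, add_comm]
          exact Real.add_one_le_exp _
      _ = Real.exp 1 := by rw [← Real.exp_nat_mul]; congr 1; field_simp
      _ ≤ 3 := by linarith [Real.exp_one_lt_d9]
  have hgeom : (1 - r⁻¹)⁻¹ ≤ 2 * n := by
    have : 1 - r⁻¹ = 1 / (n + 1) := by rw [hr]; field_simp; ring
    rw [this, one_div, inv_inv]
    linarith
  have hpt : ∀ x : X, (n : ℝ) ^ k * ‖(T ^ n * A) x‖ ≤ 6 * 4 ^ k * k.factorial * K ^ 2 * M * ‖x‖ := by
    intro x
    obtain ⟨h1, h2⟩ := tsum_choose_mul_norm_sq_le hK hr1 hM x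
    set N := ‖(T ^ n * A) x‖ with hN
    set D : ℝ := ((n : ℝ) / 2) ^ k * N / (k.factorial * (3 * K)) with hD
    have hlow : ∀ j ∈ Finset.Ico (n / 2) n,
        D ^ 2 ≤ (((j + k).choose k : ℝ) * (r⁻¹ ^ j * ‖A ((T ^ j) x)‖)) ^ 2 := by
      intro j hj
      obtain ⟨hj1, hj2⟩ := Finset.mem_Ico.1 hj
      have hNj : N ≤ K * ‖A ((T ^ j) x)‖ := by
        have : (T ^ n * A) x = (T ^ (n - j)) (A ((T ^ j) x)) := by
          have e : T ^ n * A = T ^ (n - j) * (A * T ^ j) := by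
            rw [(hA.pow_right j).eq, ← mul_assoc, ← pow_add, Nat.sub_add_cancel hj2.le]
          rw [e]; rfl
        rw [hN, this]
        exact ((T ^ (n - j)).le_opNorm _).trans (by gcongr; exact hK _)
      have hrj : 1 / 3 ≤ r⁻¹ ^ j := by
        rw [inv_pow, one_div]
        gcongr
        exact (pow_le_pow_right₀ hr1.le hj2.le).trans hrn
      have hc := half_pow_le_factorial_mul_choose hj1 k
      have hf : (0 : ℝ) < k.factorial := by positivity
      gcongr
      rw [hD, div_le_iff₀ (by positivity)]
      calc ((n : ℝ) / 2) ^ k * N ≤ (k.factorial * ((j + k).choose k : ℝ)) *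
            (K * ‖A ((T ^ j) x)‖) := by gcongr
        _ = (((j + k).choose k : ℝ) * (1 / 3 * ‖A ((T ^ j) x)‖)) * (k.factorial * (3 * K)) := by ring
        _ ≤ _ := by gcongr
    have hcard : (n : ℝ) / 2 ≤ ((Finset.Ico (n / 2) n).card : ℝ) := by
      rw [Nat.card_Ico]
      have : n ≤ 2 * (n - n / 2) := by omega
      have : (n : ℝ) ≤ 2 * ((n - n / 2 : ℕ) : ℝ) := by exact_mod_cast this
      linarith
    have hsq : (n : ℝ) / 2 * D ^ 2 ≤ (2 ^ k * M) ^ 2 * ((K * ‖x‖) ^ 2 * (2 * n)) := by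
      calc (n : ℝ) / 2 * D ^ 2 ≤ ((Finset.Ico (n / 2) n).card : ℝ) * D ^ 2 := by gcongr
        _ = ∑ j ∈ Finset.Ico (n / 2) n, D ^ 2 := by rw [Finset.sum_const, nsmul_eq_mul]
        _ ≤ _ := Finset.sum_le_sum hlow
        _ ≤ _ := h1.sum_le_tsum _ fun j _ => sq_nonneg _
        _ ≤ _ := h2
        _ ≤ _ := by
          have : 0 ≤ (1 - r⁻¹)⁻¹ := inv_nonneg.2 (sub_nonneg.2 (inv_le_one_of_one_le₀ hr1.le))
          gcongr
    have hD2 : D ^ 2 ≤ (2 * (2 ^ k * M * (K * ‖x‖))) ^ 2 := by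
      refine le_of_mul_le_mul_left (hsq.trans_eq ?_) (half_pos hn0)
      ring
    have hD1 : D ≤ 2 * (2 ^ k * M * (K * ‖x‖)) := (sq_le_sq₀ (by positivity) (by positivity)).1 hD2
    rw [hD, div_le_iff₀ (by positivity), div_pow, div_mul_eq_mul_div, div_le_iff₀ (by positivity)]
      at hD1
    refine hD1.trans_eq ?_
    rw [show (4 : ℝ) = 2 * 2 by norm_num, mul_pow]
    ring
  have hop : ‖T ^ n * A‖ ≤ 6 * 4 ^ k * k.factorial * K ^ 2 * M / (n : ℝ) ^ k := by
    refine ContinuousLinearMap.opNorm_le_bound _ (by positivity) fun x => ?_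
    rw [div_mul_eq_mul_div, le_div_iff₀ (by positivity), mul_comm]
    exact hpt x
  rw [le_div_iff₀ (by positivity)] at hop
  rwa [mul_comm]

end HilbertSpace

section Resolvent

variable {B : Type*} [NormedRing B] [NormedAlgebra ℂ B] {T : B} {K : ℝ}

theorem norm_one_sub_mul_resolvent_pow_le {l : ℂ} (hl : IsUnit (algebraMap ℂ B l - T)) {k : ℕ}
    (hk : 0 < k) :
    ‖(1 - T) * resolvent T l ^ (k + 1)‖ ≤
      ‖resolvent T l‖ ^ k + ‖l - 1‖ * ‖resolvent T l‖ ^ (k + 1) := by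
  have h1 : (algebraMap ℂ B l - T) * resolvent T l = 1 := Ring.mul_inverse_cancel _ hl
  have h2 : (1 - T) * resolvent T l ^ (k + 1)
      = resolvent T l ^ k - (l - 1) • resolvent T l ^ (k + 1) := by
    have : (1 : B) - T = (algebraMap ℂ B l - T) - (l - 1) • 1 := by
      rw [Algebra.algebraMap_eq_smul_one, sub_smul, one_smul]
      abel
    rw [this, sub_mul, smul_one_mul, pow_succ' _ k, ← mul_assoc, h1, one_mul]
  rw [h2]
  refine (norm_sub_le _ _).trans ?_
  rw [norm_smul]
  gcongr
  · exact norm_pow_le' _ hk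
  · exact norm_pow_le' _ k.succ_pos

variable [CompleteSpace B]

theorem one_le_norm_resolvent_mul {z w : ℂ} (hz : z ∈ spectrum ℂ T) (hw : w ∉ spectrum ℂ T) :
    1 ≤ ‖resolvent T w‖ * ‖w - z‖ := by
  by_contra! h
  have hu : IsUnit (algebraMap ℂ B w - T) := spectrum.notMem_iff.1 hw
  have h1 : (algebraMap ℂ B w - T) * resolvent T w = 1 := Ring.mul_inverse_cancel _ hu
  have hs : ‖(w - z) • resolvent T w‖ < 1 := by rwa [norm_smul, mul_comm]
  refine hz ?_
  have e : algebraMap ℂ B z - T = (algebraMap ℂ B w - T) * (1 - (w - z) • resolvent T w) := by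
    rw [mul_sub, mul_one, mul_smul_comm, h1, sub_smul, Algebra.algebraMap_eq_smul_one,
      Algebra.algebraMap_eq_smul_one]
    abel
  change IsUnit (algebraMap ℂ B z - T)
  rw [e]
  exact hu.mul (Units.oneSub _ hs).isUnit

theorem norm_resolvent_smul_le (hK : ∀ n, ‖T ^ n‖ ≤ K) {w : ℂ} (hw : w ∉ spectrum ℂ T)
    (hw1 : ‖w‖ = 1) {r : ℝ} (hr : 1 < r) :
    ‖resolvent T (r * w)‖ ≤ (1 + K) * ‖resolvent T w‖ := by
  have hl : ‖(r : ℂ) * w‖ = r := by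
    rw [norm_mul, hw1, Complex.norm_real, Real.norm_of_nonneg (by linarith), mul_one]
  have hr1 : 0 < r - 1 := sub_pos.2 hr
  have hu : IsUnit (algebraMap ℂ B w - T) := spectrum.notMem_iff.1 hw
  have hv := (isUnit_algebraMap_sub_of_one_lt_norm hK (hl.symm ▸ hr : 1 < ‖(r : ℂ) * w‖)).1
  have h1 : (algebraMap ℂ B w - T) * resolvent T w = 1 := Ring.mul_inverse_cancel _ hu
  have h2 : resolvent T (r * w) * (algebraMap ℂ B (r * w) - T) = 1 := Ring.inverse_mul_cancel _ hv
  have h3 := norm_resolvent_le_of_one_lt_norm hK (hl.symm ▸ hr : 1 < ‖(r : ℂ) * w‖)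
  rw [hl] at h3
  have e : resolvent T (r * w) = resolvent T w
      - (r * w - w) • (resolvent T (r * w) * resolvent T w) := by
    have : (r * w - w) • (1 : B) = (algebraMap ℂ B (r * w) - T) - (algebraMap ℂ B w - T) := by
      rw [sub_smul, Algebra.algebraMap_eq_smul_one, Algebra.algebraMap_eq_smul_one]
      abel
    calc resolvent T (r * w)
        = resolvent T w - (resolvent T (r * w) * (algebraMap ℂ B (r * w) - T) * resolvent T w
            - resolvent T (r * w) * ((algebraMap ℂ B w - T) * resolvent T w)) := by
          rw [h1, h2]; simp
      _ = resolvent T w - resolvent T (r * w) * ((r * w - w) • (1 : B)) * resolvent T w := by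
          rw [this]; noncomm_ring
      _ = _ := by rw [mul_smul_comm, mul_one, smul_mul_assoc]
  have hn : ‖(r : ℂ) * w - w‖ = r - 1 := by
    rw [show (r : ℂ) * w - w = ((r - 1 : ℝ) : ℂ) * w by push_cast; ring, norm_mul, hw1,
      Complex.norm_real, Real.norm_of_nonneg hr1.le, mul_one]
  calc ‖resolvent T (r * w)‖
      ≤ ‖resolvent T w‖ + (r - 1) * (K / (r - 1) * ‖resolvent T w‖) := by
        rw [e]
        refine (norm_sub_le _ _).trans ?_
        rw [norm_smul, hn]
        gcongr
        exact (norm_mul_le _ _).trans (by gcongr)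
    _ = (1 + K) * ‖resolvent T w‖ := by field_simp

end Resolvent

theorem mul_pow_le_rightInv {m : ℝ → ℝ} (hmanti : AntitoneOn m (Set.Ioc 0 Real.pi))
    (hmpos : ∀ ε ∈ Set.Ioc (0:ℝ) Real.pi, 0 < m ε) {c α ε₀ : ℝ} (hc : 0 < c)
    (hε₀ : ε₀ ∈ Set.Ioc (0:ℝ) Real.pi)
    (hrpi : ∀ t ≥ (1:ℝ), ∀ ε ∈ Set.Ioc (0:ℝ) ε₀, c * t ^ α ≤ m (ε / t) / m ε)
    {k : ℕ} (hk : 1 ≤ α * k) {s : ℝ} (hs : m ε₀ ≤ s) (hpos : 0 < rightInv m s) {θ : ℝ}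
    (hθ : rightInv m s < θ) (hθπ : θ ≤ Real.pi) :
    θ * m θ ^ k ≤ 2 * (Real.pi / ε₀) * (1 / c) ^ k * s ^ k * rightInv m s := by
  have hne : {ε : ℝ | ε ∈ Set.Ioc 0 Real.pi ∧ m ε ≤ s}.Nonempty := ⟨ε₀, hε₀, hs⟩
  obtain ⟨ε₁, ⟨hε₁, hmε₁⟩, hlt⟩ := exists_lt_of_csInf_lt hne
    (show rightInv m s < min θ (2 * rightInv m s) from lt_min hθ (by linarith))
  have hθ0 : 0 < θ := hpos.trans hθ
  obtain ⟨ε, hε0, hεε₀, hεθ, hε2, hmε⟩ :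
      ∃ ε, 0 < ε ∧ ε ≤ ε₀ ∧ ε ≤ θ ∧ ε ≤ 2 * rightInv m s ∧ m ε ≤ s := by
    have h1 := hlt.le.trans (min_le_left _ _)
    have h2 := hlt.le.trans (min_le_right _ _)
    rcases le_total ε₁ ε₀ with h | h
    · exact ⟨ε₁, hε₁.1, h, h1, h2, hmε₁⟩
    · exact ⟨ε₀, hε₀.1, le_rfl, h.trans h1, h.trans h2, hs⟩
  set θ₁ := min θ ε₀ with hθ₁
  have hθ₁0 : 0 < θ₁ := lt_min hθ0 hε₀.1
  have hθ₁mem : θ₁ ∈ Set.Ioc (0:ℝ) Real.pi := ⟨hθ₁0, (min_le_left _ _).trans hθπ⟩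
  have hmθ : 0 < m θ := hmpos _ ⟨hθ0, hθπ⟩
  have hmθ₁ : m θ ≤ m θ₁ := hmanti hθ₁mem ⟨hθ0, hθπ⟩ (min_le_left _ _)
  set t := θ₁ / ε with ht
  have ht1 : 1 ≤ t := (one_le_div hε0).2 (le_min hεθ hεε₀)
  have ht0 : 0 < t := one_pos.trans_le ht1
  have hgrow : c * t ^ α * m θ ≤ s := by
    have h := hrpi t ht1 θ₁ ⟨hθ₁0, min_le_right _ _⟩
    rw [show θ₁ / t = ε by rw [ht]; field_simp, le_div_iff₀ (hmpos _ hθ₁mem)] at h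
    exact le_trans (by gcongr) (h.trans hmε)
  have hpow : t ≤ (t ^ α) ^ k := by
    rw [← Real.rpow_mul_natCast ht0.le]
    exact Real.self_le_rpow_of_one_le ht1 hk
  have hθle : θ ≤ Real.pi / ε₀ * (t * ε) := by
    rw [show t * ε = θ₁ by rw [ht]; field_simp, div_mul_eq_mul_div, le_div_iff₀ hε₀.1]
    rcases min_cases θ ε₀ with ⟨h, -⟩ | ⟨h, -⟩
    · rw [hθ₁, h, mul_comm]
      have := hε₀.2
      gcongr
    · rw [hθ₁, h]
      have := hε₀.1
      gcongr
  have hπ := Real.pi_pos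
  have hε₀0 := hε₀.1
  calc θ * m θ ^ k ≤ Real.pi / ε₀ * ((t ^ α) ^ k * (2 * rightInv m s)) * m θ ^ k := by
        gcongr
        exact hθle.trans (by gcongr)
    _ = 2 * (Real.pi / ε₀) * (1 / c) ^ k * (c * t ^ α * m θ) ^ k * rightInv m s := by
        rw [mul_pow, mul_pow, one_div, inv_pow]
        field_simp
    _ ≤ _ := by gcongr

theorem one_div_le_rightInv {m : ℝ → ℝ} {s ε₀ : ℝ} (hs0 : 0 < s)
    (hε₀ : ε₀ ∈ Set.Ioc (0:ℝ) Real.pi) (hs : m ε₀ ≤ s)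
    (hm : ∀ ε ∈ Set.Ioc (0:ℝ) Real.pi, 1 ≤ m ε * ε) : 1 / s ≤ rightInv m s := by
  refine le_csInf ⟨ε₀, hε₀, hs⟩ fun ε ⟨hε, hmε⟩ => ?_
  rw [div_le_iff₀ hs0, mul_comm]
  exact (hm ε hε).trans (mul_le_mul_of_nonneg_right hmε hε.1.le)

/-- **Main theorem.** For a power-bounded operator `T` on a Hilbert space with
`σ(T) ∩ 𝕋 = {1}` and resolvent bound `m` of reciprocally positive increase,
`‖Tⁿ(I-T)‖ = O(m⁻¹(n))` as `n → ∞`. -/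
theorem kt_upper_bound_hilbert {X : Type*} [NormedAddCommGroup X] [InnerProductSpace ℂ X]
    [CompleteSpace X]
    (T : X →L[ℂ] X) (hpb : ∃ K : ℝ, ∀ n : ℕ, ‖T ^ n‖ ≤ K)
    (hspec : spectrum ℂ T ∩ {z : ℂ | ‖z‖ = 1} = {1})
    (m : ℝ → ℝ)
    (hmc : ContinuousOn m (Set.Ioc 0 Real.pi))
    (hmanti : AntitoneOn m (Set.Ioc 0 Real.pi))
    (hmpos : ∀ ε ∈ Set.Ioc (0:ℝ) Real.pi, 0 < m ε)
    (hrpi : HasRecipPosIncrease m)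
    (hres : ∀ θ : ℝ, 0 < |θ| → |θ| ≤ Real.pi →
      ‖resolvent T (Complex.exp (Complex.I * θ))‖ ≤ m |θ|) :
    ∃ C > (0:ℝ), ∃ N : ℕ, ∀ n ≥ N, ‖T ^ n * (1 - T)‖ ≤ C * rightInv m n := by
  obtain ⟨K₀, hK₀⟩ := hpb
  set K := max K₀ 1
  have hK : ∀ n, ‖T ^ n‖ ≤ K := fun n => (hK₀ n).trans (le_max_left _ _)
  have hK1 : 1 ≤ K := le_max_right _ _
  obtain ⟨c, hc, α, hα, ε₀, hε₀, hrpi⟩ := hrpi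
  have hspec1 : (1 : ℂ) ∈ spectrum ℂ T := (hspec.symm ▸ Set.mem_singleton (1 : ℂ) :).1
  have hreg : ∀ θ : ℝ, 0 < |θ| → |θ| ≤ Real.pi →
      Complex.exp (Complex.I * θ) ∉ spectrum ℂ T := by
    intro θ h0 hπ hmem
    have h1 : Complex.exp (Complex.I * θ) ∈ ({1} : Set ℂ) :=
      hspec ▸ ⟨hmem, Complex.norm_exp_I_mul_ofReal θ⟩
    obtain ⟨n, hn⟩ := Complex.exp_eq_one_iff.1 (Set.mem_singleton_iff.1 h1)
    have h2 : θ = n * (2 * Real.pi) := by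
      have : (θ : ℂ) = n * (2 * Real.pi) := by
        refine mul_left_cancel₀ Complex.I_ne_zero (hn.trans ?_)
        ring
      exact_mod_cast this
    have hn0 : n ≠ 0 := by
      rintro rfl
      simp [h2] at h0
    have h3 : (1 : ℝ) ≤ |(n : ℝ)| := by exact_mod_cast Int.one_le_abs hn0
    rw [h2, abs_mul, abs_of_pos (by positivity : 0 < 2 * Real.pi)] at hπ
    nlinarith [Real.pi_pos]
  have hlower : ∀ ε ∈ Set.Ioc (0:ℝ) Real.pi, 1 ≤ m ε * ε := by
    intro ε hε
    have ha : |ε| = ε := abs_of_pos hε.1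
    have h1 := one_le_norm_resolvent_mul hspec1 (hreg ε (ha.symm ▸ hε.1) (ha.symm ▸ hε.2))
    have h2 := hres ε (ha.symm ▸ hε.1) (ha.symm ▸ hε.2)
    have h3 : ‖Complex.exp (Complex.I * ε) - 1‖ ≤ ε := by
      simpa [ha] using Real.norm_exp_I_mul_ofReal_sub_one_le (x := ε)
    rw [ha] at h2
    have := hε.1
    have := (hmpos ε hε).le
    exact h1.trans (by gcongr)
  set k := ⌈1 / α⌉₊
  have hk0 : 0 < k := Nat.ceil_pos.2 (by positivity)
  have hkα : 1 ≤ α * ((k + 1 : ℕ) : ℝ) := by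
    have h1 : 1 / α ≤ k := Nat.le_ceil _
    rw [div_le_iff₀ hα] at h1
    push_cast
    linarith
  have hπ := Real.pi_pos
  have hc0 := hc.1
  have hε₀0 := hε₀.1
  set D := 3 * K ^ (k + 1) + (1 + K) ^ (k + 1) * (2 * (Real.pi / ε₀) * (1 / c) ^ (k + 1)) with hD
  have hD0 : 0 < D := by positivity
  refine ⟨6 * 4 ^ (k + 1) * (k + 1).factorial * K ^ 2 * D, by positivity, max 1 ⌈m ε₀⌉₊,
    fun n hn => ?_⟩
  have hn1 : 1 ≤ n := (le_max_left _ _).trans hn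
  have hn0 : (0 : ℝ) < n := by exact_mod_cast hn1
  have hmn : m ε₀ ≤ n := (Nat.le_ceil _).trans (by exact_mod_cast (le_max_right _ _).trans hn)
  set δ := rightInv m n with hδ
  have hnδ : 1 / (n : ℝ) ≤ δ := one_div_le_rightInv hn0 hε₀ hmn hlower
  have hδ0 : 0 < δ := (one_div_pos.2 hn0).trans_le hnδ
  have hM : ∀ l : ℂ, ‖l‖ = 1 + 1 / n →
      ‖(1 - T) * resolvent T l ^ (k + 1)‖ ≤ D * n ^ (k + 1) * δ := by
    intro l hl
    have hr1 : (1 : ℝ) < 1 + 1 / n := by linarith [one_div_pos.2 hn0]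
    have hl1 : 1 < ‖l‖ := hl ▸ hr1
    set a := ‖resolvent T l‖ with ha
    have ha0 : 0 ≤ a := norm_nonneg _
    have haK : a ≤ K * n := by
      have := norm_resolvent_le_of_one_lt_norm hK hl1
      rwa [hl, add_sub_cancel_left, div_div_eq_mul_div, div_one] at this
    set θ := Complex.arg l with hθ
    have hlθ : l = ((1 + 1 / n : ℝ) : ℂ) * Complex.exp (Complex.I * θ) := by
      rw [← hl, mul_comm Complex.I, Complex.norm_mul_exp_arg_mul_I]
    have hdist : ‖l - 1‖ ≤ 1 / n + |θ| := by
      have : l - 1 = ((1 / n : ℝ) : ℂ) * Complex.exp (Complex.I * θ)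
          + (Complex.exp (Complex.I * θ) - 1) := by
        rw [hlθ]; push_cast; ring
      rw [this]
      refine (norm_add_le _ _).trans ?_
      gcongr
      · rw [norm_mul, Complex.norm_exp_I_mul_ofReal, mul_one, Complex.norm_real,
          Real.norm_of_nonneg (by positivity)]
      · exact Real.norm_exp_I_mul_ofReal_sub_one_le
    have hnk : (n : ℝ) ^ k ≤ n ^ (k + 1) * δ := by
      rw [pow_succ, mul_assoc]
      refine le_mul_of_one_le_right (by positivity) ?_
      rwa [div_le_iff₀ hn0, mul_comm] at hnδ
    have hKk : K ^ k ≤ K ^ (k + 1) := pow_le_pow_right₀ hK1 k.le_succ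
    have b1 : a ^ k ≤ K ^ (k + 1) * (n ^ (k + 1) * δ) := by
      calc a ^ k ≤ (K * n) ^ k := by gcongr
        _ = K ^ k * n ^ k := mul_pow _ _ _
        _ ≤ _ := by gcongr
    have b2 : a ^ (k + 1) ≤ K ^ (k + 1) * n ^ (k + 1) := by
      rw [← mul_pow]; gcongr
    have b3 : 1 / n * a ^ (k + 1) ≤ K ^ (k + 1) * (n ^ (k + 1) * δ) := by
      calc 1 / n * a ^ (k + 1) ≤ δ * (K ^ (k + 1) * n ^ (k + 1)) := by gcongr
        _ = _ := by ring
    have b4 : |θ| * a ^ (k + 1) ≤ K ^ (k + 1) * (n ^ (k + 1) * δ) + (1 + K) ^ (k + 1) *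
        (2 * (Real.pi / ε₀) * (1 / c) ^ (k + 1)) * (n ^ (k + 1) * δ) := by
      rcases le_or_gt |θ| δ with h | h
      · calc |θ| * a ^ (k + 1) ≤ δ * (K ^ (k + 1) * n ^ (k + 1)) := by gcongr
          _ = K ^ (k + 1) * (n ^ (k + 1) * δ) := by ring
          _ ≤ _ := le_add_of_nonneg_right (by positivity)
      · have hθ0 : 0 < |θ| := hδ0.trans h
        have hθπ : |θ| ≤ Real.pi := Complex.abs_arg_le_pi l
        have h1 : a ≤ (1 + K) * m |θ| := by
          have := norm_resolvent_smul_le hK (hreg θ hθ0 hθπ) (Complex.norm_exp_I_mul_ofReal θ) hr1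
          rw [← hlθ] at this
          refine this.trans ?_
          gcongr
          exact hres θ hθ0 hθπ
        have h2 := mul_pow_le_rightInv hmanti hmpos hc0 hε₀ hrpi hkα hmn hδ0 h hθπ
        calc |θ| * a ^ (k + 1) ≤ |θ| * ((1 + K) * m |θ|) ^ (k + 1) := by gcongr
          _ = (1 + K) ^ (k + 1) * (|θ| * m |θ| ^ (k + 1)) := by rw [mul_pow]; ring
          _ ≤ (1 + K) ^ (k + 1) * (2 * (Real.pi / ε₀) * (1 / c) ^ (k + 1) * n ^ (k + 1) * δ) := by
            gcongr
          _ = (1 + K) ^ (k + 1) * (2 * (Real.pi / ε₀) * (1 / c) ^ (k + 1)) * (n ^ (k + 1) * δ) := by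
            ring
          _ ≤ _ := le_add_of_nonneg_left (by positivity)
    calc ‖(1 - T) * resolvent T l ^ (k + 1)‖ ≤ a ^ k + ‖l - 1‖ * a ^ (k + 1) :=
          norm_one_sub_mul_resolvent_pow_le (isUnit_algebraMap_sub_of_one_lt_norm hK hl1).1 hk0
      _ ≤ a ^ k + (1 / n + |θ|) * a ^ (k + 1) := by gcongr
      _ = a ^ k + (1 / n * a ^ (k + 1) + |θ| * a ^ (k + 1)) := by ring
      _ ≤ _ := by
        refine (add_le_add b1 (add_le_add b3 b4)).trans_eq ?_
        rw [hD]; ring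
  have hfin := pow_mul_norm_pow_mul_le hK hK1 ((Commute.one_left T).sub_left (Commute.refl T)) hn1
    (by positivity) hM
  have hnp : (0 : ℝ) < (n : ℝ) ^ (k + 1) := by positivity
  refine le_of_mul_le_mul_left (hfin.trans_eq ?_) hnp
  ring
end

section
/- Let X be a complex Banach space and let T be a bounded linear operator on X such that 1 ∈ σ(T) and σ(T) ∩ 𝕋 ⊆ {1}. Let m : (0,π] → (0,∞) be a continuous non-increasing function such that ‖R(e^{iθ},T)‖ ≤ m(|θ|) for 0 < |θ| ≤ π, and suppose there exists δ ∈ (0,1] such that max_{ε≤|θ|≤π} 1/dist(e^{iθ},σ(T)) ≥ δ m(ε) for all ε ∈ (0,π]. If there exist c > 0, C > 0 and N ∈ ℕ such that ‖Tⁿ(I − T)‖ ≤ C m⁻¹(cn) for all n ≥ N, then m has reciprocally positive increase. -/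
open Filter Topology

/-- The norm of the resolvent is at least the reciprocal of the distance to any spectral point. -/
lemma inv_norm_sub_le_norm_resolvent {A : Type*} [NormedRing A] [NormedAlgebra ℂ A]
    [CompleteSpace A] {a : A} {z w : ℂ} (hz : z ∉ spectrum ℂ a) (hw : w ∈ spectrum ℂ a) :
    ‖z - w‖⁻¹ ≤ ‖resolvent a z‖ := by
  have : Nontrivial A := by
    by_contra h
    rw [not_nontrivial_iff_subsingleton] at h
    exact hw (isUnit_of_subsingleton _)
  obtain ⟨u, hu⟩ := spectrum.notMem_iff.mp hz
  have hres : resolvent a z = ((u⁻¹ : Aˣ) : A) := by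
    rw [resolvent, ← hu, Ring.inverse_unit]
  have hpos : 0 < ‖((u⁻¹ : Aˣ) : A)‖ := Units.norm_pos _
  rw [hres]
  by_contra! h
  refine spectrum.mem_iff.mp hw ?_
  have hne : 0 < ‖z - w‖ := inv_pos.mp (hpos.trans h)
  have hlt : ‖(z - w) • ((u⁻¹ : Aˣ) : A)‖ < 1 := by
    rw [norm_smul]
    calc ‖z - w‖ * ‖((u⁻¹ : Aˣ) : A)‖ < ‖z - w‖ * ‖z - w‖⁻¹ := by gcongr
      _ = 1 := mul_inv_cancel₀ hne.ne'
  have hunit : IsUnit (1 - (z - w) • ((u⁻¹ : Aˣ) : A)) := isUnit_one_sub_of_norm_lt_one hlt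
  have hmul : algebraMap ℂ A w - a = u * (1 - (z - w) • ((u⁻¹ : Aˣ) : A)) := by
    rw [mul_sub, mul_one, mul_smul_comm, Units.mul_inv, hu, ← Algebra.algebraMap_eq_smul_one,
      map_sub]
    abel
  rw [hmul]
  exact u.isUnit.mul hunit

/-- A geometric growth condition along one ratio implies reciprocally positive increase. -/
lemma HasRecipPosIncrease.of_two_mul_le {m : ℝ → ℝ} {ε₀ q : ℝ}
    (hmanti : AntitoneOn m (Set.Ioc 0 Real.pi)) (hmpos : ∀ ε ∈ Set.Ioc (0:ℝ) Real.pi, 0 < m ε)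
    (hε₀ : ε₀ ∈ Set.Ioc (0:ℝ) Real.pi) (hq0 : 0 < q) (hq1 : q < 1)
    (hstep : ∀ ε ∈ Set.Ioc (0:ℝ) ε₀, 2 * m ε ≤ m (q * ε)) :
    HasRecipPosIncrease m := by
  have hpow : ∀ k : ℕ, ∀ ε ∈ Set.Ioc (0:ℝ) ε₀, 2 ^ k * m ε ≤ m (q ^ k * ε) := by
    intro k ε hε
    induction k with
    | zero => simp
    | succ k ih =>
      have hk : q ^ k * ε ∈ Set.Ioc (0:ℝ) ε₀ :=
        ⟨mul_pos (pow_pos hq0 k) hε.1,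
          (mul_le_of_le_one_left hε.1.le (pow_le_one₀ hq0.le hq1.le)).trans hε.2⟩
      calc 2 ^ (k + 1) * m ε = 2 * (2 ^ k * m ε) := by ring
        _ ≤ 2 * m (q ^ k * ε) := by gcongr
        _ ≤ m (q * (q ^ k * ε)) := hstep _ hk
        _ = m (q ^ (k + 1) * ε) := by ring_nf
  have hqi : 1 < q⁻¹ := (one_lt_inv₀ hq0).mpr hq1
  have hlog : 0 < Real.log q⁻¹ := Real.log_pos hqi
  have hlog2 : 0 < Real.log 2 := Real.log_pos one_lt_two
  refine ⟨1 / 2, by norm_num, Real.log 2 / Real.log q⁻¹, by positivity, ε₀, hε₀, ?_⟩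
  intro t ht ε hε
  have ht0 : 0 < t := by linarith
  obtain ⟨k, hk1, hk2⟩ := exists_nat_pow_near ht hqi
  have hεpi : ε ∈ Set.Ioc (0:ℝ) Real.pi := ⟨hε.1, hε.2.trans hε₀.2⟩
  have hmono : m (q ^ k * ε) ≤ m (ε / t) := by
    have hle : ε / t ≤ q ^ k * ε := by
      rw [inv_pow] at hk1
      rw [div_eq_inv_mul]
      exact mul_le_mul_of_nonneg_right (inv_le_of_inv_le₀ (by positivity) hk1) hε.1.le
    have hqk : q ^ k * ε ≤ Real.pi :=
      (mul_le_of_le_one_left hε.1.le (pow_le_one₀ hq0.le hq1.le)).trans hεpi.2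
    exact hmanti ⟨div_pos hε.1 ht0, hle.trans hqk⟩ ⟨mul_pos (pow_pos hq0 k) hε.1, hqk⟩ hle
  have hrpow : t ^ (Real.log 2 / Real.log q⁻¹) ≤ 2 ^ (k + 1) := by
    rw [Real.rpow_def_of_pos ht0, ← Real.le_log_iff_exp_le (by positivity), Real.log_pow]
    have hlt := Real.log_le_log ht0 hk2.le
    rw [Real.log_pow] at hlt
    rw [← mul_div_assoc, div_le_iff₀ hlog]
    nlinarith
  rw [le_div_iff₀ (hmpos ε hεpi)]
  calc 1 / 2 * t ^ (Real.log 2 / Real.log q⁻¹) * m ε ≤ 1 / 2 * 2 ^ (k + 1) * m ε := by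
        have := hmpos ε hεpi
        gcongr
    _ = 2 ^ k * m ε := by ring
    _ ≤ m (ε / t) := (hpow k ε hε).trans hmono

lemma lt_apply_of_lt_rightInv {m : ℝ → ℝ} {s x : ℝ} (hx : x ∈ Set.Ioc (0:ℝ) Real.pi)
    (h : x < rightInv m s) : s < m x := by
  by_contra! hs
  exact h.not_ge (csInf_le ⟨0, fun y hy => hy.1.1.le⟩ ⟨hx, hs⟩)

lemma exp_neg_two_mul_le_one_sub {x : ℝ} (hx0 : 0 ≤ x) (hx : x ≤ 1 / 2) :
    Real.exp (-(2 * x)) ≤ 1 - x := by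
  rw [Real.exp_neg]
  refine inv_le_of_inv_le₀ (by linarith) ((?_ : _ ≤ 2 * x + 1).trans (Real.add_one_le_exp _))
  rw [inv_le_iff_one_le_mul₀ (by linarith)]
  nlinarith

lemma norm_pow_mul_norm_one_sub_le {X : Type*} [NormedAddCommGroup X] [NormedSpace ℂ X]
    [CompleteSpace X] {T : X →L[ℂ] X} {w : ℂ} (hw : w ∈ spectrum ℂ T) (n : ℕ) :
    ‖w‖ ^ n * ‖1 - w‖ ≤ ‖T ^ n * (1 - T)‖ := by
  have : Nontrivial X := by
    by_contra h
    rw [not_nontrivial_iff_subsingleton] at h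
    exact hw (isUnit_of_subsingleton _)
  have h := spectrum.subset_polynomial_aeval T (Polynomial.X ^ n * (1 - Polynomial.X))
    (Set.mem_image_of_mem _ hw)
  simpa using spectrum.norm_le_norm_of_mem h

lemma two_div_pi_mul_abs_le_norm_exp_sub_one {θ : ℝ} (hθ : |θ| ≤ Real.pi) :
    2 / Real.pi * |θ| ≤ ‖Complex.exp (Complex.I * θ) - 1‖ := by
  rw [Complex.norm_exp_I_mul_ofReal_sub_one, norm_mul, Real.norm_ofNat, Real.norm_eq_abs]
  have h := Real.mul_abs_le_abs_sin (x := θ / 2) (by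
    rw [abs_div, abs_two]; linarith)
  rw [abs_div, abs_two] at h
  linarith

/-- Necessity of reciprocally positive increase: if the resolvent bound `m` is attained
up to a constant `δ` by the reciprocal of the distance to the spectrum, and
`‖Tⁿ(I-T)‖ = O(m⁻¹(cn))`, then `m` has reciprocally positive increase. -/
theorem recipPosIncrease_necessary {X : Type*} [NormedAddCommGroup X] [NormedSpace ℂ X]
    [CompleteSpace X] (T : X →L[ℂ] X)
    (h1 : (1:ℂ) ∈ spectrum ℂ T)
    (hspec : spectrum ℂ T ∩ {z : ℂ | ‖z‖ = 1} ⊆ {1})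
    (m : ℝ → ℝ)
    (hmc : ContinuousOn m (Set.Ioc 0 Real.pi))
    (hmanti : AntitoneOn m (Set.Ioc 0 Real.pi))
    (hmpos : ∀ ε ∈ Set.Ioc (0:ℝ) Real.pi, 0 < m ε)
    (hres : ∀ θ : ℝ, 0 < |θ| → |θ| ≤ Real.pi →
      ‖resolvent T (Complex.exp (Complex.I * θ))‖ ≤ m |θ|)
    (δ : ℝ) (hδ : δ ∈ Set.Ioc (0:ℝ) 1)
    (hlow : ∀ ε ∈ Set.Ioc (0:ℝ) Real.pi, ∃ θ : ℝ, ε ≤ |θ| ∧ |θ| ≤ Real.pi ∧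
      δ * m ε ≤ (Metric.infDist (Complex.exp (Complex.I * θ)) (spectrum ℂ T))⁻¹)
    (c C : ℝ) (hc : 0 < c) (hC : 0 < C) (N : ℕ)
    (hdecay : ∀ n ≥ N, ‖T ^ n * (1 - T)‖ ≤ C * rightInv m (c * n)) :
    HasRecipPosIncrease m := by
  have hpi := Real.pi_pos
  have hnorm : ∀ θ : ℝ, ‖Complex.exp (Complex.I * θ)‖ = 1 := fun θ => by
    rw [mul_comm]; exact Complex.norm_exp_ofReal_mul_I θ
  have hexp_ne : ∀ θ : ℝ, 0 < |θ| → |θ| ≤ Real.pi → Complex.exp (Complex.I * θ) ≠ 1 := by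
    intro θ h0 hθ h
    have := two_div_pi_mul_abs_le_norm_exp_sub_one hθ
    rw [h, sub_self, norm_zero] at this
    exact this.not_gt (by positivity)
  have hinv_le : ∀ ε ∈ Set.Ioc (0:ℝ) Real.pi, ε⁻¹ ≤ m ε := by
    intro ε hε
    have habs : |ε| = ε := abs_of_pos hε.1
    have hne := hexp_ne ε (habs.symm ▸ hε.1) (habs.symm ▸ hε.2)
    have hr := hres ε (habs.symm ▸ hε.1) (habs.symm ▸ hε.2)
    rw [habs] at hr
    have hnot : Complex.exp (Complex.I * ε) ∉ spectrum ℂ T :=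
      fun h => hne (hspec ⟨h, hnorm ε⟩)
    refine le_trans ?_ ((inv_norm_sub_le_norm_resolvent hnot h1).trans hr)
    have hle := Real.norm_exp_I_mul_ofReal_sub_one_le (x := ε)
    rw [Real.norm_eq_abs, habs] at hle
    exact inv_anti₀ (norm_pos_iff.mpr (sub_ne_zero.mpr hne)) hle
  obtain ⟨hδ0, hδ1⟩ := hδ
  set A : ℝ := Real.exp (-(2 * (2 / c + N + 1) / δ)) with hA
  have hA0 : 0 < A := Real.exp_pos _
  set q : ℝ := min (1 / 2) (min (A / (2 * Real.pi * C)) (δ / (2 * Real.pi))) with hq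
  have hq0 : 0 < q := by positivity
  have hq2 : q ≤ 1 / 2 := min_le_left _ _
  have hqA : q ≤ A / (2 * Real.pi * C) := (min_le_right _ _).trans (min_le_left _ _)
  have hqδ : q ≤ δ / (2 * Real.pi) := (min_le_right _ _).trans (min_le_right _ _)
  refine HasRecipPosIncrease.of_two_mul_le (ε₀ := 1) hmanti hmpos
    ⟨one_pos, by linarith [Real.pi_gt_three]⟩ hq0 (by linarith) fun ε ⟨hε0, hε1⟩ => ?_
  have hε : ε ∈ Set.Ioc (0:ℝ) Real.pi := ⟨hε0, by linarith [Real.pi_gt_three]⟩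
  have hqε : q * ε ∈ Set.Ioc (0:ℝ) Real.pi := ⟨by positivity, by nlinarith [hε.2]⟩
  have hM0 := hmpos ε hε
  rcases le_or_gt (δ * ε * m ε) Real.pi with hsmall | hlarge
  · refine le_trans ?_ (hinv_le _ hqε)
    rw [le_inv_comm₀ (by positivity) hqε.1, le_inv_comm₀ hqε.1 (by positivity), ← one_div,
      le_div_iff₀ hqε.1]
    rw [le_div_iff₀ (by positivity)] at hqδ
    have h := mul_le_mul_of_nonneg_right hqδ (mul_pos hε0 hM0).le
    nlinarith
  · obtain ⟨θ, hθε, hθ, hdist⟩ := hlow ε hε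
    obtain ⟨w, hw, hwdist⟩ := (spectrum.isCompact T).exists_infDist_eq_dist ⟨1, h1⟩
      (Complex.exp (Complex.I * θ))
    rw [hwdist, dist_eq_norm] at hdist
    set z := Complex.exp (Complex.I * θ) with hz
    have hδM : 0 < δ * m ε := by positivity
    have hclose : ‖z - w‖ ≤ (δ * m ε)⁻¹ := by
      refine (le_inv_comm₀ hδM ?_).mp hdist
      exact inv_pos.mp (hδM.trans_le hdist)
    have hδM3 : Real.pi < δ * m ε := by nlinarith
    have hx2 : (δ * m ε)⁻¹ ≤ 1 / 2 := by
      rw [one_div]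
      exact inv_anti₀ two_pos (by linarith [Real.pi_gt_three])
    have hxε : (δ * m ε)⁻¹ ≤ ε / Real.pi := by
      rw [inv_le_iff_one_le_mul₀ hδM, div_mul_eq_mul_div, le_div_iff₀ hpi]
      linarith
    have hwnorm : 1 - (δ * m ε)⁻¹ ≤ ‖w‖ := by
      have := norm_sub_norm_le z w
      rw [hnorm θ] at this
      linarith
    have hw1 : ε / Real.pi ≤ ‖1 - w‖ := by
      have hlb := two_div_pi_mul_abs_le_norm_exp_sub_one hθ
      have htri : ‖z - 1‖ ≤ ‖z - w‖ + ‖1 - w‖ := by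
        rw [norm_sub_rev 1 w]; exact norm_sub_le_norm_sub_add_norm_sub z w 1
      have : 2 / Real.pi * ε ≤ 2 / Real.pi * |θ| := by gcongr
      have : 2 / Real.pi * ε = ε / Real.pi + ε / Real.pi := by ring
      linarith
    set n : ℕ := ⌈2 * m ε / c⌉₊ + N with hn
    have hn_lower : 2 * m ε ≤ c * n := by
      have := Nat.le_ceil (2 * m ε / c)
      rw [div_le_iff₀ hc] at this
      rw [hn]; push_cast
      nlinarith [mul_nonneg hc.le (Nat.cast_nonneg (α := ℝ) N)]
    have hM1 : 1 ≤ m ε := by nlinarith [Real.pi_gt_three]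
    have hn_upper : (n : ℝ) ≤ (2 / c + N + 1) * m ε := by
      have := Nat.ceil_lt_add_one (a := 2 * m ε / c) (by positivity)
      have hN : (N : ℝ) ≤ N * m ε := le_mul_of_one_le_right (Nat.cast_nonneg N) hM1
      have : 2 * m ε / c = 2 / c * m ε := by ring
      rw [hn]; push_cast
      linarith
    have hpowA : A ≤ ‖w‖ ^ n := by
      calc A ≤ Real.exp (-(2 * (δ * m ε)⁻¹)) ^ n := by
            rw [← Real.exp_nat_mul, hA, Real.exp_le_exp, mul_neg, neg_le_neg_iff]
            have : 2 * (2 / c + N + 1) / δ =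
                (2 / c + N + 1) * m ε * (2 * (δ * m ε)⁻¹) := by
              field_simp
            rw [this]
            gcongr
        _ ≤ ‖w‖ ^ n := by
            gcongr
            exact (exp_neg_two_mul_le_one_sub (by positivity) hx2).trans hwnorm
    have hbound : A * (ε / Real.pi) ≤ C * rightInv m (c * n) :=
      calc A * (ε / Real.pi) ≤ ‖w‖ ^ n * ‖1 - w‖ := by gcongr
        _ ≤ _ := (norm_pow_mul_norm_one_sub_le hw n).trans (hdecay n (Nat.le_add_left _ _))
    refine hn_lower.trans (lt_apply_of_lt_rightInv hqε ?_).le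
    refine lt_of_lt_of_le ?_ ((div_le_iff₀' hC).mpr hbound)
    calc q * ε ≤ A / (2 * Real.pi * C) * ε := by gcongr
      _ = A * (ε / Real.pi) / C / 2 := by field_simp
      _ < A * (ε / Real.pi) / C := half_lt_self (by positivity)
end

section
/- Let X be a finite-dimensional complex normed space and let T be a power-bounded linear operator on X such that σ(T) ∩ 𝕋 ⊆ {1}. Then there exist α ∈ [0,1) and C > 0 such that ‖Tⁿ(I − T)‖ ≤ C αⁿ for all n ≥ 1. -/
open Filter Topology

theorem exists_norm_pow_le_of_spectralRadius_lt_one {A : Type*} [NormedRing A] [NormedAlgebra ℂ A]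
    [CompleteSpace A] {a : A} (ha : spectralRadius ℂ a < 1) :
    ∃ α ∈ Set.Ico (0 : ℝ) 1, ∃ C > (0 : ℝ), ∀ n : ℕ, ‖a ^ n‖ ≤ C * α ^ n := by
  obtain ⟨α, haα, hα1⟩ := ENNReal.lt_iff_exists_nnreal_btwn.mp ha
  have hα0 : 0 < α := by exact_mod_cast (zero_le).trans_lt haα
  have hO : (fun n : ℕ => a ^ n) =O[atTop] fun n => (α : ℝ) ^ n := by
    refine Asymptotics.IsBigO.of_bound 1 ?_
    filter_upwards [(spectrum.pow_norm_pow_one_div_tendsto_nhds_spectralRadius a).eventually_lt_const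
      haα, eventually_ge_atTop 1] with n hn hn1
    rw [← ENNReal.ofReal_coe_nnreal] at hn
    have h := (ENNReal.ofReal_lt_ofReal_iff (by exact_mod_cast hα0)).mp hn
    have h' := pow_le_pow_left₀ (by positivity) h.le n
    rw [one_div, Real.rpow_inv_natCast_pow (norm_nonneg _) (by lia)] at h'
    simpa using h'
  obtain ⟨C, hC, h⟩ := Asymptotics.bound_of_isBigO_nat_atTop hO
  refine ⟨α, ⟨α.coe_nonneg, by exact_mod_cast hα1⟩, C, hC, fun n => ?_⟩
  simpa using h (x := n) (by positivity)

section

variable {X : Type*} [NormedAddCommGroup X] [NormedSpace ℂ X]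

theorem ContinuousLinearMap.exists_eigenvector_of_mem_spectrum [FiniteDimensional ℂ X]
    {T : X →L[ℂ] X} {z : ℂ} (hz : z ∈ spectrum ℂ T) : ∃ x, x ≠ 0 ∧ T x = z • x := by
  rw [← AlgEquiv.spectrum_eq (Module.End.toContinuousLinearMap X).symm,
    ← Module.End.hasEigenvalue_iff_mem_spectrum] at hz
  obtain ⟨x, hx⟩ := hz.exists_hasEigenvector
  exact ⟨x, hx.2, hx.apply_eq_smul⟩

theorem ContinuousLinearMap.mem_spectrum_of_apply_eq_smul
    {T : X →L[ℂ] X} {z : ℂ} {x : X} (hx : x ≠ 0) (h : T x = z • x) : z ∈ spectrum ℂ T := by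
  rw [spectrum.mem_iff]
  rintro ⟨u, hu⟩
  refine hx ?_
  have h0 : (u : X →L[ℂ] X) x = 0 := by
    simp [hu, h, Algebra.algebraMap_eq_smul_one]
  calc x = (↑u⁻¹ * u : X →L[ℂ] X) x := by rw [u.inv_mul, one_apply_eq_self]
    _ = (↑u⁻¹ : X →L[ℂ] X) ((u : X →L[ℂ] X) x) := rfl
    _ = 0 := by rw [h0, map_zero]

theorem ContinuousLinearMap.pow_apply_of_apply_eq_smul
    {T : X →L[ℂ] X} {z : ℂ} {x : X} (h : T x = z • x) (n : ℕ) : (T ^ n) x = z ^ n • x := by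
  induction n with
  | zero => simp
  | succ n ih => rw [pow_succ, mul_apply_eq_comp, h, map_smul, ih, smul_smul, pow_succ']

theorem norm_le_one_of_apply_eq_smul {T : X →L[ℂ] X} {K : ℝ} (hK : ∀ n : ℕ, ‖T ^ n‖ ≤ K)
    {z : ℂ} {x : X} (hx : x ≠ 0) (h : T x = z • x) : ‖z‖ ≤ 1 := by
  by_contra! hz
  obtain ⟨n, hn⟩ := pow_unbounded_of_one_lt K hz
  have h1 := (T ^ n).le_of_opNorm_le (hK n) x
  rw [T.pow_apply_of_apply_eq_smul h, norm_smul, norm_pow] at h1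
  exact hn.not_ge (le_of_mul_le_mul_right h1 (norm_pos_iff.mpr hx))

/-- For a power-bounded operator `T`, the range of `1 - T` meets the fixed space trivially. -/
theorem sub_apply_eq_zero_of_apply_sub_apply_eq {T : X →L[ℂ] X} {K : ℝ}
    (hK : ∀ n : ℕ, ‖T ^ n‖ ≤ K) {x : X} (h : T (x - T x) = x - T x) : x - T x = 0 := by
  have hpow : ∀ n : ℕ, (T ^ n) x = x - n • (x - T x) := by
    intro n
    induction n with
    | zero => simp
    | succ n ih =>
      rw [pow_succ', mul_apply_eq_comp, ih, map_sub, map_nsmul, h, succ_nsmul]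
      abel
  by_contra hne
  have hpos : 0 < ‖x - T x‖ := norm_pos_iff.mpr hne
  obtain ⟨n, hn⟩ := exists_nat_gt ((‖x‖ + K * ‖x‖) / ‖x - T x‖)
  rw [div_lt_iff₀ hpos] at hn
  have h1 := (T ^ n).le_of_opNorm_le (hK n) x
  have h2 : n • (x - T x) = x - (T ^ n) x := by rw [hpow]; abel
  have h3 : (n : ℝ) * ‖x - T x‖ = ‖x - (T ^ n) x‖ := by
    rw [← h2, ← Nat.cast_smul_eq_nsmul ℝ, norm_smul, Real.norm_natCast]
  have h4 := norm_sub_le x ((T ^ n) x)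
  linarith

end

theorem ContinuousLinearMap.exists_norm_pow_le_of_forall_eigenvector {Y : Type*}
    [NormedAddCommGroup Y] [NormedSpace ℂ Y] [FiniteDimensional ℂ Y] (S : Y →L[ℂ] Y)
    (hS : ∀ (z : ℂ) (y : Y), y ≠ 0 → S y = z • y → ‖z‖ < 1) :
    ∃ α ∈ Set.Ico (0 : ℝ) 1, ∃ C > (0 : ℝ), ∀ n : ℕ, ‖S ^ n‖ ≤ C * α ^ n := by
  have := FiniteDimensional.complete ℂ Y
  refine exists_norm_pow_le_of_spectralRadius_lt_one ?_
  rcases (spectrum ℂ S).eq_empty_or_nonempty with h | h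
  · simp [spectralRadius, h]
  · refine spectrum.spectralRadius_lt_of_forall_lt_of_nonempty (r := 1) h fun z hz => ?_
    obtain ⟨y, hy, hzy⟩ := S.exists_eigenvector_of_mem_spectrum hz
    exact_mod_cast hS z y hy hzy

/-- In finite dimensions, a power-bounded operator with `σ(T) ∩ 𝕋 ⊆ {1}` satisfies
`‖Tⁿ(I-T)‖ = O(αⁿ)` for some `α ∈ [0,1)`. -/
theorem kt_finite_dimensional {X : Type*} [NormedAddCommGroup X] [NormedSpace ℂ X]
    [FiniteDimensional ℂ X] (T : X →L[ℂ] X) (hpb : ∃ K : ℝ, ∀ n : ℕ, ‖T ^ n‖ ≤ K)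
    (hspec : spectrum ℂ T ∩ {z : ℂ | ‖z‖ = 1} ⊆ {1}) :
    ∃ α ∈ Set.Ico (0:ℝ) 1, ∃ C > (0:ℝ), ∀ n : ℕ, 1 ≤ n →
      ‖T ^ n * (1 - T)‖ ≤ C * α ^ n := by
  obtain ⟨K, hK⟩ := hpb
  obtain ⟨Y, hmem⟩ : ∃ Y : Submodule ℂ X, ∀ y, y ∈ Y ↔ ∃ x, x - T x = y :=
    ⟨LinearMap.range (1 - T : X →L[ℂ] X).toLinearMap, fun _ => Iff.rfl⟩
  have hY : ∀ y ∈ Y, T y ∈ Y := by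
    intro y hy
    obtain ⟨x, rfl⟩ := (hmem y).mp hy
    exact (hmem _).mpr ⟨T x, by rw [map_sub]⟩
  obtain ⟨S, hS⟩ : ∃ S : Y →L[ℂ] Y, ∀ y : Y, (S y : X) = T y :=
    ⟨T.restrict hY, fun _ => rfl⟩
  have hSpow : ∀ (n : ℕ) (y : Y), ((S ^ n) y : X) = (T ^ n) y := by
    intro n
    induction n with
    | zero => simp
    | succ n ih => intro y; rw [pow_succ, pow_succ, mul_apply_eq_comp, ih, mul_apply_eq_comp, hS]
  have hnorm : ∀ (z : ℂ) (y : Y), y ≠ 0 → S y = z • y → ‖z‖ < 1 := by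
    intro z y hy hzy
    have hy' : (y : X) ≠ 0 := by simpa using hy
    have hT : T y = z • (y : X) := by rw [← hS, hzy, Submodule.coe_smul]
    refine (norm_le_one_of_apply_eq_smul hK hy' hT).lt_of_ne fun hz => hy' ?_
    obtain rfl : z = 1 := hspec ⟨T.mem_spectrum_of_apply_eq_smul hy' hT, hz⟩
    obtain ⟨x, hx⟩ := (hmem y).mp y.2
    rw [one_smul, ← hx] at hT
    exact hx ▸ sub_apply_eq_zero_of_apply_sub_apply_eq hK hT
  obtain ⟨α, hα, C, hC, hbound⟩ := S.exists_norm_pow_le_of_forall_eigenvector hnorm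
  have hα0 := hα.1
  refine ⟨α, hα, C * (‖1 - T‖ + 1), by positivity, fun n _ => ?_⟩
  refine ContinuousLinearMap.opNorm_le_bound _ (by positivity) fun x => ?_
  have h1 := (S ^ n).le_of_opNorm_le (hbound n) ⟨x - T x, (hmem _).mpr ⟨x, rfl⟩⟩
  rw [← Submodule.norm_coe, ← Submodule.norm_coe, hSpow] at h1
  calc ‖(T ^ n * (1 - T)) x‖ ≤ C * α ^ n * ‖(1 - T) x‖ := h1
    _ ≤ C * α ^ n * ((‖1 - T‖ + 1) * ‖x‖) := by
      gcongr
      exact (1 - T).le_of_opNorm_le (by linarith) x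
    _ = C * (‖1 - T‖ + 1) * α ^ n * ‖x‖ := by ring
end

section
/- Let φ(λ) = λ + (1 − λ) Log(1 − λ) for λ ∈ ℂ with |λ| ≤ 1, λ ≠ 1, and set φ(1) = 1. Let Γ = {φ(e^{it}) : t ∈ [−π,π]} be the image of the unit circle under φ. Then dist(e^{iθ}, Γ) · (2 log(1/|θ|))/(π|θ|) → 1 as θ → 0 with θ ≠ 0; equivalently, 1/dist(e^{iθ}, Γ) ∼ 2 log(1/|θ|)/(π|θ|) as |θ| → 0. -/
open Filter Topology

/-- `φ(λ) = λ + (1-λ) Log(1-λ)` for `λ ≠ 1`, with `φ(1) = 1`. -/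
noncomputable def phiFun (z : ℂ) : ℂ :=
  if z = 1 then 1 else z + (1 - z) * Complex.log (1 - z)

/-- `1 - Re φ(e^{it})` for `t ∈ [0, π]`. -/
noncomputable def curveDefect (t : ℝ) : ℝ :=
  2 * Real.sin (t / 2) * (Real.sin (t / 2) + Real.negMulLog (2 * Real.sin (t / 2)) / 2 +
    Real.cos (t / 2) * (Real.pi / 2 - t / 2))

/-- `Im φ(e^{it})` for `t ∈ [0, π]`. -/
noncomputable def curveHeight (t : ℝ) : ℝ :=
  Real.cos (t / 2) * (2 * Real.sin (t / 2) + Real.negMulLog (2 * Real.sin (t / 2))) -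
    2 * Real.sin (t / 2) * (Real.sin (t / 2) * (Real.pi / 2 - t / 2))

/-- The curve `Γ = φ(𝕋)`. -/
def phiCurve : Set ℂ :=
  (fun t : ℝ => phiFun (Complex.exp (Complex.I * t))) '' Set.Icc (-Real.pi) Real.pi

lemma continuous_curveDefect : Continuous curveDefect := by
  unfold curveDefect
  have := Real.continuous_negMulLog
  fun_prop

lemma continuous_curveHeight : Continuous curveHeight := by
  unfold curveHeight
  have := Real.continuous_negMulLog
  fun_prop

lemma one_sub_exp_I_mul (t : ℝ) :
    1 - Complex.exp (Complex.I * t) =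
      ((2 * Real.sin (t / 2) : ℝ) : ℂ) *
        Complex.exp (((t / 2 - Real.pi / 2 : ℝ) : ℂ) * Complex.I) := by
  have h : Complex.I * t = (t : ℂ) * Complex.I := mul_comm _ _
  have hc : Real.cos t = 1 - 2 * Real.sin (t / 2) ^ 2 := by
    have := Real.cos_two_mul (t / 2)
    rw [show 2 * (t / 2) = t by ring] at this
    nlinarith [Real.sin_sq_add_cos_sq (t / 2)]
  have hs : Real.sin t = 2 * Real.sin (t / 2) * Real.cos (t / 2) := by
    rw [← Real.sin_two_mul, show 2 * (t / 2) = t by ring]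
  rw [h]
  apply Complex.ext
  · rw [Complex.re_ofReal_mul, Complex.exp_ofReal_mul_I_re, Real.cos_sub_pi_div_two,
      Complex.sub_re, Complex.exp_ofReal_mul_I_re, hc, Complex.one_re]
    ring
  · rw [Complex.im_ofReal_mul, Complex.exp_ofReal_mul_I_im, Real.sin_sub_pi_div_two,
      Complex.sub_im, Complex.exp_ofReal_mul_I_im, hs, Complex.one_im]
    ring

lemma phiFun_exp_of_mem_Icc {t : ℝ} (ht : t ∈ Set.Icc 0 Real.pi) :
    phiFun (Complex.exp (Complex.I * t)) = ⟨1 - curveDefect t, curveHeight t⟩ := by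
  rcases ht.1.eq_or_lt with rfl | h0
  · apply Complex.ext <;> simp [phiFun, curveDefect, curveHeight]
  have hs : 0 < Real.sin (t / 2) :=
    Real.sin_pos_of_pos_of_lt_pi (by linarith) (by linarith [ht.2, Real.pi_pos])
  have hr : 0 < 2 * Real.sin (t / 2) := by positivity
  have e := one_sub_exp_I_mul t
  have hne : Complex.exp (Complex.I * t) ≠ 1 := by
    intro h
    rw [h, sub_self] at e
    exact mul_ne_zero (Complex.ofReal_ne_zero.2 hr.ne') (Complex.exp_ne_zero _) e.symm
  have hlog : Complex.log (1 - Complex.exp (Complex.I * t)) =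
      (Real.log (2 * Real.sin (t / 2)) : ℂ) +
        ((t / 2 - Real.pi / 2 : ℝ) : ℂ) * Complex.I := by
    rw [e, Complex.log_ofReal_mul hr (Complex.exp_ne_zero _), Complex.log_exp]
    · rw [Complex.im_ofReal_mul, Complex.I_im]
      linarith [Real.pi_pos]
    · rw [Complex.im_ofReal_mul, Complex.I_im]
      linarith [ht.2, Real.pi_pos]
  have hz : Complex.exp (Complex.I * t) = 1 - (1 - Complex.exp (Complex.I * t)) := by ring
  rw [phiFun, if_neg hne, hlog]
  nth_rewrite 1 [hz]
  rw [e]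
  apply Complex.ext
  · simp only [Complex.add_re, Complex.sub_re, Complex.mul_re, Complex.exp_ofReal_mul_I_re,
      Complex.exp_ofReal_mul_I_im, Complex.ofReal_re, Complex.ofReal_im, Complex.I_re,
      Complex.I_im, Complex.one_re, Complex.add_im, Complex.mul_im, Real.cos_sub_pi_div_two,
      Real.sin_sub_pi_div_two, curveDefect, Real.negMulLog]
    ring
  · simp only [Complex.add_re, Complex.sub_im, Complex.mul_re, Complex.exp_ofReal_mul_I_re,
      Complex.exp_ofReal_mul_I_im, Complex.ofReal_re, Complex.ofReal_im, Complex.I_re,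
      Complex.I_im, Complex.one_im, Complex.add_im, Complex.mul_im, Real.cos_sub_pi_div_two,
      Real.sin_sub_pi_div_two, curveHeight, Real.negMulLog]
    ring

lemma exp_I_mul_neg (t : ℝ) :
    Complex.exp (Complex.I * (-t : ℝ)) = (starRingEnd ℂ) (Complex.exp (Complex.I * t)) := by
  rw [← Complex.exp_conj]
  simp

lemma phiFun_conj {z : ℂ} (hz : z.re ≤ 1) :
    phiFun ((starRingEnd ℂ) z) = (starRingEnd ℂ) (phiFun z) := by
  by_cases h : z = 1
  · simp [phiFun, h]
  have h' : (starRingEnd ℂ) z ≠ 1 := by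
    intro h2
    exact h (by simpa using congrArg (starRingEnd ℂ) h2)
  have harg : (1 - z).arg ≠ Real.pi := by
    intro h2
    have := (Complex.arg_eq_pi_iff.1 h2).1
    simp at this
    linarith
  have hl := Complex.log_conj _ harg
  rw [map_sub, map_one] at hl
  simp only [phiFun, if_neg h, if_neg h', hl, map_add, map_mul, map_sub, map_one]

lemma phiFun_exp_neg (t : ℝ) :
    phiFun (Complex.exp (Complex.I * (-t : ℝ))) =
      (starRingEnd ℂ) (phiFun (Complex.exp (Complex.I * t))) := by
  rw [exp_I_mul_neg, phiFun_conj]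
  rw [mul_comm, Complex.exp_ofReal_mul_I_re]
  exact Real.cos_le_one t

lemma conj_image_phiCurve : (starRingEnd ℂ) '' phiCurve = phiCurve := by
  have key : ∀ z ∈ phiCurve, (starRingEnd ℂ) z ∈ phiCurve := by
    rintro _ ⟨t, ht, rfl⟩
    exact ⟨-t, ⟨by linarith [ht.2], by linarith [ht.1]⟩, phiFun_exp_neg t⟩
  apply Set.Subset.antisymm
  · rintro _ ⟨z, hz, rfl⟩
    exact key z hz
  · intro z hz
    exact ⟨_, key z hz, by simp⟩

lemma infDist_phiCurve_neg (θ : ℝ) :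
    Metric.infDist (Complex.exp (Complex.I * (-θ : ℝ))) phiCurve =
      Metric.infDist (Complex.exp (Complex.I * θ)) phiCurve := by
  rw [exp_I_mul_neg]
  nth_rewrite 1 [← conj_image_phiCurve]
  exact Metric.infDist_image Complex.isometry_conj

lemma tendsto_two_sin_half_div :
    Tendsto (fun t : ℝ => 2 * Real.sin (t / 2) / t) (𝓝[>] 0) (𝓝 1) := by
  have h : HasDerivAt (fun t : ℝ => 2 * Real.sin (t / 2)) 1 0 := by
    have := (((hasDerivAt_id (0 : ℝ)).div_const 2).sin).const_mul 2
    simpa using this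
  have := h.tendsto_slope_zero_right
  refine this.congr fun t => ?_
  simp [div_eq_inv_mul]

lemma tendsto_curveDefect_div :
    Tendsto (fun t => curveDefect t / t) (𝓝[>] 0) (𝓝 (Real.pi / 2)) := by
  have h : Continuous fun t : ℝ => Real.sin (t / 2) +
      Real.negMulLog (2 * Real.sin (t / 2)) / 2 + Real.cos (t / 2) * (Real.pi / 2 - t / 2) := by
    have := Real.continuous_negMulLog
    fun_prop
  have h0 := (h.tendsto 0).mono_left (nhdsWithin_le_nhds (s := Set.Ioi 0))
  have := tendsto_two_sin_half_div.mul h0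
  simp only [zero_div, Real.sin_zero, mul_zero, Real.negMulLog_zero, Real.cos_zero, one_mul,
    sub_zero, zero_add] at this
  refine this.congr fun t => ?_
  unfold curveDefect
  ring

lemma tendsto_curveHeight_div :
    Tendsto (fun t => curveHeight t / Real.negMulLog t) (𝓝[>] 0) (𝓝 1) := by
  have hlog : Tendsto (fun t => (Real.log t)⁻¹) (𝓝[>] 0) (𝓝 0) :=
    Real.tendsto_log_nhdsGT_zero.inv_tendsto_atBot
  have hr := tendsto_two_sin_half_div
  have hl := hr.log one_ne_zero
  have hc : Tendsto (fun t : ℝ => Real.cos (t / 2)) (𝓝[>] 0) (𝓝 1) := by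
    have : Continuous fun t : ℝ => Real.cos (t / 2) := by fun_prop
    simpa using (this.tendsto 0).mono_left (nhdsWithin_le_nhds (s := Set.Ioi 0))
  have hs : Tendsto (fun t : ℝ => Real.sin (t / 2) * (Real.pi / 2 - t / 2)) (𝓝[>] 0) (𝓝 0) := by
    have : Continuous fun t : ℝ => Real.sin (t / 2) * (Real.pi / 2 - t / 2) := by fun_prop
    simpa using (this.tendsto 0).mono_left (nhdsWithin_le_nhds (s := Set.Ioi 0))
  have key := hr.mul ((hc.mul ((hlog.neg).add ((hl.mul hlog).const_add 1))).add (hs.mul hlog))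
  simp only [Real.log_one, mul_zero, add_zero, neg_zero, zero_add, one_mul] at key
  refine key.congr' ?_
  filter_upwards [Ioo_mem_nhdsGT (show (0 : ℝ) < 1 by norm_num)] with t ht
  have hs : 0 < Real.sin (t / 2) :=
    Real.sin_pos_of_pos_of_lt_pi (by linarith [ht.1]) (by linarith [ht.2, Real.pi_gt_three])
  have ht0 := ht.1.ne'
  have hL : Real.log t ≠ 0 := (Real.log_neg ht.1 ht.2).ne
  rw [Real.log_div (by positivity) ht0]
  unfold curveHeight Real.negMulLog
  field_simp
  ring

lemma tendsto_log_one_div_nhdsGT_zero :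
    Tendsto (fun θ : ℝ => Real.log (1 / θ)) (𝓝[>] 0) atTop := by
  simpa using Real.tendsto_log_nhdsGT_zero

lemma tendsto_negMulLog_div {c : ℝ} (hc : 0 < c) :
    Tendsto (fun θ : ℝ => Real.negMulLog (c * (θ / Real.log (1 / θ))) / θ) (𝓝[>] 0) (𝓝 c) := by
  have hL := tendsto_log_one_div_nhdsGT_zero
  have h1 : Tendsto (fun x : ℝ => Real.log x / x) atTop (𝓝 0) :=
    Real.isLittleO_log_id_atTop.tendsto_div_nhds_zero
  have h2 : Tendsto (fun x : ℝ => c * (1 + Real.log x / x - Real.log c * x⁻¹)) atTop (𝓝 c) := by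
    simpa using ((h1.const_add 1).sub (tendsto_inv_atTop_zero.const_mul (Real.log c))).const_mul c
  refine (h2.comp hL).congr' ?_
  filter_upwards [hL.eventually_gt_atTop 0, self_mem_nhdsWithin] with θ hθ h0
  have h0' : θ ≠ 0 := ne_of_gt h0
  have : Real.log θ = -Real.log (1 / θ) := by simp
  rw [Function.comp, Real.negMulLog, Real.log_mul hc.ne' (div_ne_zero h0' hθ.ne'),
    Real.log_div h0' hθ.ne', this]
  field_simp
  ring

lemma tendsto_const_mul_div_log (c : ℝ) :
    Tendsto (fun θ : ℝ => c * (θ / Real.log (1 / θ))) (𝓝[>] 0) (𝓝 0) := by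
  have h : Tendsto (fun θ : ℝ => θ) (𝓝[>] 0) (𝓝 0) := nhdsWithin_le_nhds
  simpa [div_eq_mul_inv] using
    (h.mul tendsto_log_one_div_nhdsGT_zero.inv_tendsto_atTop).const_mul c

lemma eventually_div_log_pos : ∀ᶠ θ : ℝ in 𝓝[>] 0, 0 < θ / Real.log (1 / θ) := by
  filter_upwards [tendsto_log_one_div_nhdsGT_zero.eventually_gt_atTop 0, self_mem_nhdsWithin]
    with θ h h0
  exact div_pos h0 h

lemma tendsto_const_mul_div_log_nhdsGT {c : ℝ} (hc : 0 < c) :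
    Tendsto (fun θ : ℝ => c * (θ / Real.log (1 / θ))) (𝓝[>] 0) (𝓝[>] 0) := by
  refine tendsto_nhdsWithin_iff.2 ⟨tendsto_const_mul_div_log c, ?_⟩
  filter_upwards [eventually_div_log_pos] with θ h
  exact mul_pos hc h

lemma tendsto_sin_div : Tendsto (fun θ : ℝ => Real.sin θ / θ) (𝓝[>] 0) (𝓝 1) := by
  have := (Real.hasDerivAt_sin 0).tendsto_slope_zero_right
  simp only [zero_add, Real.sin_zero, sub_zero, Real.cos_zero] at this
  refine this.congr fun t => ?_
  simp [div_eq_inv_mul]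

lemma curveDefect_pos {t : ℝ} (ht : t ∈ Set.Ioc 0 Real.pi) : 0 < curveDefect t := by
  have hs : 0 < Real.sin (t / 2) :=
    Real.sin_pos_of_pos_of_lt_pi (by linarith [ht.1]) (by linarith [ht.2, Real.pi_pos])
  have hc : 0 ≤ Real.cos (t / 2) :=
    Real.cos_nonneg_of_mem_Icc ⟨by linarith [ht.1, Real.pi_pos], by linarith [ht.2]⟩
  have hlog : Real.log (2 * Real.sin (t / 2)) < 1 := by
    have h1 : Real.log (2 * Real.sin (t / 2)) ≤ Real.log 2 :=
      Real.log_le_log (by positivity) (by linarith [Real.sin_le_one (t / 2)])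
    linarith [Real.log_two_lt_d9]
  have h2 : 0 ≤ Real.cos (t / 2) * (Real.pi / 2 - t / 2) :=
    mul_nonneg hc (by linarith [ht.2])
  have h3 := mul_pos hs (sub_pos.2 hlog)
  unfold curveDefect Real.negMulLog
  exact mul_pos (by positivity) (by nlinarith)

/-- Every point of the curve is `1 - curveDefect t ± i curveHeight t` with `t ∈ [0, π]`. -/
lemma exists_of_mem_phiCurve {z : ℂ} (hz : z ∈ phiCurve) :
    ∃ t ∈ Set.Icc 0 Real.pi, z.re = 1 - curveDefect t ∧ |z.im| = |curveHeight t| := by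
  obtain ⟨t, ht, rfl⟩ := hz
  rcases le_total 0 t with h | h
  · refine ⟨t, ⟨h, ht.2⟩, ?_⟩
    simp only [phiFun_exp_of_mem_Icc ⟨h, ht.2⟩, and_self]
  · have hm : -t ∈ Set.Icc 0 Real.pi := ⟨by linarith, by linarith [ht.1]⟩
    refine ⟨-t, hm, ?_⟩
    have := phiFun_exp_neg (-t)
    rw [phiFun_exp_of_mem_Icc hm, neg_neg] at this
    simp [this]

lemma phiCurve_nonempty : phiCurve.Nonempty :=
  ⟨_, 0, ⟨by linarith [Real.pi_pos], Real.pi_pos.le⟩, rfl⟩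

lemma eventually_infDist_phiCurve_le {b : ℝ} (hb : 1 < b) :
    ∀ᶠ θ : ℝ in 𝓝[>] 0, Metric.infDist (Complex.exp (Complex.I * θ)) phiCurve ≤
      Real.pi / 2 * b ^ 2 * (θ / Real.log (1 / θ)) + θ ^ 2 / 2 := by
  have hb0 : 0 < b := by linarith
  have hT := tendsto_const_mul_div_log_nhdsGT hb0
  have hB : ∀ᶠ θ : ℝ in 𝓝[>] 0, θ ≤ curveHeight (b * (θ / Real.log (1 / θ))) := by
    have h := ((tendsto_curveHeight_div.comp hT).mul (tendsto_negMulLog_div hb0))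
    rw [one_mul] at h
    filter_upwards [h.eventually_const_lt hb, self_mem_nhdsWithin,
      hT.eventually (Ioo_mem_nhdsGT (show (0 : ℝ) < 1 by norm_num))] with θ h1 h0 h2
    have hn : Real.negMulLog (b * (θ / Real.log (1 / θ))) ≠ 0 := by
      rw [Real.negMulLog]
      exact mul_ne_zero (neg_ne_zero.2 h2.1.ne') (Real.log_neg h2.1 h2.2).ne
    rw [Function.comp_apply, div_mul_div_cancel₀ hn, lt_div_iff₀ h0, one_mul] at h1
    exact h1.le
  obtain ⟨δ, hδ, hA⟩ := mem_nhdsGT_iff_exists_Ioo_subset.1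
    (tendsto_curveDefect_div.eventually_lt_const
      (show Real.pi / 2 < Real.pi / 2 * b by nlinarith [Real.pi_pos]))
  filter_upwards [hB, self_mem_nhdsWithin, hT.eventually (Ioo_mem_nhdsGT hδ),
    hT.eventually (Ioo_mem_nhdsGT Real.pi_pos), Ioo_mem_nhdsGT Real.pi_pos] with θ h1 h0 h2 h3 h4
  have h0 : 0 < θ := h0
  obtain ⟨t, ht, hBt⟩ := intermediate_value_Icc h2.1.le continuous_curveHeight.continuousOn
    (show Real.sin θ ∈ Set.Icc _ _ from
      ⟨by simpa [curveHeight] using Real.sin_nonneg_of_nonneg_of_le_pi h0.le h4.2.le,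
        (Real.sin_le h0.le).trans h1⟩)
  have htp : t ∈ Set.Icc 0 Real.pi := ⟨ht.1, ht.2.trans h3.2.le⟩
  have hA0 : 0 ≤ curveDefect t ∧ curveDefect t ≤ Real.pi / 2 * b * t := by
    rcases ht.1.eq_or_lt with rfl | htpos
    · simp [curveDefect]
    · refine ⟨(curveDefect_pos ⟨htpos, htp.2⟩).le, ?_⟩
      have := hA ⟨htpos, ht.2.trans_lt h2.2⟩
      exact ((div_lt_iff₀ htpos).1 this).le
  have hmem : phiFun (Complex.exp (Complex.I * t)) ∈ phiCurve :=
    ⟨t, ⟨by linarith [htp.1, Real.pi_pos], htp.2⟩, rfl⟩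
  refine (Metric.infDist_le_dist_of_mem hmem).trans ?_
  rw [phiFun_exp_of_mem_Icc htp, Complex.dist_eq, mul_comm Complex.I]
  refine (Complex.norm_le_abs_re_add_abs_im _).trans ?_
  rw [Complex.sub_re, Complex.sub_im, Complex.exp_ofReal_mul_I_re, Complex.exp_ofReal_mul_I_im,
    hBt, sub_self, abs_zero, add_zero]
  have hcos := Real.one_sub_sq_div_two_le_cos (x := θ)
  have hcos1 := Real.cos_le_one θ
  have hfin : Real.pi / 2 * b * t ≤ Real.pi / 2 * b ^ 2 * (θ / Real.log (1 / θ)) := by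
    have := mul_le_mul_of_nonneg_left ht.2 (show 0 ≤ Real.pi / 2 * b by positivity)
    linarith
  rw [abs_le]
  constructor <;> nlinarith

lemma monotoneOn_negMulLog :
    MonotoneOn Real.negMulLog (Set.Icc 0 (Real.exp (-1))) := by
  refine monotoneOn_of_deriv_nonneg (convex_Icc _ _) Real.continuous_negMulLog.continuousOn ?_ ?_
  all_goals
    rw [interior_Icc]
    intro x hx
  · exact (Real.hasDerivAt_negMulLog hx.1.ne').differentiableAt.differentiableWithinAt
  · rw [Real.deriv_negMulLog hx.1.ne']
    linarith [(Real.log_lt_iff_lt_exp hx.1).2 hx.2]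

lemma eventually_le_infDist_phiCurve {c : ℝ} (hc0 : 0 < c) (hc : c < 1) :
    ∀ᶠ θ : ℝ in 𝓝[>] 0, Real.pi / 2 * c ^ 2 * (θ / Real.log (1 / θ)) - θ ^ 2 / 2 ≤
      Metric.infDist (Complex.exp (Complex.I * θ)) phiCurve := by
  have hT := tendsto_const_mul_div_log_nhdsGT hc0
  have hT2 := tendsto_const_mul_div_log (Real.pi / 2 * c ^ 2)
  have hpi := Real.pi_pos
  obtain ⟨δ, hδ, hA⟩ := mem_nhdsGT_iff_exists_Ioo_subset.1
    (tendsto_curveDefect_div.eventually_const_lt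
      (show Real.pi / 2 * c < Real.pi / 2 by nlinarith))
  have hδ : 0 < δ := hδ
  obtain ⟨m, hm, hAm⟩ : ∃ m, 0 < m ∧ ∀ t ∈ Set.Icc δ Real.pi, m ≤ curveDefect t := by
    refine isCompact_Icc.exists_forall_le' continuous_curveDefect.continuousOn fun t ht => ?_
    exact curveDefect_pos ⟨hδ.trans_le ht.1, ht.2⟩
  have hbd : ∀ᶠ t : ℝ in 𝓝[>] 0, |curveHeight t| ≤ (2 - c) * Real.negMulLog t := by
    filter_upwards [tendsto_curveHeight_div.abs.eventually_lt_const
      (show |(1 : ℝ)| < 2 - c by rw [abs_one]; linarith),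
      Ioo_mem_nhdsGT (show (0 : ℝ) < 1 by norm_num)] with t h ht
    have hn : 0 < Real.negMulLog t := by
      rw [Real.negMulLog]
      nlinarith [Real.log_neg ht.1 ht.2, ht.1]
    rw [abs_div, abs_of_pos hn, div_lt_iff₀ hn] at h
    exact h.le
  obtain ⟨η, hη, hB⟩ := mem_nhdsGT_iff_exists_Ioo_subset.1 hbd
  have hη : 0 < η := hη
  have hgap : ∀ᶠ θ : ℝ in 𝓝[>] 0, Real.pi / 2 * c ^ 2 * (θ / Real.log (1 / θ)) ≤
      Real.sin θ - (2 - c) * Real.negMulLog (c * (θ / Real.log (1 / θ))) := by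
    have h := (tendsto_sin_div.sub ((tendsto_negMulLog_div hc0).const_mul (2 - c))).sub
      (tendsto_log_one_div_nhdsGT_zero.inv_tendsto_atTop.const_mul (Real.pi / 2 * c ^ 2))
    filter_upwards [h.eventually_const_lt
      (show 0 < 1 - (2 - c) * c - Real.pi / 2 * c ^ 2 * 0 by nlinarith [sq_pos_of_pos (sub_pos.2 hc)]),
      self_mem_nhdsWithin] with θ h1 h0
    have h0 : 0 < θ := h0
    have := mul_pos h1 h0
    simp only [Pi.inv_apply] at this
    have e : (Real.sin θ / θ - (2 - c) * (Real.negMulLog (c * (θ / Real.log (1 / θ))) / θ) -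
        Real.pi / 2 * c ^ 2 * (Real.log (1 / θ))⁻¹) * θ =
        Real.sin θ - (2 - c) * Real.negMulLog (c * (θ / Real.log (1 / θ))) -
          Real.pi / 2 * c ^ 2 * (θ / Real.log (1 / θ)) := by
      field_simp
    linarith
  filter_upwards [hgap, hT.eventually (Ioo_mem_nhdsGT hη),
    hT.eventually (Ioo_mem_nhdsGT (Real.exp_pos (-1))), hT2.eventually_lt_const hm] with θ h1 h2 h3 h4
  refine (Metric.le_infDist phiCurve_nonempty).2 fun z hz => ?_
  obtain ⟨t, ht, hre, him⟩ := exists_of_mem_phiCurve hz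
  have hcos := Real.one_sub_sq_div_two_le_cos (x := θ)
  rw [Complex.dist_eq, mul_comm Complex.I]
  rcases lt_or_ge t (c * (θ / Real.log (1 / θ))) with htT | htT
  · have hmono : (2 - c) * Real.negMulLog t ≤
        (2 - c) * Real.negMulLog (c * (θ / Real.log (1 / θ))) := by
      have hle := monotoneOn_negMulLog ⟨ht.1, (htT.trans h3.2).le⟩ ⟨h3.1.le, h3.2.le⟩ htT.le
      exact mul_le_mul_of_nonneg_left hle (by linarith)
    have hBt : |curveHeight t| ≤ (2 - c) * Real.negMulLog t := by
      rcases ht.1.eq_or_lt with rfl | htpos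
      · simp [curveHeight]
      · exact hB ⟨htpos, htT.trans h2.2⟩
    refine le_trans ?_ (Complex.abs_im_le_norm _)
    rw [Complex.sub_im, Complex.exp_ofReal_mul_I_im]
    refine le_trans ?_ (le_abs_self _)
    have := le_abs_self z.im
    nlinarith [sq_nonneg θ]
  · refine le_trans ?_ (Complex.abs_re_le_norm _)
    rw [Complex.sub_re, Complex.exp_ofReal_mul_I_re, hre]
    refine le_trans ?_ (le_abs_self _)
    have : Real.pi / 2 * c ^ 2 * (θ / Real.log (1 / θ)) ≤ curveDefect t := by
      rcases lt_or_ge t δ with h | h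
      · have htpos := h2.1.trans_le htT
        have h5 := (lt_div_iff₀ htpos).1 (hA ⟨htpos, h⟩)
        have := mul_le_mul_of_nonneg_left htT (show 0 ≤ Real.pi / 2 * c by positivity)
        linarith
      · exact h4.le.trans (hAm t ⟨h, ht.2⟩)
    linarith

lemma tendsto_infDist_phiCurve_nhdsGT :
    Tendsto (fun θ : ℝ => Metric.infDist (Complex.exp (Complex.I * θ)) phiCurve *
      (2 * Real.log (1 / |θ|)) / (Real.pi * |θ|)) (𝓝[>] 0) (𝓝 1) := by
  have hpi := Real.pi_pos
  have herr : Tendsto (fun θ : ℝ => Real.negMulLog θ / Real.pi) (𝓝[>] 0) (𝓝 0) := by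
    have := (Real.continuous_negMulLog.tendsto 0).mono_left (nhdsWithin_le_nhds (s := Set.Ioi 0))
    simpa using this.div_const Real.pi
  have hscale : ∀ᶠ θ : ℝ in 𝓝[>] 0, ∀ a x : ℝ,
      (x ≤ Real.pi / 2 * a * (θ / Real.log (1 / θ)) + θ ^ 2 / 2 →
        x * (2 * Real.log (1 / |θ|)) / (Real.pi * |θ|) ≤ a + Real.negMulLog θ / Real.pi) ∧
      (Real.pi / 2 * a * (θ / Real.log (1 / θ)) - θ ^ 2 / 2 ≤ x →
        a - Real.negMulLog θ / Real.pi ≤ x * (2 * Real.log (1 / |θ|)) / (Real.pi * |θ|)) := by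
    filter_upwards [tendsto_log_one_div_nhdsGT_zero.eventually_gt_atTop 0, self_mem_nhdsWithin]
      with θ hL h0 a x
    have h0 : 0 < θ := h0
    have hn : Real.negMulLog θ = θ * Real.log (1 / θ) := by simp [Real.negMulLog]
    rw [abs_of_pos h0, hn]
    set L := Real.log (1 / θ)
    have hk : 0 ≤ 2 * L / (Real.pi * θ) := by positivity
    constructor <;> intro h
    · calc x * (2 * L) / (Real.pi * θ) = x * (2 * L / (Real.pi * θ)) := by ring
        _ ≤ _ := mul_le_mul_of_nonneg_right h hk
        _ = _ := by field_simp
    · calc _ = (Real.pi / 2 * a * (θ / L) - θ ^ 2 / 2) * (2 * L / (Real.pi * θ)) := by field_simp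
        _ ≤ x * (2 * L / (Real.pi * θ)) := mul_le_mul_of_nonneg_right h hk
        _ = _ := by ring
  refine tendsto_order.2 ⟨fun a ha => ?_, fun a ha => ?_⟩
  · obtain ⟨c, hc0, hc1, hca⟩ : ∃ c : ℝ, 0 < c ∧ c < 1 ∧ a < c ^ 2 := by
      rcases lt_or_ge a 0 with h | h
      · exact ⟨1 / 2, by norm_num, by norm_num, by linarith⟩
      · exact ⟨(1 + a) / 2, by linarith, by linarith, by nlinarith [sq_pos_of_pos (sub_pos.2 ha)]⟩
    filter_upwards [hscale, eventually_le_infDist_phiCurve hc0 hc1,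
      herr.eventually_lt_const (sub_pos.2 hca)] with θ h1 h2 h3
    linarith [(h1 (c ^ 2) _).2 h2]
  · obtain ⟨b, hb1, hba⟩ : ∃ b : ℝ, 1 < b ∧ b ^ 2 < a :=
      ⟨√((1 + a) / 2), Real.lt_sqrt_of_sq_lt (by linarith),
        by rw [Real.sq_sqrt (by linarith)]; linarith⟩
    filter_upwards [hscale, eventually_infDist_phiCurve_le hb1,
      herr.eventually_lt_const (sub_pos.2 hba)] with θ h1 h2 h3
    linarith [(h1 (b ^ 2) _).1 h2]

/-- With `Γ = φ(𝕋)` the image of the unit circle under `φ`, one has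
`dist(e^{iθ}, Γ) · (2 log(1/|θ|))/(π|θ|) → 1` as `θ → 0`, `θ ≠ 0`. -/
theorem dist_to_curve_asymptotics :
    Filter.Tendsto (fun θ : ℝ =>
        Metric.infDist (Complex.exp (Complex.I * θ))
            ((fun t : ℝ => phiFun (Complex.exp (Complex.I * t))) ''
              Set.Icc (-Real.pi) Real.pi) *
          (2 * Real.log (1 / |θ|)) / (Real.pi * |θ|))
      (nhdsWithin 0 {0}ᶜ) (nhds 1) := by
  have h := tendsto_infDist_phiCurve_nhdsGT
  rw [← nhdsLT_sup_nhdsGT, tendsto_sup]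
  refine ⟨?_, h⟩
  have hneg : Tendsto (fun θ : ℝ => -θ) (𝓝[<] 0) (𝓝[>] 0) := by
    simpa using tendsto_neg_nhdsLT (a := (0 : ℝ))
  refine (h.comp hneg).congr fun θ => ?_
  rw [Function.comp, infDist_phiCurve_neg, abs_neg, phiCurve]
end

section
/- For every λ ∈ ℂ with |λ| ≤ 1 and λ ≠ 1, one has |λ + (1 − λ) Log(1 − λ)| < 1, where Log denotes the principal branch of the complex logarithm. (That is, the image under φ(λ) = λ + (1 − λ)Log(1 − λ) of the closed unit disk with the point 1 removed lies in the open unit disk.) -/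
open Filter Topology in
theorem hasSum_one_div_add_one_mul_add_two (k : ℕ) :
    HasSum (fun n : ℕ => 1 / (((n : ℝ) + k + 1) * (n + k + 2))) (1 / ((k : ℝ) + 1)) := by
  rw [hasSum_iff_tendsto_nat_of_nonneg (fun n => by positivity)]
  have key : ∀ n : ℕ, ∑ i ∈ Finset.range n, 1 / (((i : ℝ) + k + 1) * (i + k + 2)) =
      1 / ((k : ℝ) + 1) - 1 / (((n + k : ℕ) : ℝ) + 1) := by
    intro n
    induction n with
    | zero => simp
    | succ n ih =>
      rw [Finset.sum_range_succ, ih]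
      push_cast
      have h₁ : (n : ℝ) + k + 1 ≠ 0 := by positivity
      have h₂ : (n : ℝ) + k + 2 ≠ 0 := by positivity
      have h₃ : (n : ℝ) + 1 + k + 1 ≠ 0 := by positivity
      field_simp
      ring
  simp_rw [key]
  simpa using (((tendsto_add_atTop_iff_nat k).2
    (tendsto_one_div_add_atTop_nhds_zero_nat (𝕜 := ℝ))).const_sub (1 / ((k : ℝ) + 1)))

theorem norm_pow_div_add_one_mul_add_two_le {z : ℂ} (hz : ‖z‖ ≤ 1) (m n : ℕ) :
    ‖z ^ m / (((n : ℂ) + 1) * (n + 2))‖ ≤ 1 / (((n : ℝ) + 1) * (n + 2)) := by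
  have h : ‖((n : ℂ) + 1) * (n + 2)‖ = ((n : ℝ) + 1) * (n + 2) := by
    have : ((n : ℂ) + 1) * (n + 2) = ((((n : ℝ) + 1) * (n + 2) : ℝ) : ℂ) := by push_cast; ring
    rw [this, Complex.norm_of_nonneg (by positivity)]
  rw [norm_div, h, norm_pow]
  gcongr
  exact pow_le_one₀ (norm_nonneg z) hz

theorem Complex.re_lt_one_of_norm_le_one {z : ℂ} (hz : ‖z‖ ≤ 1) (hz1 : z ≠ 1) : z.re < 1 := by
  refine lt_of_le_of_ne ((Complex.re_le_norm z).trans hz) fun h => hz1 ?_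
  have h₁ : ‖z‖ ^ 2 ≤ 1 := pow_le_one₀ (norm_nonneg z) hz
  rw [Complex.sq_norm, Complex.normSq_apply, h] at h₁
  have h₂ : z.im = 0 := by nlinarith
  exact Complex.ext (by simpa using h) (by simpa using h₂)

theorem tsum_eq_add_one_sub_mul_log_of_norm_lt_one {z : ℂ} (hz : ‖z‖ < 1) :
    ∑' n : ℕ, z ^ (n + 2) / (((n : ℂ) + 1) * (n + 2)) =
      z + (1 - z) * Complex.log (1 - z) := by
  have h₀ := Complex.hasSum_taylorSeries_neg_log hz
  have h₁ := ((hasSum_nat_add_iff' 1).2 h₀).mul_left z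
  have h₂ := (hasSum_nat_add_iff' 2).2 h₀
  refine HasSum.tsum_eq ?_
  convert! h₁.sub h₂ using 1
  · funext n
    have h₃ : (n : ℂ) + 1 ≠ 0 := by exact_mod_cast n.succ_ne_zero
    have h₄ : (n : ℂ) + 2 ≠ 0 := by exact_mod_cast (n + 1).succ_ne_zero
    push_cast
    field_simp
    ring
  · simp [Finset.sum_range_succ]
    ring

open Filter Topology in
theorem tsum_eq_add_one_sub_mul_log {z : ℂ} (hz : ‖z‖ ≤ 1) (hz1 : z ≠ 1) :
    ∑' n : ℕ, z ^ (n + 2) / (((n : ℂ) + 1) * (n + 2)) =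
      z + (1 - z) * Complex.log (1 - z) := by
  have hcont : ContinuousOn (fun w : ℂ => ∑' n : ℕ, w ^ (n + 2) / (((n : ℂ) + 1) * (n + 2)))
      (Metric.closedBall 0 1) := by
    refine continuousOn_tsum (u := fun n : ℕ => 1 / (((n : ℝ) + 1) * (n + 2)))
      (fun n => by fun_prop) (by simpa using (hasSum_one_div_add_one_mul_add_two 0).summable) ?_
    intro n w hw
    exact norm_pow_div_add_one_mul_add_two_le (by simpa using hw) _ _
  have hslit : 1 - z ∈ Complex.slitPlane :=
    Or.inl (by simpa using Complex.re_lt_one_of_norm_le_one hz hz1)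
  have hlog : ContinuousAt (fun w : ℂ => w + (1 - w) * Complex.log (1 - w)) z := by
    have : ContinuousAt (fun w : ℂ => Complex.log (1 - w)) z :=
      ContinuousAt.clog (by fun_prop) hslit
    fun_prop
  have hmem : z ∈ closure (Metric.ball (0 : ℂ) 1) := by
    rw [closure_ball _ one_ne_zero]
    simpa using hz
  have : (𝓝[Metric.ball (0 : ℂ) 1] z).NeBot := mem_closure_iff_nhdsWithin_neBot.1 hmem
  refine tendsto_nhds_unique (f := fun w : ℂ => ∑' n : ℕ, w ^ (n + 2) / (((n : ℂ) + 1) * (n + 2)))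
    (l := 𝓝[Metric.ball (0 : ℂ) 1] z)
    ((hcont z (by simpa using hz)).mono Metric.ball_subset_closedBall)
    ((hlog.tendsto.mono_left nhdsWithin_le_nhds).congr' ?_)
  filter_upwards [self_mem_nhdsWithin] with w hw
  exact (tsum_eq_add_one_sub_mul_log_of_norm_lt_one (by simpa using hw)).symm

/-- For `|z| ≤ 1`, `z ≠ 1`, one has `|z + (1-z) Log(1-z)| < 1`: the function
`φ(λ) = λ + (1-λ)Log(1-λ)` maps the closed unit disk minus `{1}` into the open unit disk. -/
theorem abs_phi_lt_one (z : ℂ) (hz : ‖z‖ ≤ 1) (hz1 : z ≠ 1) :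
    ‖z + (1 - z) * Complex.log (1 - z)‖ < 1 := by
  have hsum : Summable fun n : ℕ => z ^ (n + 2) / (((n : ℂ) + 1) * (n + 2)) :=
    Summable.of_norm_bounded (by simpa using (hasSum_one_div_add_one_mul_add_two 0).summable)
      fun n => norm_pow_div_add_one_mul_add_two_le hz _ n
  rw [← tsum_eq_add_one_sub_mul_log hz hz1, ← hsum.sum_add_tsum_nat_add 2]
  have htail : ‖∑' n : ℕ, z ^ (n + 2 + 2) / ((((n + 2 : ℕ) : ℂ) + 1) * ((n + 2 : ℕ) + 2))‖
      ≤ 1 / (((2 : ℕ) : ℝ) + 1) := by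
    refine tsum_of_norm_bounded (hasSum_one_div_add_one_mul_add_two 2) fun n => ?_
    simpa using norm_pow_div_add_one_mul_add_two_le hz (n + 2 + 2) (n + 2)
  have hre := Complex.re_lt_one_of_norm_le_one hz hz1
  have hthree : ‖3 + z‖ < 4 := by
    refine lt_of_pow_lt_pow_left₀ 2 (by norm_num) ?_
    have h₁ : ‖z‖ ^ 2 ≤ 1 := pow_le_one₀ (norm_nonneg z) hz
    rw [Complex.sq_norm, Complex.normSq_apply] at h₁ ⊢
    simp only [Complex.add_re, Complex.add_im, Complex.re_ofNat, Complex.im_ofNat]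
    nlinarith
  have hhead : ‖∑ i ∈ Finset.range 2, z ^ (i + 2) / (((i : ℂ) + 1) * (i + 2))‖ < 2 / 3 := by
    have h : ∑ i ∈ Finset.range 2, z ^ (i + 2) / (((i : ℂ) + 1) * (i + 2)) =
        z ^ 2 * (3 + z) / 6 := by
      simp [Finset.sum_range_succ]
      ring
    rw [h, norm_div, norm_mul, norm_pow, Complex.norm_ofNat]
    have h₁ : ‖z‖ ^ 2 * ‖3 + z‖ ≤ ‖3 + z‖ :=
      mul_le_of_le_one_left (norm_nonneg _) (pow_le_one₀ (norm_nonneg z) hz)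
    linarith
  refine (norm_add_le _ _).trans_lt ?_
  norm_num at htail hhead ⊢
  linarith
end

section
/- Let X be a complex Hilbert space and let T be a power-bounded bounded linear operator on X such that σ(T) ∩ 𝕋 = {1}. Let m : (0,π] → (0,∞) be a continuous non-increasing function such that ‖R(e^{iθ},T)‖ ≤ m(|θ|) for 0 < |θ| ≤ π, and suppose m has reciprocally positive increase with constants c ∈ (0,1], α > 0 and ε₀ ∈ (0,π]. Set ℓ = ⌈1/α⌉. Then there exists C > 0 such that for all n ≥ 1 and all ε ∈ (0,1], ‖Tⁿ(I − T)‖ ≤ C ε ((m(ε)/(cn))^ℓ + Σ_{j=0}^{ℓ} 1/(εⁿ)ʲ), where (εn)ʲ denotes (ε·n) raised to the power j, i.e. ‖Tⁿ(I − T)‖ ≤ C ε ((m(ε)/(cn))^ℓ + Σ_{j=0}^{ℓ} (εn)^{−j}). -/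
open Filter Topology

theorem integral_exp_int_mul_I (k : ℤ) :
    ∫ θ in (0:ℝ)..(2 * Real.pi), Complex.exp (Complex.I * (k * θ)) =
      if k = 0 then (2 * Real.pi : ℂ) else 0 := by
  split_ifs with h
  · simp [h]
  · have hk : (Complex.I * k : ℂ) ≠ 0 := by simp [h]
    have := integral_exp_mul_complex (a := 0) (b := 2 * Real.pi) hk
    simp only [mul_assoc] at this
    rw [this]
    have h2 : Complex.exp (Complex.I * (k * ((2 * Real.pi : ℝ) : ℂ))) = 1 := by
      rw [Complex.exp_eq_one_iff]
      exact ⟨k, by push_cast; ring⟩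
    rw [h2]
    simp

section Parseval

variable {X : Type*} [NormedAddCommGroup X] [InnerProductSpace ℂ X]

theorem norm_exp_I_nat_smul (k : ℕ) (θ : ℝ) (x : X) :
    ‖Complex.exp (Complex.I * (k * θ)) • x‖ = ‖x‖ := by
  have : Complex.I * (k * θ) = ((k * θ : ℝ) : ℂ) * Complex.I := by push_cast; ring
  rw [norm_smul, this, Complex.norm_exp_ofReal_mul_I, one_mul]

theorem continuous_tsum_exp_smul [CompleteSpace X] {a : ℕ → X} (ha : Summable fun k => ‖a k‖) :
    Continuous fun θ : ℝ => ∑' k : ℕ, Complex.exp (Complex.I * (k * θ)) • a k :=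
  continuous_tsum (fun k => by fun_prop) ha fun k θ => (norm_exp_I_nat_smul k θ _).le

theorem integral_exp_neg_smul_tsum [CompleteSpace X] {a : ℕ → X}
    (ha : Summable fun k => ‖a k‖) (j : ℕ) :
    ∫ θ in (0:ℝ)..(2 * Real.pi), Complex.exp (-(Complex.I * (j * θ))) •
      ∑' k : ℕ, Complex.exp (Complex.I * (k * θ)) • a k = (2 * Real.pi : ℂ) • a j := by
  let f : ℕ → C(ℝ, X) := fun k =>
    ⟨fun θ : ℝ => Complex.exp (Complex.I * (((k : ℤ) - (j : ℤ) : ℤ) * θ)) • a k, by fun_prop⟩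
  have hfe : ∀ k (θ : ℝ), f k θ =
      Complex.exp (-(Complex.I * (j * θ))) • Complex.exp (Complex.I * (k * θ)) • a k := by
    intro k θ
    simp only [f, ContinuousMap.coe_mk, smul_smul, ← Complex.exp_add]
    congr 2
    push_cast
    ring
  have hnorm : ∀ k (θ : ℝ), ‖f k θ‖ = ‖a k‖ := by
    intro k θ
    have : Complex.I * (((k : ℤ) - (j : ℤ) : ℤ) * θ) =
        ((((k : ℤ) - (j : ℤ) : ℤ) * θ : ℝ) : ℂ) * Complex.I := by push_cast; ring
    simp only [f, ContinuousMap.coe_mk]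
    rw [norm_smul, this, Complex.norm_exp_ofReal_mul_I, one_mul]
  have hs : Summable fun k => ‖(f k).restrict
      (⟨Set.uIcc 0 (2 * Real.pi), isCompact_uIcc⟩ : TopologicalSpace.Compacts ℝ)‖ :=
    ha.of_nonneg_of_le (fun _ => norm_nonneg _) fun k =>
      (ContinuousMap.norm_le _ (norm_nonneg _)).2 fun θ => (hnorm k θ).le
  have h := intervalIntegral.hasSum_intervalIntegral_of_summable_norm hs
  have hval : ∀ k, ∫ θ in (0:ℝ)..(2 * Real.pi), f k θ =
      if k = j then (2 * Real.pi : ℂ) • a j else 0 := by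
    intro k
    simp only [f, ContinuousMap.coe_mk]
    rw [intervalIntegral.integral_smul_const, integral_exp_int_mul_I]
    by_cases hkj : k = j
    · simp [hkj]
    · have : ((k : ℤ) - (j : ℤ)) ≠ 0 := by omega
      simp [hkj, this]
  simp only [hval] at h
  have h' := h.unique (hasSum_ite_eq j _)
  rw [← h']
  refine intervalIntegral.integral_congr fun θ _ => ?_
  simp only [hfe]
  exact (((ha.congr fun k => (norm_exp_I_nat_smul k θ _).symm).of_norm).tsum_const_smul _).symm

/-- Parseval's identity for absolutely convergent Fourier series in a Hilbert space. -/
theorem hasSum_norm_sq_integral [CompleteSpace X] {a : ℕ → X} (ha : Summable fun k => ‖a k‖) :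
    HasSum (fun k => 2 * Real.pi * ‖a k‖ ^ 2)
      (∫ θ in (0:ℝ)..(2 * Real.pi),
        ‖∑' k : ℕ, Complex.exp (Complex.I * (k * θ)) • a k‖ ^ 2) := by
  set F : ℝ → X := fun θ => ∑' k : ℕ, Complex.exp (Complex.I * (k * θ)) • a k with hF
  have hFc : Continuous F := continuous_tsum_exp_smul ha
  have hsum : ∀ θ : ℝ, Summable fun k : ℕ => Complex.exp (Complex.I * (k * θ)) • a k :=
    fun θ => (ha.congr fun k => (norm_exp_I_nat_smul k θ _).symm).of_norm
  have hFle : ∀ θ, ‖F θ‖ ≤ ∑' k, ‖a k‖ := fun θ =>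
    tsum_of_norm_bounded ha.hasSum fun k => (norm_exp_I_nat_smul k θ _).le
  let f : ℕ → C(ℝ, ℂ) := fun k =>
    ⟨fun θ : ℝ => inner ℂ (Complex.exp (Complex.I * (k * θ)) • a k) (F θ), by fun_prop⟩
  have hs : Summable fun k => ‖(f k).restrict
      (⟨Set.uIcc 0 (2 * Real.pi), isCompact_uIcc⟩ : TopologicalSpace.Compacts ℝ)‖ :=
    (ha.mul_right (∑' k, ‖a k‖)).of_nonneg_of_le (fun _ => norm_nonneg _) fun k =>
      (ContinuousMap.norm_le _ (mul_nonneg (norm_nonneg _)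
        (tsum_nonneg fun _ => norm_nonneg _))).2 fun θ =>
        (norm_inner_le_norm _ _).trans <|
          mul_le_mul (norm_exp_I_nat_smul k θ _).le (hFle θ) (norm_nonneg _) (norm_nonneg _)
  have h := intervalIntegral.hasSum_intervalIntegral_of_summable_norm hs
  have hval : ∀ k, ∫ θ in (0:ℝ)..(2 * Real.pi), f k θ =
      ((2 * Real.pi * ‖a k‖ ^ 2 : ℝ) : ℂ) := by
    intro k
    have h1 : ∀ θ : ℝ, f k θ =
        innerSL ℂ (a k) (Complex.exp (-(Complex.I * (k * θ))) • F θ) := by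
      intro θ
      simp only [f, ContinuousMap.coe_mk, innerSL_apply_apply, inner_smul_left, inner_smul_right,
        ← Complex.exp_conj]
      simp
    simp only [h1]
    rw [ContinuousLinearMap.intervalIntegral_comp_comm _
        (Continuous.intervalIntegrable (by fun_prop) _ _), integral_exp_neg_smul_tsum ha,
      innerSL_apply_apply, inner_smul_right, inner_self_eq_norm_sq_to_K]
    push_cast
    rfl
  have hint : ∫ θ in (0:ℝ)..(2 * Real.pi), ∑' k, f k θ =
      ((∫ θ in (0:ℝ)..(2 * Real.pi), ‖F θ‖ ^ 2 : ℝ) : ℂ) := by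
    rw [← intervalIntegral.integral_ofReal]
    refine intervalIntegral.integral_congr fun θ _ => ?_
    have h2 := ((hsum θ).hasSum.mapL ((innerSLFlip ℂ) (F θ)))
    simp only [innerSLFlip_apply_apply] at h2
    have h3 := h2.tsum_eq
    simp only [f, ContinuousMap.coe_mk]
    rw [h3, inner_self_eq_norm_sq_to_K]
    push_cast
    rfl
  rw [hint] at h
  simp only [hval] at h
  exact Complex.hasSum_ofReal.1 h

end Parseval
section PowerSeries

variable {X : Type*} [NormedAddCommGroup X] [NormedSpace ℂ X]

/-- The power series `∑ₖ (k+j choose j) wᵏ Tᵏ`, whose sum is `(1 - wT)⁻⁽ʲ⁺¹⁾`. -/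
noncomputable def resolventSeries (T : X →L[ℂ] X) (j : ℕ) (w : ℂ) : X →L[ℂ] X :=
  ∑' k : ℕ, (((k + j).choose j : ℂ) * w ^ k) • T ^ k

variable {T : X →L[ℂ] X} {K : ℝ} {w : ℂ}

theorem norm_choose_mul_pow_smul_le (hK : ∀ n : ℕ, ‖T ^ n‖ ≤ K) (j : ℕ) (k : ℕ) :
    ‖(((k + j).choose j : ℂ) * w ^ k) • T ^ k‖ ≤ ((k + j).choose j : ℝ) * ‖w‖ ^ k * K := by
  rw [norm_smul, norm_mul, norm_pow, Complex.norm_natCast]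
  exact mul_le_mul_of_nonneg_left (hK k) (by positivity)

theorem summable_choose_mul_norm_pow (hw : ‖w‖ < 1) (j : ℕ) :
    Summable fun k : ℕ => ((k + j).choose j : ℝ) * ‖w‖ ^ k * K :=
  (summable_choose_mul_geometric_of_norm_lt_one j (by simpa using hw)).mul_right K

theorem norm_resolventSeries_zero_le (hK : ∀ n : ℕ, ‖T ^ n‖ ≤ K) (hw : ‖w‖ < 1) :
    ‖resolventSeries T 0 w‖ ≤ K / (1 - ‖w‖) := by
  have h := (hasSum_geometric_of_lt_one (norm_nonneg w) hw).mul_right K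
  rw [inv_mul_eq_div] at h
  exact tsum_of_norm_bounded h fun k => by
    simpa using norm_choose_mul_pow_smul_le (w := w) hK 0 k

variable [CompleteSpace X]

theorem summable_resolventSeries (hK : ∀ n : ℕ, ‖T ^ n‖ ≤ K) (hw : ‖w‖ < 1) (j : ℕ) :
    Summable fun k : ℕ => (((k + j).choose j : ℂ) * w ^ k) • T ^ k :=
  (summable_choose_mul_norm_pow hw j).of_norm_bounded fun k => norm_choose_mul_pow_smul_le hK j k

theorem one_sub_smul_mul_resolventSeries_zero (hK : ∀ n : ℕ, ‖T ^ n‖ ≤ K) (hw : ‖w‖ < 1) :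
    (1 - w • T) * resolventSeries T 0 w = 1 := by
  have hs := summable_resolventSeries hK hw 0
  have h : resolventSeries T 0 w = 1 + (w • T) * resolventSeries T 0 w := by
    conv_lhs => rw [resolventSeries, hs.tsum_eq_zero_add]
    rw [resolventSeries, ← hs.tsum_mul_left]
    congr 1
    · simp
    · refine tsum_congr fun k => ?_
      simp [smul_smul, pow_succ', mul_comm]
  rw [sub_mul, one_mul, sub_eq_iff_eq_add]
  exact h

theorem one_sub_smul_mul_resolventSeries_succ (hK : ∀ n : ℕ, ‖T ^ n‖ ≤ K) (hw : ‖w‖ < 1) (j : ℕ) :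
    (1 - w • T) * resolventSeries T (j + 1) w = resolventSeries T j w := by
  have hs := summable_resolventSeries hK hw j
  have hs' := summable_resolventSeries hK hw (j + 1)
  have h : resolventSeries T (j + 1) w =
      resolventSeries T j w + (w • T) * resolventSeries T (j + 1) w := by
    conv_lhs => rw [resolventSeries, hs'.tsum_eq_zero_add]
    rw [resolventSeries, hs.tsum_eq_zero_add, resolventSeries, ← hs'.tsum_mul_left, add_assoc,
      ← ((summable_nat_add_iff 1).2 hs).tsum_add (hs'.mul_left _)]
    congr 1
    · simp
    · refine tsum_congr fun k => ?_
      have hc : ((k + 1 + (j + 1)).choose (j + 1) : ℂ) =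
          ((k + 1 + j).choose j : ℂ) + ((k + (j + 1)).choose (j + 1) : ℂ) := by
        rw [show k + 1 + (j + 1) = (k + 1 + j) + 1 by ring, Nat.choose_succ_succ,
          show k + (j + 1) = k + 1 + j by ring]
        push_cast
        rfl
      rw [hc, smul_mul_smul_comm, ← pow_succ', ← add_smul]
      congr 1
      ring
  rw [sub_mul, one_mul, sub_eq_iff_eq_add]
  exact h

theorem resolventSeries_zero_mul_one_sub_smul (hK : ∀ n : ℕ, ‖T ^ n‖ ≤ K) (hw : ‖w‖ < 1) :
    resolventSeries T 0 w * (1 - w • T) = 1 := by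
  have hc : Commute (1 - w • T) (resolventSeries T 0 w) :=
    Commute.tsum_right _ fun k => (((Commute.one_left _).sub_left
      ((Commute.self_pow T k).smul_left w)).smul_right _)
  rw [← hc.eq, one_sub_smul_mul_resolventSeries_zero hK hw]

theorem resolventSeries_eq_pow (hK : ∀ n : ℕ, ‖T ^ n‖ ≤ K) (hw : ‖w‖ < 1) (j : ℕ) :
    resolventSeries T j w = resolventSeries T 0 w ^ (j + 1) := by
  induction j with
  | zero => simp
  | succ j ih =>
    rw [pow_succ', ← ih, ← one_sub_smul_mul_resolventSeries_succ hK hw j, ← mul_assoc,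
      resolventSeries_zero_mul_one_sub_smul hK hw, one_mul]

end PowerSeries

section Plancherel

variable {X : Type*} [NormedAddCommGroup X] [InnerProductSpace ℂ X] [CompleteSpace X]
  {T : X →L[ℂ] X} {K : ℝ}

theorem sum_sq_choose_mul_pow_le (hK : ∀ n : ℕ, ‖T ^ n‖ ≤ K) {s : ℝ} (hs0 : 0 ≤ s) (hs1 : s < 1)
    (B : X →L[ℂ] X) (l : ℕ) {M : ℝ}
    (hM : ∀ w : ℂ, ‖w‖ = s → ‖B * resolventSeries T 0 w ^ l‖ ≤ M) (x : X) (N : Finset ℕ) :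
    ∑ k ∈ N, (((k + l).choose l : ℝ) * s ^ k * ‖B ((T ^ k) x)‖) ^ 2 ≤
      M ^ 2 * (K ^ 2 * ‖x‖ ^ 2 / (1 - s)) := by
  have hM0 : 0 ≤ M := (norm_nonneg _).trans (hM s (by simp [abs_of_nonneg hs0]))
  let a : ℕ → (X →L[ℂ] X) → ℕ → X := fun j A k =>
    (((k + j).choose j : ℂ) * (s : ℂ) ^ k) • A ((T ^ k) x)
  have hsn : ‖(s : ℂ)‖ = s := by simp [abs_of_nonneg hs0]
  have han : ∀ j A k, ‖a j A k‖ = ((k + j).choose j : ℝ) * s ^ k * ‖A ((T ^ k) x)‖ := by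
    intro j A k
    simp only [a]
    rw [norm_smul, norm_mul, norm_pow, Complex.norm_natCast, hsn]
  have hTx : ∀ k, ‖(T ^ k) x‖ ≤ K * ‖x‖ := fun k => (T ^ k).le_of_opNorm_le (hK k) x
  have hsum : ∀ j A, Summable fun k => ‖a j A k‖ := by
    intro j A
    refine (summable_choose_mul_norm_pow (K := ‖A‖ * (K * ‖x‖)) (w := (s : ℂ))
      (by rwa [hsn]) j).of_nonneg_of_le (fun _ => norm_nonneg _) fun k => ?_
    rw [han, hsn]
    exact mul_le_mul_of_nonneg_left (A.le_opNorm_of_le (hTx k)) (by positivity)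
  have hwn : ∀ θ : ℝ, ‖(s : ℂ) * Complex.exp (Complex.I * θ)‖ = s := by
    intro θ
    rw [norm_mul, hsn, mul_comm Complex.I, Complex.norm_exp_ofReal_mul_I, mul_one]
  have hval : ∀ j A (θ : ℝ), ∑' k : ℕ, Complex.exp (Complex.I * (k * θ)) • a j A k =
      A (resolventSeries T j (s * Complex.exp (Complex.I * θ)) x) := by
    intro j A θ
    have h1 := (summable_resolventSeries (w := s * Complex.exp (Complex.I * θ)) hK
      (by rwa [hwn]) j).hasSum
    have h2 := (h1.mapL (ContinuousLinearMap.apply ℂ X x)).mapL A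
    rw [← resolventSeries] at h2
    simp only [ContinuousLinearMap.apply_apply, map_smul] at h2
    rw [← h2.tsum_eq]
    refine tsum_congr fun k => ?_
    simp only [a, smul_smul]
    congr 1
    rw [mul_pow, ← Complex.exp_nat_mul]
    rw [show (k : ℂ) * (Complex.I * θ) = Complex.I * (k * θ) by ring]
    ring
  have hF := hasSum_norm_sq_integral (hsum l B)
  have hG := hasSum_norm_sq_integral (hsum 0 1)
  have hle : (∫ θ in (0:ℝ)..(2 * Real.pi),
        ‖∑' k : ℕ, Complex.exp (Complex.I * (k * θ)) • a l B k‖ ^ 2) ≤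
      ∫ θ in (0:ℝ)..(2 * Real.pi),
        M ^ 2 * ‖∑' k : ℕ, Complex.exp (Complex.I * (k * θ)) • a 0 1 k‖ ^ 2 := by
    refine intervalIntegral.integral_mono_on (by positivity)
      (((continuous_tsum_exp_smul (hsum l B)).norm.pow 2).intervalIntegrable _ _)
      ((((continuous_tsum_exp_smul (hsum 0 1)).norm.pow 2).const_mul _).intervalIntegrable _ _)
      fun θ _ => ?_
    rw [hval, hval, ← mul_pow, resolventSeries_eq_pow hK (by rwa [hwn]) l, pow_succ]
    exact pow_le_pow_left₀ (norm_nonneg _)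
      ((B * resolventSeries T 0 (s * Complex.exp (Complex.I * θ)) ^ l).le_of_opNorm_le
        (hM _ (hwn θ)) _) 2
  rw [intervalIntegral.integral_const_mul] at hle
  have hpi := Real.pi_pos
  have hGle : (∫ θ in (0:ℝ)..(2 * Real.pi),
      ‖∑' k : ℕ, Complex.exp (Complex.I * (k * θ)) • a 0 1 k‖ ^ 2) ≤
      2 * Real.pi * (K ^ 2 * ‖x‖ ^ 2 / (1 - s)) := by
    have hgeo := (hasSum_geometric_of_lt_one hs0 hs1).mul_left (2 * Real.pi * (K ^ 2 * ‖x‖ ^ 2))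
    rw [← div_eq_mul_inv, mul_div_assoc] at hgeo
    refine hasSum_le (fun k => ?_) hG hgeo
    rw [han, mul_assoc (2 * Real.pi)]
    refine mul_le_mul_of_nonneg_left ?_ (by positivity)
    simp only [add_zero, Nat.choose_zero_right, Nat.cast_one, one_mul,
      one_apply_eq_self, mul_pow]
    rw [mul_comm]
    have h3 : ‖(T ^ k) x‖ ^ 2 ≤ K ^ 2 * ‖x‖ ^ 2 := by
      rw [← mul_pow]
      exact pow_le_pow_left₀ (norm_nonneg _) (hTx k) 2
    have h4 : (s ^ k) ^ 2 ≤ s ^ k :=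
      pow_le_of_le_one (by positivity) (pow_le_one₀ hs0 hs1.le) two_ne_zero
    exact mul_le_mul h3 h4 (by positivity) (by positivity)
  have hN := (sum_le_hasSum N (fun k _ => by positivity) hF).trans
    (hle.trans (mul_le_mul_of_nonneg_left hGle (sq_nonneg M)))
  simp only [han] at hN
  rw [← Finset.mul_sum, mul_left_comm] at hN
  exact le_of_mul_le_mul_left hN (by positivity)

theorem norm_pow_mul_le_of_forall_norm_mul_resolventSeries_le (hK : ∀ n : ℕ, ‖T ^ n‖ ≤ K)
    (n : ℕ) (hn : 1 ≤ n) (B : X →L[ℂ] X) (hB : Commute T B) (l : ℕ) {M : ℝ}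
    (hM : ∀ w : ℂ, ‖w‖ = n / (n + 1) → ‖B * resolventSeries T 0 w ^ l‖ ≤ M) :
    ‖T ^ n * B‖ ≤ 3 * (l + 1).factorial * K ^ 2 * M / (n + 1) ^ l := by
  have hn0 : (0:ℝ) < n := by exact_mod_cast hn
  set s : ℝ := n / (n + 1) with hs
  have hs0 : 0 < s := by positivity
  have hs1 : s < 1 := by rw [hs, div_lt_one (by positivity)]; linarith
  have hM0 : 0 ≤ M := (norm_nonneg _).trans (hM s (by simp [abs_of_nonneg hs0.le]))
  have hK0 : 0 ≤ K := (norm_nonneg _).trans (hK 0)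
  have hsn : 1 ≤ 3 * s ^ n := by
    have h1 : (s ^ n)⁻¹ ≤ 3 := by
      have h2 : s⁻¹ = 1 + (n : ℝ)⁻¹ := by rw [hs]; field_simp
      rw [← inv_pow, h2]
      exact Real.one_add_inv_pow_le_exp.trans (Real.exp_one_lt_d9.le.trans (by norm_num))
    rwa [inv_le_iff_one_le_mul₀ (by positivity)] at h1
  refine ContinuousLinearMap.opNorm_le_bound _ (by positivity) fun x => ?_
  set y := ‖(T ^ n * B) x‖ with hy
  have hy0 : 0 ≤ y := norm_nonneg _
  have hyk : ∀ k ∈ Finset.range (n + 1), y ≤ K * ‖B ((T ^ k) x)‖ := by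
    intro k hk
    have hkn : k ≤ n := by simpa [Nat.lt_succ_iff] using hk
    have : T ^ n * B = T ^ (n - k) * (B * T ^ k) := by
      rw [← (hB.pow_left k).eq, ← mul_assoc, ← pow_add, Nat.sub_add_cancel hkn]
    rw [hy, this]
    exact (T ^ (n - k)).le_of_opNorm_le (hK _) _
  have hmain := sum_sq_choose_mul_pow_le hK hs0.le hs1 B l hM x (Finset.range (n + 1))
  have h1s : 1 - s = 1 / (n + 1) := by rw [hs]; field_simp; ring
  rw [h1s] at hmain
  have hcs := sq_sum_le_card_mul_sum_sq (s := Finset.range (n + 1))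
    (f := fun k => ((k + l).choose l : ℝ) * s ^ k * ‖B ((T ^ k) x)‖)
  rw [Finset.card_range] at hcs
  have hlow : ((n + l + 1).choose (l + 1) : ℝ) * s ^ n * y ≤
      K * ∑ k ∈ Finset.range (n + 1), ((k + l).choose l : ℝ) * s ^ k * ‖B ((T ^ k) x)‖ := by
    rw [← Nat.sum_range_add_choose, Nat.cast_sum, Finset.sum_mul, Finset.sum_mul, Finset.mul_sum]
    refine Finset.sum_le_sum fun k hk => ?_
    have hkn : k ≤ n := by simpa [Nat.lt_succ_iff] using hk
    have h1 : s ^ n ≤ s ^ k := pow_le_pow_of_le_one hs0.le hs1.le hkn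
    calc ((k + l).choose l : ℝ) * s ^ n * y
        ≤ ((k + l).choose l : ℝ) * s ^ k * (K * ‖B ((T ^ k) x)‖) := by
          gcongr
          exact hyk k hk
      _ = _ := by ring
  have hS : ∑ k ∈ Finset.range (n + 1), ((k + l).choose l : ℝ) * s ^ k * ‖B ((T ^ k) x)‖ ≤
      (n + 1) * (M * K * ‖x‖) := by
    refine le_of_sq_le_sq ?_ (by positivity)
    refine hcs.trans ?_
    calc _ ≤ ((n + 1 : ℕ) : ℝ) * (M ^ 2 * (K ^ 2 * ‖x‖ ^ 2 / (1 / (n + 1)))) := by gcongr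
      _ = _ := by push_cast; field_simp
  have hch : ((n : ℝ) + 1) ^ (l + 1) / (l + 1).factorial ≤ ((n + l + 1).choose (l + 1) : ℝ) := by
    have := Nat.pow_le_choose (α := ℝ) (l + 1) (n + l + 1)
    rwa [show n + l + 1 + 1 - (l + 1) = n + 1 by omega, Nat.cast_add_one] at this
  have hfac : (0:ℝ) < (l + 1).factorial := by positivity
  have h5 : ((n : ℝ) + 1) ^ (l + 1) / (l + 1).factorial * s ^ n * y ≤
      K * ((n + 1) * (M * K * ‖x‖)) :=
    le_trans (by gcongr) (hlow.trans (mul_le_mul_of_nonneg_left hS hK0))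
  have hp : (0:ℝ) < n + 1 := by positivity
  rw [div_mul_eq_mul_div, le_div_iff₀ (by positivity)]
  have h6 : ((n : ℝ) + 1) ^ l * s ^ n * y ≤ (l + 1).factorial * (K ^ 2 * M * ‖x‖) := by
    rw [div_mul_eq_mul_div, div_mul_eq_mul_div, div_le_iff₀ hfac, pow_succ] at h5
    refine le_of_mul_le_mul_right ?_ hp
    linarith [h5]
  calc y * (n + 1) ^ l = 1 * (((n : ℝ) + 1) ^ l * y) := by ring
    _ ≤ 3 * s ^ n * (((n : ℝ) + 1) ^ l * y) := by gcongr
    _ = 3 * (((n : ℝ) + 1) ^ l * s ^ n * y) := by ring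
    _ ≤ 3 * ((l + 1).factorial * (K ^ 2 * M * ‖x‖)) := by gcongr
    _ = _ := by ring

end Plancherel
section ResolventEstimate

variable {X : Type*} [NormedAddCommGroup X] [NormedSpace ℂ X] {T : X →L[ℂ] X} {K : ℝ}

theorem exists_inverse_one_sub_smul {u : ℂ} (hu : ‖u‖ = 1) (h : u⁻¹ ∉ spectrum ℂ T) :
    ∃ Q : X →L[ℂ] X, (1 - u • T) * Q = 1 ∧ ‖Q‖ = ‖resolvent T u⁻¹‖ := by
  have hu0 : u ≠ 0 := by rintro rfl; simp at hu
  refine ⟨u⁻¹ • resolvent T u⁻¹, ?_, by rw [norm_smul, norm_inv, hu]; simp⟩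
  have h1 := Ring.mul_inverse_cancel _ (spectrum.notMem_iff.1 h)
  have h2 : (1 - u • T) = u • (algebraMap ℂ (X →L[ℂ] X) u⁻¹ - T) := by
    rw [Algebra.algebraMap_eq_smul_one, smul_sub, smul_smul, mul_inv_cancel₀ hu0, one_smul]
  rw [resolvent, h2, smul_mul_smul_comm, mul_inv_cancel₀ hu0, one_smul, h1]

variable [CompleteSpace X]

theorem norm_one_sub_mul_resolventSeries_pow_le (hK : ∀ n : ℕ, ‖T ^ n‖ ≤ K) {w : ℂ}
    (hw0 : w ≠ 0) (hw : ‖w‖ < 1) (j : ℕ) :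
    ‖(1 - T) * resolventSeries T 0 w ^ (j + 1)‖ ≤
      ‖w‖⁻¹ * (‖resolventSeries T 0 w ^ j‖ + ‖1 - w‖ * ‖resolventSeries T 0 w ^ (j + 1)‖) := by
  set U := resolventSeries T 0 w
  have hU : (1 - w • T) * U = 1 := one_sub_smul_mul_resolventSeries_zero hK hw
  have h : (1 - T) * U ^ (j + 1) = w⁻¹ • (U ^ j - (1 - w) • U ^ (j + 1)) := by
    rw [eq_inv_smul_iff₀ hw0]
    have h1 : w • ((1 - T) * U ^ (j + 1)) =
        ((1 - w • T) * U) * U ^ j - (1 - w) • U ^ (j + 1) := by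
      rw [mul_assoc, ← pow_succ', sub_mul, sub_mul, sub_smul, smul_sub, smul_mul_assoc]
      simp
    rw [h1, hU, one_mul]
  rw [h, norm_smul, norm_inv]
  gcongr
  exact (norm_sub_le _ _).trans (by rw [norm_smul])

theorem norm_resolventSeries_le_of_inverse (hK : ∀ n : ℕ, ‖T ^ n‖ ≤ K) {w u : ℂ}
    (hw : ‖w‖ < 1) (hu : ‖u - w‖ ≤ 1 - ‖w‖) {Q : X →L[ℂ] X} (hQ : (1 - u • T) * Q = 1) :
    ‖resolventSeries T 0 w‖ ≤ (1 + K ^ 2) * ‖Q‖ := by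
  set U := resolventSeries T 0 w
  have hU : U * (1 - w • T) = 1 := resolventSeries_zero_mul_one_sub_smul hK hw
  have hK0 : 0 ≤ K := (norm_nonneg _).trans (hK 0)
  have hw' : 0 < 1 - ‖w‖ := by linarith
  have h : U = Q - (u - w) • (U * T * Q) := by
    have h1 : (u - w) • (U * T * Q) = U * (1 - w • T) * Q - U * ((1 - u • T) * Q) := by
      simp only [sub_smul, mul_sub, sub_mul, mul_one, one_mul, smul_mul_assoc, mul_smul_comm,
        mul_assoc]
      abel
    rw [h1, hU, hQ]
    simp
  have hUn : ‖U‖ ≤ K / (1 - ‖w‖) := norm_resolventSeries_zero_le hK hw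
  have hT : ‖T‖ ≤ K := by simpa using hK 1
  have h2 : ‖(u - w) • (U * T * Q)‖ ≤ K ^ 2 * ‖Q‖ := by
    rw [norm_smul]
    calc ‖u - w‖ * ‖U * T * Q‖ ≤ (1 - ‖w‖) * (K / (1 - ‖w‖) * K * ‖Q‖) := by
          gcongr
          exact (norm_mul_le _ _).trans (mul_le_mul_of_nonneg_right
            ((norm_mul_le _ _).trans (mul_le_mul hUn hT (norm_nonneg _) (by positivity)))
            (norm_nonneg _))
      _ = _ := by field_simp
  calc ‖U‖ = ‖Q - (u - w) • (U * T * Q)‖ := by rw [← h]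
    _ ≤ ‖Q‖ + K ^ 2 * ‖Q‖ := (norm_sub_le _ _).trans (by gcongr)
    _ = _ := by ring

end ResolventEstimate

theorem mul_pow_le_of_reciprocally_positive_increase {m : ℝ → ℝ}
    (hmanti : AntitoneOn m (Set.Ioc 0 Real.pi))
    (hmpos : ∀ ε ∈ Set.Ioc (0:ℝ) Real.pi, 0 < m ε)
    {c : ℝ} (hc : c ∈ Set.Ioc (0:ℝ) 1) {α : ℝ} (hα : 0 < α)
    {ε₀ : ℝ} (hε₀ : ε₀ ∈ Set.Ioc (0:ℝ) Real.pi)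
    (hrpi : ∀ t ≥ (1:ℝ), ∀ ε ∈ Set.Ioc (0:ℝ) ε₀, c * t ^ α ≤ m (ε / t) / m ε)
    {l : ℕ} (hl : α⁻¹ ≤ l) {ε θ : ℝ} (hε : 0 < ε) (hεθ : ε ≤ θ) (hθ : θ ≤ Real.pi) :
    θ * m θ ^ l ≤ Real.pi / ε₀ * (ε * (m ε / c) ^ l) := by
  obtain ⟨hc0, hc1⟩ := hc
  obtain ⟨hε₀0, hε₀π⟩ := hε₀
  have hθ0 : 0 < θ := hε.trans_le hεθ
  have hmε : 0 < m ε := hmpos ε ⟨hε, hεθ.trans hθ⟩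
  have hmθ : 0 < m θ := hmpos θ ⟨hθ0, hθ⟩
  have hD : 1 ≤ Real.pi / ε₀ := (one_le_div hε₀0).2 hε₀π
  have hsmall : ∀ φ, ε ≤ φ → φ ≤ ε₀ → φ * m φ ^ l ≤ ε * (m ε / c) ^ l := by
    intro φ hφ hφ0
    have hφp : 0 < φ := hε.trans_le hφ
    have hmφ : 0 < m φ := hmpos φ ⟨hφp, hφ0.trans hε₀π⟩
    have ht : 1 ≤ φ / ε := (one_le_div hε).2 hφ
    have h1 := hrpi (φ / ε) ht φ ⟨hφp, hφ0⟩
    rw [div_div_cancel₀ hφp.ne', le_div_iff₀ hmφ] at h1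
    have h2 : (φ / ε) ^ α * m φ ≤ m ε / c := by
      rw [le_div_iff₀ hc0]
      linarith
    have h3 : φ / ε ≤ ((φ / ε) ^ α) ^ l := by
      rw [← Real.rpow_mul_natCast (by positivity)]
      refine Real.self_le_rpow_of_one_le ht ?_
      have := mul_le_mul_of_nonneg_left hl hα.le
      rwa [mul_inv_cancel₀ hα.ne'] at this
    calc φ * m φ ^ l = ε * (φ / ε * m φ ^ l) := by field_simp
      _ ≤ ε * (((φ / ε) ^ α) ^ l * m φ ^ l) := by gcongr
      _ = ε * ((φ / ε) ^ α * m φ) ^ l := by rw [mul_pow]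
      _ ≤ ε * (m ε / c) ^ l := by gcongr
  by_cases h1 : θ ≤ ε₀
  · exact (hsmall θ hεθ h1).trans (le_mul_of_one_le_left (by positivity) hD)
  push Not at h1
  by_cases h2 : ε ≤ ε₀
  · have h3 := hsmall ε₀ h2 le_rfl
    have h4 : m θ ≤ m ε₀ := hmanti ⟨hε₀0, hε₀π⟩ ⟨hθ0, hθ⟩ h1.le
    calc θ * m θ ^ l ≤ Real.pi * m ε₀ ^ l := by gcongr
      _ = Real.pi / ε₀ * (ε₀ * m ε₀ ^ l) := by field_simp
      _ ≤ _ := by gcongr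
  · push Not at h2
    have h4 : m θ ≤ m ε := hmanti ⟨hε, hεθ.trans hθ⟩ ⟨hθ0, hθ⟩ hεθ
    have h5 : m ε ≤ m ε / c := le_div_self hmε.le hc0 hc1
    calc θ * m θ ^ l ≤ Real.pi * (m ε / c) ^ l := by
          gcongr
          exact h4.trans h5
      _ = Real.pi / ε₀ * (ε₀ * (m ε / c) ^ l) := by field_simp
      _ ≤ _ := by gcongr

/-- Key estimate in the proof of the main theorem: with `ℓ = ⌈1/α⌉`, for all `n ≥ 1` and
`ε ∈ (0,1]`, `‖Tⁿ(I-T)‖ ≤ C ε ((m(ε)/(cn))^ℓ + Σ_{j=0}^{ℓ} (εn)^{-j})`. -/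
theorem kt_key_estimate {X : Type*} [NormedAddCommGroup X] [InnerProductSpace ℂ X]
    [CompleteSpace X]
    (T : X →L[ℂ] X) (hpb : ∃ K : ℝ, ∀ n : ℕ, ‖T ^ n‖ ≤ K)
    (hspec : spectrum ℂ T ∩ {z : ℂ | ‖z‖ = 1} = {1})
    (m : ℝ → ℝ)
    (hmc : ContinuousOn m (Set.Ioc 0 Real.pi))
    (hmanti : AntitoneOn m (Set.Ioc 0 Real.pi))
    (hmpos : ∀ ε ∈ Set.Ioc (0:ℝ) Real.pi, 0 < m ε)
    (hres : ∀ θ : ℝ, 0 < |θ| → |θ| ≤ Real.pi →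
      ‖resolvent T (Complex.exp (Complex.I * θ))‖ ≤ m |θ|)
    (c : ℝ) (hc : c ∈ Set.Ioc (0:ℝ) 1) (α : ℝ) (hα : 0 < α)
    (ε₀ : ℝ) (hε₀ : ε₀ ∈ Set.Ioc (0:ℝ) Real.pi)
    (hrpi : ∀ t ≥ (1:ℝ), ∀ ε ∈ Set.Ioc (0:ℝ) ε₀, c * t ^ α ≤ m (ε / t) / m ε) :
    ∃ C > (0:ℝ), ∀ n : ℕ, 1 ≤ n → ∀ ε ∈ Set.Ioc (0:ℝ) 1,
      ‖T ^ n * (1 - T)‖ ≤ C * ε * ((m ε / (c * n)) ^ (⌈α⁻¹⌉₊) +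
        ∑ j ∈ Finset.range (⌈α⁻¹⌉₊ + 1), ((ε * n) ^ j)⁻¹) := by
  obtain ⟨K', hK'⟩ := hpb
  obtain ⟨K, hK1, hK⟩ : ∃ K : ℝ, 1 ≤ K ∧ ∀ n : ℕ, ‖T ^ n‖ ≤ K :=
    ⟨max K' 1, le_max_right _ _, fun n => (hK' n).trans (le_max_left _ _)⟩
  have hK0 : 0 ≤ K := zero_le_one.trans hK1
  set l := ⌈α⁻¹⌉₊ with hl
  have hlα : α⁻¹ ≤ l := Nat.le_ceil _
  obtain ⟨j, hj⟩ : ∃ j, l = j + 1 :=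
    Nat.exists_eq_succ_of_ne_zero (Nat.ceil_pos.2 (inv_pos.2 hα)).ne'
  set D := Real.pi / ε₀
  have hD : 0 < D := div_pos Real.pi_pos hε₀.1
  set B₀ := 2 * ((1 + K) * K ^ j)
  set B₁ := 2 * K ^ l
  set B₂ := 2 * ((1 + K ^ 2) ^ l * D)
  have hB₀ : 0 < B₀ := by positivity
  have hB₁ : 0 < B₁ := by positivity
  have hB₂ : 0 < B₂ := by positivity
  set A := 3 * (l + 1).factorial * K ^ 2
  have hA : 0 < A := by positivity
  refine ⟨A * (B₀ + B₁ + B₂), by positivity, fun n hn ε hε => ?_⟩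
  obtain ⟨hε0, hε1⟩ := hε
  have hεπ : ε ≤ Real.pi := hε1.trans (by linarith [Real.pi_gt_three])
  have hmε : 0 < m ε := hmpos ε ⟨hε0, hεπ⟩
  have hc0 : 0 < c := hc.1
  have hn1 : (1:ℝ) ≤ n := by exact_mod_cast hn
  have hn0 : (0:ℝ) < n := by linarith
  set p : ℝ := n + 1 with hp
  have hp0 : 0 < p := by positivity
  have hbound : ∀ w : ℂ, ‖w‖ = n / (n + 1) → ‖(1 - T) * resolventSeries T 0 w ^ l‖ ≤
      B₀ * p ^ j + B₁ * (ε * p ^ l) + B₂ * (ε * (m ε / c) ^ l) := by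
    intro w hw
    rw [← hp] at hw
    have hw1 : 1 - ‖w‖ = p⁻¹ := by rw [hw, hp]; field_simp; ring
    have hwlt : ‖w‖ < 1 := by have := inv_pos.2 hp0; linarith
    have hwpos : 0 < ‖w‖ := by rw [hw]; positivity
    have hw0 : w ≠ 0 := norm_pos_iff.1 hwpos
    have hwinv : ‖w‖⁻¹ ≤ 2 := by
      rw [hw, inv_div, div_le_iff₀ hn0]
      linarith
    set U := resolventSeries T 0 w with hUdef
    have hUn : ‖U‖ ≤ K * p := by
      have := norm_resolventSeries_zero_le hK hwlt
      rwa [hw1, div_inv_eq_mul] at this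
    have hUj : ‖U ^ j‖ ≤ (K * p) ^ j := by
      rcases j.eq_zero_or_pos with h | h
      · rw [h, pow_zero, pow_zero]
        exact ContinuousLinearMap.norm_id_le
      · exact (norm_pow_le' U h).trans (pow_le_pow_left₀ (norm_nonneg _) hUn j)
    have hUl : ‖U ^ l‖ ≤ ‖U‖ ^ l := by
      rw [hj]
      exact norm_pow_le' U j.succ_pos
    have hUl' : ‖U ^ l‖ ≤ (K * p) ^ l := hUl.trans (pow_le_pow_left₀ (norm_nonneg _) hUn l)
    set θ := (w⁻¹).arg with hθ
    set u : ℂ := Complex.exp (-(Complex.I * θ)) with hu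
    have huinv : u⁻¹ = Complex.exp (Complex.I * θ) := by rw [hu, Complex.exp_neg, inv_inv]
    have hun : ‖u‖ = 1 := by
      rw [hu, show -(Complex.I * (θ : ℂ)) = ((-θ : ℝ) : ℂ) * Complex.I by push_cast; ring]
      exact Complex.norm_exp_ofReal_mul_I _
    have hu0 : u ≠ 0 := by rw [hu]; exact Complex.exp_ne_zero _
    have hwu : w = ‖w‖ * u := by
      have h1 := Complex.norm_mul_exp_arg_mul_I w⁻¹
      rw [← hθ, mul_comm (θ : ℂ), ← huinv, norm_inv] at h1
      push_cast at h1
      rw [← mul_inv] at h1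
      exact (inv_injective h1).symm
    have huw : ‖u - w‖ = 1 - ‖w‖ := by
      have : u - w = ((1 - ‖w‖ : ℝ) : ℂ) * u := by
        push_cast
        rw [sub_mul, one_mul, ← hwu]
      rw [this, norm_mul, hun, mul_one, Complex.norm_real, Real.norm_of_nonneg (by linarith)]
    have h1u : ‖1 - u‖ ≤ |θ| := by
      have h1 := Real.norm_exp_I_mul_ofReal_sub_one_le (x := -θ)
      rw [norm_neg, Real.norm_eq_abs] at h1
      rw [norm_sub_rev, hu]
      simpa using h1
    have h1w : ‖1 - w‖ ≤ |θ| + p⁻¹ := by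
      calc ‖1 - w‖ = ‖(1 - u) + (u - w)‖ := by congr 1; ring
        _ ≤ |θ| + p⁻¹ := (norm_add_le _ _).trans (add_le_add h1u (by rw [huw, hw1]))
    have hθU : |θ| * ‖U ^ l‖ ≤
        K ^ l * (ε * p ^ l) + (1 + K ^ 2) ^ l * D * (ε * (m ε / c) ^ l) := by
      rcases le_total |θ| ε with h | h
      · calc |θ| * ‖U ^ l‖ ≤ ε * (K * p) ^ l := by gcongr
          _ = K ^ l * (ε * p ^ l) := by rw [mul_pow]; ring
          _ ≤ _ := le_add_of_nonneg_right (by positivity)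
      · have hθ0 : 0 < |θ| := hε0.trans_le h
        have hθπ : |θ| ≤ Real.pi := Complex.abs_arg_le_pi _
        have huspec : u⁻¹ ∉ spectrum ℂ T := by
          intro hmem
          have h1 : u⁻¹ ∈ ({1} : Set ℂ) := by
            rw [← hspec]
            exact ⟨hmem, by simp [hun]⟩
          have h2 : u = 1 := by simpa using h1
          rw [h2] at hwu
          have h3 : w⁻¹ = ((‖w‖⁻¹ : ℝ) : ℂ) := by
            push_cast
            rw [hwu]
            simp
          rw [hθ, h3, Complex.arg_ofReal_of_nonneg (by positivity), abs_zero] at hθ0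
          exact lt_irrefl _ hθ0
        obtain ⟨Q, hQ, hQn⟩ := exists_inverse_one_sub_smul hun huspec
        have hQm : ‖Q‖ ≤ m |θ| := by
          rw [hQn, huinv]
          exact hres θ hθ0 hθπ
        have hUm : ‖U‖ ≤ (1 + K ^ 2) * m |θ| :=
          (norm_resolventSeries_le_of_inverse hK hwlt huw.le hQ).trans (by gcongr)
        have hrp := mul_pow_le_of_reciprocally_positive_increase hmanti hmpos hc hα hε₀ hrpi
          hlα hε0 h hθπ
        calc |θ| * ‖U ^ l‖ ≤ |θ| * ((1 + K ^ 2) * m |θ|) ^ l := by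
              gcongr
              exact hUl.trans (pow_le_pow_left₀ (norm_nonneg _) hUm l)
          _ = (1 + K ^ 2) ^ l * (|θ| * m |θ| ^ l) := by rw [mul_pow]; ring
          _ ≤ (1 + K ^ 2) ^ l * (D * (ε * (m ε / c) ^ l)) := by gcongr
          _ = (1 + K ^ 2) ^ l * D * (ε * (m ε / c) ^ l) := by ring
          _ ≤ _ := le_add_of_nonneg_left (by positivity)
    have hpU : p⁻¹ * ‖U ^ l‖ ≤ K * (K * p) ^ j := by
      calc p⁻¹ * ‖U ^ l‖ ≤ p⁻¹ * (K * p) ^ l := by gcongr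
        _ = K * (K * p) ^ j := by rw [hj, pow_succ]; field_simp
    have hmain := norm_one_sub_mul_resolventSeries_pow_le hK hw0 hwlt j
    rw [← hj, ← hUdef] at hmain
    calc ‖(1 - T) * U ^ l‖ ≤ 2 * ((K * p) ^ j + (|θ| + p⁻¹) * ‖U ^ l‖) :=
          hmain.trans (by gcongr)
      _ = 2 * ((K * p) ^ j + |θ| * ‖U ^ l‖ + p⁻¹ * ‖U ^ l‖) := by ring
      _ ≤ 2 * ((K * p) ^ j + (K ^ l * (ε * p ^ l) +
          (1 + K ^ 2) ^ l * D * (ε * (m ε / c) ^ l)) + K * (K * p) ^ j) := by gcongr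
      _ = _ := by simp only [B₀, B₁, B₂, mul_pow]; ring
  have hfin := norm_pow_mul_le_of_forall_norm_mul_resolventSeries_le hK n hn (1 - T)
    ((Commute.one_right T).sub_right (Commute.refl T)) l hbound
  have hnp : (n : ℝ) ≤ p := by rw [hp]; linarith
  set S := ∑ i ∈ Finset.range (l + 1), ((ε * n) ^ i)⁻¹ with hS
  have hSi : ∀ i ∈ Finset.range (l + 1), ((ε * n) ^ i)⁻¹ ≤ S := fun i hi =>
    Finset.single_le_sum (f := fun i => ((ε * n) ^ i)⁻¹) (fun i _ => by positivity) hi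
  have hS0 : 1 ≤ S := by simpa using hSi 0 (by simp)
  have hS1 : (ε * n)⁻¹ ≤ S := by simpa using hSi 1 (by simp [hj])
  set G := (m ε / (c * n)) ^ l with hG
  have hG0 : 0 ≤ G := by positivity
  have e0 : p ^ j / p ^ l ≤ ε * (G + S) := by
    calc p ^ j / p ^ l = p⁻¹ := by rw [hj, pow_succ]; field_simp
      _ ≤ (n : ℝ)⁻¹ := by gcongr
      _ = ε * (ε * n)⁻¹ := by field_simp
      _ ≤ ε * (G + S) := by gcongr; linarith
  have e1 : ε * p ^ l / p ^ l ≤ ε * (G + S) := by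
    rw [mul_div_assoc, div_self (by positivity)]
    gcongr
    linarith
  have e2 : ε * (m ε / c) ^ l / p ^ l ≤ ε * (G + S) := by
    rw [mul_div_assoc, ← div_pow, div_div]
    gcongr
    calc (m ε / (c * p)) ^ l ≤ G := by rw [hG]; gcongr
      _ ≤ G + S := by linarith
  calc ‖T ^ n * (1 - T)‖
      ≤ A * (B₀ * p ^ j + B₁ * (ε * p ^ l) + B₂ * (ε * (m ε / c) ^ l)) / p ^ l := hfin
    _ = A * (B₀ * (p ^ j / p ^ l) + B₁ * (ε * p ^ l / p ^ l) +
        B₂ * (ε * (m ε / c) ^ l / p ^ l)) := by ring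
    _ ≤ A * (B₀ * (ε * (G + S)) + B₁ * (ε * (G + S)) + B₂ * (ε * (G + S))) := by gcongr
    _ = A * (B₀ + B₁ + B₂) * ε * (G + S) := by ring
end
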